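/- For any k-bounded partition λ, Ω(g^{(k)}_λ) = g^{(k)}_{λ^{ω_k}}, where Ω is the ℤ-algebra endomorphism of Λ determined by Ω(h_ℓ) = Σ_{j=1}^{ℓ} binom(ℓ−1, j−1) e_j and λ^{ω_k} = 𝔭(𝔠(λ)′) is the k-conjugate of λ. -/

import Mathlib

open scoped Classical

namespace AffineKTheory

noncomputable instance : Nonempty YoungDiagram := ⟨⊥⟩

noncomputable instance : Nonempty YoungDiagram := ⟨⊥⟩

/-! ## Cells, hooks, cores, residues -/

/-- Hook length of the cell `(r, c)` in the diagram `γ`. -/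
def hookLen (γ : YoungDiagram) (r c : ℕ) : ℕ :=
  (γ.rowLen r - c) + (γ.colLen c - r) - 1

/-- A `p`-core: a diagram none of whose cells has hook length `p`. -/
def IsCore (p : ℕ) (γ : YoungDiagram) : Prop :=
  ∀ c : ℕ × ℕ, c ∈ γ → hookLen γ c.1 c.2 ≠ p

/-- The `(k+1)`-residue of a cell.  (Rows of the Ferrers shape are indexed so that the cell
directly above `(r, c)` -- in the Ferrers sense of the next, shorter, row -- is `(r+1, c)`.) -/
def residue (k : ℕ) (c : ℕ × ℕ) : ZMod (k + 1) :=
  (c.2 : ZMod (k + 1)) - (c.1 : ZMod (k + 1))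

/-- A removable corner of `γ`: a cell of `γ` with no cell above it nor to its right. -/
def Removable (γ : YoungDiagram) (c : ℕ × ℕ) : Prop :=
  c ∈ γ ∧ (c.1 + 1, c.2) ∉ γ ∧ (c.1, c.2 + 1) ∉ γ

/-- An addable corner of `γ`: a cell outside `γ` whose addition again yields a partition shape. -/
def Addable (γ : YoungDiagram) (c : ℕ × ℕ) : Prop :=
  c ∉ γ ∧ ∀ d : ℕ × ℕ, d ≤ c → d ≠ c → d ∈ γ

/-- A cell is `γ`-blocked if it lies below a cell of `γ`. -/
def Blocked (γ : YoungDiagram) (c : ℕ × ℕ) : Prop :=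
  (c.1 + 1, c.2) ∈ γ

/-- The number of cells of `γ` in row `i` whose hook length is at most `k`:
the `i`-th part of `𝔭(γ)`. -/
noncomputable def pRow (k : ℕ) (γ : YoungDiagram) (i : ℕ) : ℕ :=
  (γ.cells.filter (fun c => c.1 = i ∧ hookLen γ c.1 c.2 ≤ k)).card

/-- The number of cells of `γ` with `k`-bounded hook length, i.e. `|𝔭(γ)|`. -/
noncomputable def pSize (k : ℕ) (γ : YoungDiagram) : ℕ :=
  (γ.cells.filter (fun c => hookLen γ c.1 c.2 ≤ k)).card

/-- A `k`-bounded partition: all parts at most `k`. -/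
def IsKBounded (k : ℕ) (lam : YoungDiagram) : Prop :=
  ∀ i, lam.rowLen i ≤ k

/-- `𝔭(γ)`: the `k`-bounded partition obtained from a `(k+1)`-core `γ` by deleting every cell of
hook length greater than `k` and reading off row lengths. -/
noncomputable def pPart (k : ℕ) (γ : YoungDiagram) : YoungDiagram :=
  Classical.epsilon fun lam => ∀ i, lam.rowLen i = pRow k γ i

/-- `𝔠(λ)`: the unique `(k+1)`-core corresponding to the `k`-bounded partition `λ` under the
bijection `𝔭`. -/
noncomputable def coreOf (k : ℕ) (lam : YoungDiagram) : YoungDiagram :=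
  Classical.epsilon fun γ => IsCore (k + 1) γ ∧ ∀ i, pRow k γ i = lam.rowLen i

/-- The `k`-conjugate `λ^{ω_k} = 𝔭(𝔠(λ)')` of a `k`-bounded partition. -/
noncomputable def kConj (k : ℕ) (lam : YoungDiagram) : YoungDiagram :=
  pPart k ((coreOf k lam).transpose)

/-- A `k`-bounded composition: a list of parts, each between `1` and `k`. -/
def IsKBoundedComp (k : ℕ) (α : List ℕ) : Prop :=
  ∀ a ∈ α, 1 ≤ a ∧ a ≤ k

/-- Dominance order on partitions. -/
def Dominates (mu lam : YoungDiagram) : Prop :=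
  mu.card = lam.card ∧
    ∀ n : ℕ, ∑ i ∈ Finset.range n, lam.rowLen i ≤ ∑ i ∈ Finset.range n, mu.rowLen i


/-! ## Set-valued fillings and affine set-valued tableaux -/

/-- A set-valued filling of the shape `γ`: each cell of `γ` carries a finite nonempty set of
positive integers, empty outside `γ`, with `max X < min Y` when `X` is directly below `Y` and
`max X ≤ min Y` when `X` is directly to the left of `Y`. -/
def IsSVFilling (γ : YoungDiagram) (e : ℕ × ℕ → Finset ℕ) : Prop :=
  (∀ c : ℕ × ℕ, c ∈ γ ↔ (e c).Nonempty) ∧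
  (∀ c : ℕ × ℕ, ∀ x ∈ e c, 0 < x) ∧
  (∀ r c : ℕ, ∀ x ∈ e (r, c), ∀ y ∈ e (r + 1, c), x < y) ∧
  (∀ r c : ℕ, ∀ x ∈ e (r, c), ∀ y ∈ e (r, c + 1), x ≤ y)

/-- The set of cells of `T_{≤ x}`: cells containing a letter `≤ x`. -/
noncomputable def shapeLe (γ : YoungDiagram) (e : ℕ × ℕ → Finset ℕ) (x : ℕ) : Finset (ℕ × ℕ) :=
  γ.cells.filter fun c => ∃ y ∈ e c, y ≤ x

/-- A standard affine set-valued tableau of degree `n` and shape `γ`: a set-valued filling with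
letters `1, …, n` such that for each `x`, the shape of `T_{≤x}` is a `(k+1)`-core and the letter
`x` occupies exactly all of its removable corners of one single residue. -/
def IsStdASVT (k n : ℕ) (γ : YoungDiagram) (e : ℕ × ℕ → Finset ℕ) : Prop :=
  IsSVFilling γ e ∧
  (∀ c : ℕ × ℕ, ∀ y ∈ e c, y ≤ n) ∧
  ∀ x : ℕ, 1 ≤ x → x ≤ n →
    ∃ δ : YoungDiagram, IsCore (k + 1) δ ∧ δ.cells = shapeLe γ e x ∧
      ∃ i : ZMod (k + 1), (∃ c, x ∈ e c) ∧
        ∀ c : ℕ × ℕ, x ∈ e c ↔ Removable δ c ∧ residue k c = i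

/-- The alphabet `𝒜_{α,x} = {Σ^{x-1}α + 1, …, Σ^x α}`. -/
def alphaBlock (α : List ℕ) (x : ℕ) : Finset ℕ :=
  Finset.Ioc ((α.take (x - 1)).sum) ((α.take x).sum)

/-- `c` is the lowest occurrence of the letter `y`. -/
def IsLowestOcc (e : ℕ × ℕ → Finset ℕ) (y : ℕ) (c : ℕ × ℕ) : Prop :=
  y ∈ e c ∧ ∀ d : ℕ × ℕ, y ∈ e d → c.1 ≤ d.1

/-- `a` comes strictly before `b` in the reading order (top to bottom, left to right;
higher rows of the Ferrers shape have larger first coordinate here). -/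
def ReadBefore (a b : ℕ × ℕ) : Prop :=
  b.1 < a.1 ∨ (a.1 = b.1 ∧ a.2 < b.2)

/-- An affine set-valued tableau of weight `α` and shape `γ`: a standard affine set-valued
tableau of degree `|α|` such that for each `x`, the lowest reading word in `𝒜_{α,x}` is
increasing, the letters of `𝒜_{α,x}` occupy exactly `α_x` distinct residues, and they form a
horizontal strip. -/
def IsASVT (k : ℕ) (α : List ℕ) (γ : YoungDiagram) (e : ℕ × ℕ → Finset ℕ) : Prop :=
  IsStdASVT k α.sum γ e ∧
  ∀ x : ℕ, 1 ≤ x → x ≤ α.length →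
    (∀ y z : ℕ, y ∈ alphaBlock α x → z ∈ alphaBlock α x → y < z →
      ∀ cy cz : ℕ × ℕ, IsLowestOcc e y cy → IsLowestOcc e z cz → ReadBefore cy cz) ∧
    (((γ.cells.filter fun c => ∃ y ∈ alphaBlock α x, y ∈ e c).image (residue k)).card
        = α.getD (x - 1) 0) ∧
    (∀ c d : ℕ × ℕ, (∃ y ∈ alphaBlock α x, y ∈ e c) → (∃ y ∈ alphaBlock α x, y ∈ e d) →
      c.2 = d.2 → c = d)

/-- `𝒦^{(k)}_{λα}`: the number of affine set-valued tableaux of shape `𝔠(λ)` and weight `α`. -/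
noncomputable def Kcal (k : ℕ) (lam : YoungDiagram) (α : List ℕ) : ℕ :=
  Nat.card {e : ℕ × ℕ → Finset ℕ // IsASVT k α (coreOf k lam) e}

/-- A `k`-tableau of shape `γ` and weight `α`: a semistandard filling with letters `1,…,ℓ(α)`
(recorded as `0` outside `γ`) in which the letter `i` occupies exactly `α_i` distinct residues. -/
def IsKTab (k : ℕ) (α : List ℕ) (γ : YoungDiagram) (u : ℕ × ℕ → ℕ) : Prop :=
  (∀ c : ℕ × ℕ, c ∈ γ ↔ u c ≠ 0) ∧
  (∀ c : ℕ × ℕ, u c ≤ α.length) ∧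
  (∀ r c : ℕ, (r, c) ∈ γ → (r + 1, c) ∈ γ → u (r, c) < u (r + 1, c)) ∧
  (∀ r c : ℕ, (r, c) ∈ γ → (r, c + 1) ∈ γ → u (r, c) ≤ u (r, c + 1)) ∧
  ∀ i : ℕ, 1 ≤ i → i ≤ α.length →
    ((γ.cells.filter fun c => u c = i).image (residue k)).card = α.getD (i - 1) 0

/-- `K^{(k)}_{λα}`: the number of `k`-tableaux of shape `𝔠(λ)` and weight `α`. -/
noncomputable def Kktab (k : ℕ) (lam : YoungDiagram) (α : List ℕ) : ℕ :=
  Nat.card {u : ℕ × ℕ → ℕ // IsKTab k α (coreOf k lam) u}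

/-- A plain set-valued tableau of shape `λ` and weight `α`. -/
def IsSVT (α : List ℕ) (lam : YoungDiagram) (e : ℕ × ℕ → Finset ℕ) : Prop :=
  IsSVFilling lam e ∧ (∀ c : ℕ × ℕ, ∀ x ∈ e c, x ≤ α.length) ∧
  ∀ i : ℕ, 1 ≤ i → i ≤ α.length →
    (lam.cells.filter fun c => i ∈ e c).card = α.getD (i - 1) 0

/-- `𝒦_{λα}`: the number of set-valued tableaux of shape `λ` and weight `α`. -/
noncomputable def KcalSV (lam : YoungDiagram) (α : List ℕ) : ℕ :=
  Nat.card {e : ℕ × ℕ → Finset ℕ // IsSVT α lam e}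


/-! ## The ring of symmetric functions, realized as `Λ ≅ ℤ[h₁, h₂, …]`,
the free polynomial ring on the complete homogeneous symmetric functions
(variable `n` is `h_{n+1}`). -/

abbrev SymFunc := MvPolynomial ℕ ℤ

/-- The complete homogeneous symmetric function `h_r` (`h_0 = 1`). -/
noncomputable def hSym : ℕ → SymFunc
  | 0 => 1
  | n + 1 => MvPolynomial.X n

/-- The elementary symmetric function
`e_n = Σ_{α ⊨ n} (-1)^{n - ℓ(α)} h_α` (sum over compositions of `n`). -/
noncomputable def eSym (n : ℕ) : SymFunc :=
  ∑ c : Composition n, (-1 : SymFunc) ^ (n - c.length) * (c.blocks.map hSym).prod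

/-- `h_λ = h_{λ_1} ⋯ h_{λ_ℓ}` for a partition `λ`. -/
noncomputable def hProd (lam : YoungDiagram) : SymFunc :=
  (lam.rowLens.map hSym).prod

/-- `Λ^{(k)} = ℤ[h_1, …, h_k]` as a subalgebra of `Λ`. -/
noncomputable def LambdaK (k : ℕ) : Subalgebra ℤ SymFunc :=
  MvPolynomial.supported ℤ {n : ℕ | n < k}

/-- The exponent vector of the monomial `h_λ` in the `h`-presentation of `Λ`. -/
noncomputable def hExp (lam : YoungDiagram) : ℕ →₀ ℕ :=
  Multiset.toFinsupp ((lam.rowLens : Multiset ℕ).map fun r => r - 1)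

/-- The coefficient of `h_λ` in the expansion of `p ∈ Λ` in the basis `{h_λ}`. -/
noncomputable def hCoeff (p : SymFunc) (lam : YoungDiagram) : ℤ :=
  MvPolynomial.coeff (hExp lam) p

/-- The Hall inner product `⟨p, F⟩` of `p ∈ Λ` with a (degree-wise finite) formal series
`F = Σ_ν F(ν) m_ν` in the monomial symmetric functions, characterized by
`⟨h_λ, m_μ⟩ = δ_{λμ}`. -/
noncomputable def hallPair (p : SymFunc) (F : YoungDiagram → ℤ) : ℤ :=
  ∑ᶠ ν : YoungDiagram, hCoeff p ν * F ν

/-- The column dual Grothendieck polynomial `g_{1^m} = Σ_{j=1}^m binom(m-1, j-1) e_j`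
(`g_{1^0} = 1`). -/
noncomputable def gColumn (m : ℕ) : SymFunc :=
  if m = 0 then 1 else ∑ j ∈ Finset.Icc 1 m, (((m - 1).choose (j - 1) : ℤ)) • eSym j

/-- The algebra endomorphism `Ω` of `Λ` with `Ω(h_ℓ) = Σ_{j=1}^ℓ binom(ℓ-1, j-1) e_j`. -/
noncomputable def OmegaMap : SymFunc →ₐ[ℤ] SymFunc :=
  MvPolynomial.aeval fun n => gColumn (n + 1)

/-- Generalized binomial coefficient `C(n, j)` for an arbitrary integer `n`. -/
def genBinom (n : ℤ) (j : ℕ) : ℤ :=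
  if 0 ≤ n then (n.toNat.choose j : ℤ) else (-1) ^ j * ((j + (-n - 1).toNat).choose j : ℤ)



/-! ## The defining systems for (k-K-)Schur-type bases -/

/-- `g` is the family of `k`-`K`-Schur functions: the unique elements of `Λ^{(k)}` with
`h_λ = Σ_{μ ∈ 𝒫^k, |μ| ≤ |λ|} (-1)^{|λ|+|μ|} 𝒦^{(k)}_{μλ} g^{(k)}_μ` for all `λ ∈ 𝒫^k`. -/
def KKSchurSystem (k : ℕ) (g : YoungDiagram → SymFunc) : Prop :=
  (∀ lam : YoungDiagram, IsKBounded k lam → g lam ∈ LambdaK k) ∧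
  ∀ lam : YoungDiagram, IsKBounded k lam →
    hProd lam = ∑ᶠ μ : YoungDiagram,
      if IsKBounded k μ ∧ μ.card ≤ lam.card then
        ((-1 : ℤ) ^ (lam.card + μ.card) * (Kcal k μ lam.rowLens : ℤ)) • g μ
      else 0

/-- `gd` is the family of dual Grothendieck polynomials: determined by
`h_μ = Σ_{|λ| ≤ |μ|} (-1)^{|λ|+|μ|} 𝒦_{λμ} g_λ` for all partitions `μ`. -/
def DualGrothSystem (gd : YoungDiagram → SymFunc) : Prop :=
  ∀ mu : YoungDiagram,
    hProd mu = ∑ᶠ lam : YoungDiagram,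
      if lam.card ≤ mu.card then
        ((-1 : ℤ) ^ (lam.card + mu.card) * (KcalSV lam mu.rowLens : ℤ)) • gd lam
      else 0

/-- `s` is the family of `k`-Schur functions: the unique elements of `Λ^{(k)}` with
`h_λ = s^{(k)}_λ + Σ_{μ ⊳ λ} K^{(k)}_{μλ} s^{(k)}_μ` for all `λ ∈ 𝒫^k`. -/
def KSchurSystem (k : ℕ) (s : YoungDiagram → SymFunc) : Prop :=
  (∀ lam : YoungDiagram, IsKBounded k lam → s lam ∈ LambdaK k) ∧
  ∀ lam : YoungDiagram, IsKBounded k lam →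
    hProd lam = s lam + ∑ᶠ μ : YoungDiagram,
      if IsKBounded k μ ∧ Dominates μ lam ∧ μ ≠ lam then
        (Kktab k μ lam.rowLens : ℤ) • s μ
      else 0

/-! ## Abacus states: the tops of the runners -/

/-- A state of the abacus: the position of the topmost bead on each runner. -/
abbrev Tops (k : ℕ) := ZMod (k + 1) → ℤ

section Tops

variable {k : ℕ}

/-- Move the surplus beads of runner `i - 1` one step up to runner `i`. -/
def raise (i : ZMod (k + 1)) (p : Tops k) : Tops k := fun j =>
  if j = i then p (i - 1) + 1 else if j = i - 1 then p i - 1 else p j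

/-- The `0`-Hecke generator of residue `i`, up to sign: undefined when there is neither an addable
nor a removable corner of residue `i`. -/
noncomputable def step (i : ZMod (k + 1)) (p : Tops k) : Option (Tops k) :=
  if p i < p (i - 1) + 1 then some (raise i p)
  else if p (i - 1) + 1 < p i then some p else none

/-- The carrier sequence of the set of residues `A` at the state `p`. -/
def IsCarrier (A : Finset (ZMod (k + 1))) (p C : Tops k) : Prop :=
  (∀ j ∈ A, C j = max (C (j - 1) + 1) (p j)) ∧ (∀ j ∉ A, C j = p j) ∧
    ∀ j ∈ A, C (j - 1) + 1 ≠ p j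

/-- The state obtained from `p` by means of a carrier sequence. -/
noncomputable def carryOut (A : Finset (ZMod (k + 1))) (p C : Tops k) : Tops k := fun j =>
  if j + 1 ∈ A then min (C j) (p (j + 1) - 1) else C j

/-- The action of the cyclically decreasing element attached to the set of residues `A`. -/
noncomputable def dec (A : Finset (ZMod (k + 1))) (p : Tops k) : Option (Tops k) :=
  if h : ∃ C, IsCarrier A p C then some (carryOut A p h.choose) else none

theorem zmod_reach (i j : ZMod (k + 1)) : ∃ t : ℕ, j = i + t :=
  ⟨(j - i).val, by simp⟩

theorem IsCarrier.ne_univ {A : Finset (ZMod (k + 1))} {p C : Tops k} (h : IsCarrier A p C) :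
    A ≠ Finset.univ := by
  rintro rfl
  have h1 : ∀ j, C (j - 1) + 1 ≤ C j := fun j => by
    have := h.1 j (Finset.mem_univ _); omega
  have h2 : ∀ t : ℕ, C 0 + t ≤ C t := by
    intro t
    induction t with
    | zero => simp
    | succ t ih =>
      have := h1 ((t + 1 : ℕ) : ZMod (k + 1))
      push_cast at this ⊢
      rw [add_sub_cancel_right] at this
      omega
  have := h2 (k + 1)
  rw [ZMod.natCast_self] at this
  push_cast at this
  omega

theorem IsCarrier.unique {A : Finset (ZMod (k + 1))} {p C D : Tops k} (hC : IsCarrier A p C)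
    (hD : IsCarrier A p D) : C = D := by
  obtain ⟨i, hi⟩ : ∃ i, i ∉ A := by
    by_contra! h
    exact hC.ne_univ (Finset.eq_univ_iff_forall.2 h)
  have key : ∀ t : ℕ, C (i + t) = D (i + t) := by
    intro t
    induction t with
    | zero => simp [hC.2.1 i hi, hD.2.1 i hi]
    | succ t ih =>
      have e : i + ((t + 1 : ℕ) : ZMod (k + 1)) - 1 = i + t := by push_cast; ring
      by_cases hA : i + ((t + 1 : ℕ) : ZMod (k + 1)) ∈ A
      · rw [hC.1 _ hA, hD.1 _ hA, e, ih]
      · rw [hC.2.1 _ hA, hD.2.1 _ hA]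
  funext j
  obtain ⟨t, rfl⟩ := zmod_reach i j
  exact key t

theorem dec_eq_some {A : Finset (ZMod (k + 1))} {p q : Tops k} :
    dec A p = some q ↔ ∃ C, IsCarrier A p C ∧ carryOut A p C = q := by
  unfold dec
  split_ifs with h
  · constructor
    · intro e
      exact ⟨h.choose, h.choose_spec, by simpa using e⟩
    · rintro ⟨C, hC, rfl⟩
      rw [hC.unique h.choose_spec]
  · simp only [false_iff]
    rintro ⟨C, hC, -⟩
    exact h ⟨C, hC⟩

theorem dec_empty (p : Tops k) : dec ∅ p = some p :=
  dec_eq_some.2 ⟨p, by simp [IsCarrier], by funext j; simp [carryOut]⟩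

theorem step_eq_some {i : ZMod (k + 1)} {p q : Tops k} :
    step i p = some q ↔ (p i < p (i - 1) + 1 ∧ q = raise i p) ∨ (p (i - 1) + 1 < p i ∧ q = p) := by
  unfold step
  split_ifs with h1 h2
  · simp only [Option.some.injEq]
    constructor
    · rintro rfl; exact Or.inl ⟨h1, rfl⟩
    · rintro (⟨_, rfl⟩ | ⟨h, _⟩)
      · rfl
      · omega
  · simp only [Option.some.injEq]
    constructor
    · rintro rfl; exact Or.inr ⟨h2, rfl⟩
    · rintro (⟨h, _⟩ | ⟨_, rfl⟩)
      · omega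
      · rfl
  · simp only [false_iff]
    rintro (⟨h, _⟩ | ⟨h, _⟩) <;> omega

/-- A carrier for `insert i A` restricts to one for `A`. -/
theorem IsCarrier.of_insert {A : Finset (ZMod (k + 1))} {i : ZMod (k + 1)} {p C : Tops k}
    (hi : i ∉ A) (hi1 : i + 1 ∉ A) (h : IsCarrier (insert i A) p C) :
    IsCarrier A p (Function.update C i (p i)) := by
  obtain ⟨h1, h2, h3⟩ := h
  have ne : ∀ j ∈ A, j ≠ i ∧ j - 1 ≠ i := by
    intro j hj
    refine ⟨?_, ?_⟩
    · rintro rfl; exact hi hj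
    · rintro rfl; rw [sub_add_cancel] at hi1; exact hi1 hj
  refine ⟨fun j hj => ?_, fun j hj => ?_, fun j hj => ?_⟩
  · rw [Function.update_of_ne (ne j hj).1, Function.update_of_ne (ne j hj).2]
    exact h1 j (Finset.mem_insert_of_mem hj)
  · by_cases e : j = i
    · subst e; simp
    · rw [Function.update_of_ne e]
      exact h2 j (by simp [e, hj])
  · rw [Function.update_of_ne (ne j hj).2]
    exact h3 j (Finset.mem_insert_of_mem hj)

variable [Nontrivial (ZMod (k + 1))]

theorem sub_one_ne (i : ZMod (k + 1)) : i - 1 ≠ i := by simp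

/-- Extending a carrier for `A` to `insert i A`. -/
theorem IsCarrier.insert {A : Finset (ZMod (k + 1))} {i : ZMod (k + 1)} {p C : Tops k}
    (hi1 : i + 1 ∉ A) (h : IsCarrier A p C)
    (hne : C (i - 1) + 1 ≠ p i) :
    IsCarrier (insert i A) p (Function.update C i (max (C (i - 1) + 1) (p i))) := by
  obtain ⟨h1, h2, h3⟩ := h
  have ne : ∀ j ∈ A, j - 1 ≠ i := by
    intro j hj
    rintro rfl; rw [sub_add_cancel] at hi1; exact hi1 hj
  refine ⟨fun j hj => ?_, fun j hj => ?_, fun j hj => ?_⟩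
  · by_cases e : j = i
    · subst e; rw [Function.update_self, Function.update_of_ne (sub_one_ne _)]
    · have hj' : j ∈ A := by simpa [e] using hj
      rw [Function.update_of_ne e, Function.update_of_ne (ne j hj')]
      exact h1 j hj'
  · have e : j ≠ i ∧ j ∉ A := by simpa using hj
    rw [Function.update_of_ne e.1]
    exact h2 j e.2
  · by_cases e : j = i
    · subst e; rwa [Function.update_of_ne (sub_one_ne _)]
    · have hj' : j ∈ A := by simpa [e] using hj
      rw [Function.update_of_ne (ne j hj')]
      exact h3 j hj'

theorem IsCarrier.step_carryOut {A : Finset (ZMod (k + 1))} {i : ZMod (k + 1)} {p C : Tops k}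
    (hi : i ∉ A) (hi1 : i + 1 ∉ A) (h : IsCarrier A p C)
    (hne : C (i - 1) + 1 ≠ p i) :
    step i (carryOut A p C) = some (carryOut (Insert.insert i A) p
      (Function.update C i (max (C (i - 1) + 1) (p i)))) := by
  have q1 : carryOut A p C i = p i := by simp [carryOut, hi1, h.2.1 i hi]
  have q2 : carryOut A p C (i - 1) = C (i - 1) := by simp [carryOut, hi]
  rw [step_eq_some, q1, q2]
  have aux : ∀ j, carryOut (Insert.insert i A) p
      (Function.update C i (max (C (i - 1) + 1) (p i))) j = if j = i then
      max (C (i - 1) + 1) (p i) else if j = i - 1 then min (C (i - 1)) (p i - 1)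
      else carryOut A p C j := by
    intro j
    by_cases e : j = i
    · subst e; simp [carryOut, hi1]
    · by_cases e1 : j = i - 1
      · subst e1; simp [carryOut]
      · have : j + 1 ≠ i := fun e2 => e1 (by rw [← e2]; ring)
        simp [carryOut, e, e1, this]
  rcases lt_or_gt_of_ne hne with hlt | hlt
  · right
    refine ⟨hlt, ?_⟩
    funext j
    rw [aux]
    split_ifs with e e1
    · rw [e, q1]; omega
    · rw [e1, q2]; omega
    · rfl
  · left
    refine ⟨hlt, ?_⟩
    funext j
    rw [aux]
    unfold raise
    rw [q1, q2]
    split_ifs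
    · omega
    · omega
    · rfl

/-- Building up a cyclically decreasing element one generator at a time. -/
theorem dec_insert {A : Finset (ZMod (k + 1))} {i : ZMod (k + 1)} (hi : i ∉ A) (hi1 : i + 1 ∉ A)
    (p : Tops k) : dec (insert i A) p = (dec A p).bind (step i) := by
  ext q
  rw [dec_eq_some, Option.bind_eq_some_iff]
  constructor
  · rintro ⟨C, hC, rfl⟩
    have hC' := hC.of_insert hi hi1
    have hne : (Function.update C i (p i)) (i - 1) + 1 ≠ p i := by
      rw [Function.update_of_ne (sub_one_ne _)]
      exact hC.2.2 i (Finset.mem_insert_self _ _)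
    refine ⟨_, dec_eq_some.2 ⟨_, hC', rfl⟩, ?_⟩
    rw [hC'.step_carryOut hi hi1 hne, (hC'.insert hi1 hne).unique hC]
  · rintro ⟨r, hr, hs⟩
    obtain ⟨C, hC, rfl⟩ := dec_eq_some.1 hr
    have q1 : carryOut A p C i = p i := by simp [carryOut, hi1, hC.2.1 i hi]
    have q2 : carryOut A p C (i - 1) = C (i - 1) := by simp [carryOut, hi]
    have hne : C (i - 1) + 1 ≠ p i := by
      intro e
      rw [step_eq_some, q1, q2] at hs
      omega
    rw [hC.step_carryOut hi hi1 hne, Option.some.injEq] at hs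
    exact ⟨_, hC.insert hi1 hne, hs⟩

end Tops

/-! ## Linear extensions of partial maps -/

section Lin

variable {α β γ : Type*} (R : Type*) [CommRing R]

/-- The linear extension of a partial map. -/
noncomputable def lin (f : α → Option β) : (α →₀ R) →ₗ[R] (β →₀ R) :=
  Finsupp.linearCombination R fun a => (f a).elim 0 fun b => Finsupp.single b 1

variable {R}

theorem lin_single (f : α → Option β) (a : α) :
    lin R f (Finsupp.single a 1) = (f a).elim 0 fun b => Finsupp.single b 1 := by
  simp [lin]

theorem lin_single_apply (f : α → Option β) (a : α) (b : β) :
    lin R f (Finsupp.single a 1) b = if f a = some b then 1 else 0 := by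
  rw [lin_single]
  cases h : f a with
  | none => simp
  | some c => simp [Finsupp.single_apply]

theorem lin_comp (f : α → Option β) (g : β → Option γ) :
    (lin R g).comp (lin R f) = lin R fun a => (f a).bind g := by
  refine Finsupp.lhom_ext' fun a => LinearMap.ext_ring ?_
  simp only [LinearMap.comp_apply, Finsupp.lsingle_apply, lin_single]
  cases h : f a with
  | none => simp
  | some c => simp [lin_single]

theorem lin_some : lin R (fun a : α => some a) = LinearMap.id := by
  refine Finsupp.lhom_ext' fun a => LinearMap.ext_ring ?_
  simp [lin_single]

theorem lin_ext {f g : (α →₀ R) →ₗ[R] (β →₀ R)}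
    (h : ∀ a, f (Finsupp.single a 1) = g (Finsupp.single a 1)) : f = g :=
  Finsupp.lhom_ext' fun a => LinearMap.ext_ring (by simpa using h a)

end Lin

/-! ## Commutation of the transfer operators -/

section YangBaxter

variable {R : Type*} [CommRing R]

/-- The drifted sort of a pair of integers. -/
def sortPair (a b : ℤ) : Option (ℤ × ℤ) :=
  if b < a + 1 then some (b - 1, a + 1) else if a + 1 < b then some (a, b) else none

/-- The drifted sort of the first two coordinates. -/
def sortL (t : ℤ × ℤ × ℤ) : Option (ℤ × ℤ × ℤ) :=
  (sortPair t.1 t.2.1).map fun r => (r.1, r.2, t.2.2)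

/-- The drifted sort of the last two coordinates. -/
def sortR (t : ℤ × ℤ × ℤ) : Option (ℤ × ℤ × ℤ) :=
  (sortPair t.2.1 t.2.2).map fun r => (t.1, r.1, r.2)

theorem sortPair_cases (a b : ℤ) :
    (b < a + 1 ∧ sortPair a b = some (b - 1, a + 1)) ∨ (a + 1 < b ∧ sortPair a b = some (a, b)) ∨
      (a + 1 = b ∧ sortPair a b = none) := by
  unfold sortPair
  rcases lt_trichotomy b (a + 1) with h | h | h
  · left; simp [h]
  · right; right; simp [h]
  · right; left
    refine ⟨h, ?_⟩
    rw [if_neg (by omega), if_pos h]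

theorem sortPair_of_lt {a b : ℤ} (h : b < a + 1) : sortPair a b = some (b - 1, a + 1) := by
  simp [sortPair, h]

theorem sortPair_of_gt {a b : ℤ} (h : a + 1 < b) : sortPair a b = some (a, b) := by
  rw [sortPair, if_neg (by omega), if_pos h]

theorem sortPair_of_eq {a b : ℤ} (h : a + 1 = b) : sortPair a b = none := by
  simp [sortPair, h]

theorem sortPair_bind (a b : ℤ) :
    ((sortPair a b).bind fun r => sortPair r.1 r.2) = sortPair a b := by
  rcases sortPair_cases a b with ⟨h, e⟩ | ⟨h, e⟩ | ⟨h, e⟩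
  · rw [e, Option.bind_some, sortPair_of_gt (by omega)]
  · rw [e, Option.bind_some, e]
  · rw [e]; rfl

theorem sort_braid (t : ℤ × ℤ × ℤ) :
    ((sortL t).bind sortR).bind sortL = ((sortR t).bind sortL).bind sortR := by
  obtain ⟨a, b, c⟩ := t
  unfold sortL sortR
  rcases lt_trichotomy b (a + 1) with h1 | h1 | h1 <;>
  rcases lt_trichotomy c (b + 1) with h2 | h2 | h2 <;>
  rcases lt_trichotomy c (a + 2) with h3 | h3 | h3 <;>
  first
  | omega
  | (simp (discharger := omega) [sortPair_of_lt, sortPair_of_gt, sortPair_of_eq]; try omega)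

theorem yang_baxter {E : Type*} [Ring E] [Algebra R E] {s t : E} (hs : s * s = s) (ht : t * t = t)
    (hb : s * t * s = t * s * t) (a b : R) :
    ((1 + b) • 1 + (a - b) • t) * ((1 + a • s) * (1 + b • t)) =
      ((1 + b • s) * (1 + a • t)) * ((1 + b) • 1 + (a - b) • s) := by
  have hb' : s * (t * s) = t * (s * t) := by simpa only [mul_assoc] using hb
  simp only [add_mul, mul_add, smul_mul_assoc, mul_smul_comm, smul_add, smul_smul, mul_assoc, one_mul,
    mul_one, hs, ht, hb']
  module

theorem sort_unitary {E : Type*} [Ring E] [Algebra R E] {s : E} (hs : s * s = s) (a b : R) :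
    ((1 + a) • 1 + (b - a) • s) * ((1 + b) • 1 + (a - b) • s) = ((1 + a) * (1 + b)) • (1 : E) := by
  simp only [add_mul, mul_add, smul_mul_assoc, mul_smul_comm, smul_add, smul_smul, one_mul,
    mul_one, hs]
  module

theorem lin_sortL_mul : lin R sortL * lin R sortL = lin R sortL := by
  rw [Module.End.mul_eq_comp, lin_comp]
  congr 1
  funext t
  obtain ⟨a, b, c⟩ := t
  have := sortPair_bind a b
  unfold sortL
  rw [Option.bind_map, Function.comp_def, ← this, Option.map_bind]
  simp [this]

theorem lin_sortR_mul : lin R sortR * lin R sortR = lin R sortR := by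
  rw [Module.End.mul_eq_comp, lin_comp]
  congr 1
  funext t
  obtain ⟨a, b, c⟩ := t
  have := sortPair_bind b c
  unfold sortR
  rw [Option.bind_map, Function.comp_def, ← this, Option.map_bind]
  simp [this]

theorem lin_sort_braid :
    lin R sortL * lin R sortR * lin R sortL = lin R sortR * lin R sortL * lin R sortR := by
  simp only [Module.End.mul_eq_comp, lin_comp]
  congr 1
  funext t
  have := sort_braid t
  rw [Option.bind_assoc, Option.bind_assoc] at this
  exact this

variable {k : ℕ}

/-- One step of a carrier: the new carrier value and the new value at the site. -/
def hop (e : Bool) (c s : ℤ) : Option (ℤ × ℤ) :=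
  if e then (sortPair c s).map Prod.swap else some (s, c)

/-- The second carrier passes the site `j`. -/
def opC (e : Bool) (j : ZMod (k + 1)) (x : ℤ × ℤ × Tops k) : Option (ℤ × ℤ × Tops k) :=
  (hop e x.2.1 (x.2.2 j)).map fun r => (x.1, r.1, Function.update x.2.2 j r.2)

/-- The first carrier passes the site `j`. -/
def opD (e : Bool) (j : ZMod (k + 1)) (x : ℤ × ℤ × Tops k) : Option (ℤ × ℤ × Tops k) :=
  (hop e x.1 (x.2.2 j)).map fun r => (r.1, x.2.1, Function.update x.2.2 j r.2)

/-- The drifted sort of the two carriers. -/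
def sortCar (x : ℤ × ℤ × Tops k) : Option (ℤ × ℤ × Tops k) :=
  (sortPair x.1 x.2.1).map fun r => (r.1, r.2, x.2.2)

/-- The local transfer operator of the second carrier. -/
noncomputable def locC (j : ZMod (k + 1)) (u : R) : Module.End R ((ℤ × ℤ × Tops k) →₀ R) :=
  lin R (opC false j) + u • lin R (opC true j)

/-- The local transfer operator of the first carrier. -/
noncomputable def locD (j : ZMod (k + 1)) (u : R) : Module.End R ((ℤ × ℤ × Tops k) →₀ R) :=
  lin R (opD false j) + u • lin R (opD true j)

/-- The intertwiner exchanging the parameters of the two carriers. -/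
noncomputable def carR (u v : R) : Module.End R ((ℤ × ℤ × Tops k) →₀ R) :=
  (1 + v) • 1 + (u - v) • lin R sortCar

/-- Insert two carriers and the value at the site `j`. -/
def siteEmb (p : Tops k) (j : ZMod (k + 1)) (t : ℤ × ℤ × ℤ) : ℤ × ℤ × Tops k :=
  (t.1, t.2.1, Function.update p j t.2.2)

theorem locC_emb (p : Tops k) (j : ZMod (k + 1)) (u : R) :
    locC j u ∘ₗ lin R (fun t => some (siteEmb p j t)) =
      lin R (fun t => some (siteEmb p j (t.1, t.2.2, t.2.1))) ∘ₗ (1 + u • lin R sortR) := by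
  rw [locC, LinearMap.add_comp, LinearMap.smul_comp, lin_comp, lin_comp, LinearMap.comp_add,
    LinearMap.comp_smul, lin_comp, Module.End.one_eq_id, LinearMap.comp_id]
  congr 1
  · congr 1
    funext t
    simp [opC, hop, siteEmb]
  · congr 2
    funext t
    simp [opC, hop, siteEmb, sortR]
    cases sortPair _ _ <;> simp

theorem locD_emb (p : Tops k) (j : ZMod (k + 1)) (u : R) :
    locD j u ∘ₗ lin R (fun t => some (siteEmb p j (t.1, t.2.2, t.2.1))) =
      lin R (fun t => some (siteEmb p j (t.2.1, t.2.2, t.1))) ∘ₗ (1 + u • lin R sortL) := by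
  rw [locD, LinearMap.add_comp, LinearMap.smul_comp, lin_comp, lin_comp, LinearMap.comp_add,
    LinearMap.comp_smul, lin_comp, Module.End.one_eq_id, LinearMap.comp_id]
  congr 1
  · congr 1
    funext t
    simp [opD, hop, siteEmb]
  · congr 2
    funext t
    simp [opD, hop, siteEmb, sortL]
    cases sortPair _ _ <;> simp

theorem carR_emb (p : Tops k) (j : ZMod (k + 1)) (u v : R) :
    carR u v ∘ₗ lin R (fun t => some (siteEmb p j t)) =
      lin R (fun t => some (siteEmb p j t)) ∘ₗ ((1 + v) • 1 + (u - v) • lin R sortL) := by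
  simp only [carR, LinearMap.add_comp, LinearMap.smul_comp, LinearMap.comp_add,
    LinearMap.comp_smul, lin_comp, Module.End.one_eq_id, LinearMap.comp_id, LinearMap.id_comp]
  congr 3
  funext t
  simp [sortCar, siteEmb, sortL]
  cases sortPair _ _ <;> simp

theorem carR_emb_rot (p : Tops k) (j : ZMod (k + 1)) (u v : R) :
    carR u v ∘ₗ lin R (fun t => some (siteEmb p j (t.2.1, t.2.2, t.1))) =
      lin R (fun t => some (siteEmb p j (t.2.1, t.2.2, t.1))) ∘ₗ
        ((1 + v) • 1 + (u - v) • lin R sortR) := by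
  simp only [carR, LinearMap.add_comp, LinearMap.smul_comp, LinearMap.comp_add,
    LinearMap.comp_smul, lin_comp, Module.End.one_eq_id, LinearMap.comp_id, LinearMap.id_comp]
  congr 3
  funext t
  simp [sortCar, siteEmb, sortR]
  cases sortPair _ _ <;> simp

/-- The `RLL` relation. -/
theorem carR_mul_loc (j : ZMod (k + 1)) (u v : R) :
    carR u v * (locD j u * locC j v) = (locD j v * locC j u) * carR u v := by
  refine lin_ext fun x => ?_
  obtain ⟨d, c, p⟩ := x
  have hx : (Finsupp.single (d, c, p) 1 : (ℤ × ℤ × Tops k) →₀ R) =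
      lin R (fun t => some (siteEmb p j t)) (Finsupp.single (d, c, p j) 1) := by
    simp [lin_single, siteEmb]
  rw [hx]
  generalize (Finsupp.single (d, c, p j) 1 : (ℤ × ℤ × ℤ) →₀ R) = f
  have h1 := fun f => LinearMap.congr_fun (carR_emb (R := R) p j u v) f
  have h2 := fun f => LinearMap.congr_fun (carR_emb_rot (R := R) p j u v) f
  have h3 := fun u f => LinearMap.congr_fun (locC_emb (R := R) p j u) f
  have h4 := fun u f => LinearMap.congr_fun (locD_emb (R := R) p j u) f
  simp only [LinearMap.comp_apply] at h1 h2 h3 h4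
  simp only [Module.End.mul_apply]
  rw [h1, h3, h4, h2, h3, h4]
  congr 1
  have := yang_baxter (E := Module.End R ((ℤ × ℤ × ℤ) →₀ R)) lin_sortL_mul lin_sortR_mul
    lin_sort_braid u v
  simpa only [Module.End.mul_apply] using LinearMap.congr_fun this f

theorem lin_sortCar_mul : (lin R sortCar : Module.End R ((ℤ × ℤ × Tops k) →₀ R)) * lin R sortCar =
    lin R sortCar := by
  rw [Module.End.mul_eq_comp, lin_comp]
  congr 1
  funext t
  obtain ⟨a, b, c⟩ := t
  have := sortPair_bind a b
  unfold sortCar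
  rw [Option.bind_map, Function.comp_def, ← this, Option.map_bind]
  simp [this]

theorem carR_mul_carR (u v : R) :
    (carR v u : Module.End R ((ℤ × ℤ × Tops k) →₀ R)) * carR u v = ((1 + u) * (1 + v)) • 1 :=
  sort_unitary (E := Module.End R ((ℤ × ℤ × Tops k) →₀ R)) lin_sortCar_mul u v

/-- Both carriers pass the sites `0, …, m - 1`. -/
noncomputable def pairPass (u v : R) : ℕ → Module.End R ((ℤ × ℤ × Tops k) →₀ R)
  | 0 => 1
  | m + 1 => locD (m : ZMod (k + 1)) u * locC (m : ZMod (k + 1)) v * pairPass u v m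

theorem carR_mul_pairPass (u v : R) (m : ℕ) :
    (carR u v : Module.End R ((ℤ × ℤ × Tops k) →₀ R)) * pairPass u v m =
      pairPass v u m * carR u v := by
  induction m with
  | zero => simp [pairPass]
  | succ m ih =>
    rw [pairPass, pairPass, ← mul_assoc, carR_mul_loc, mul_assoc, ih, ← mul_assoc]

end YangBaxter

section Trace

variable {k : ℕ}

theorem natCast_inj_of_le {a b : ℕ} (ha : a ≤ k) (hb : b ≤ k)
    (h : (a : ZMod (k + 1)) = b) : a = b := by
  have := (ZMod.natCast_eq_natCast_iff' a b (k + 1)).1 h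
  rwa [Nat.mod_eq_of_lt (by omega), Nat.mod_eq_of_lt (by omega)] at this

theorem hop_true_iff {c s : ℤ} {r : ℤ × ℤ} :
    hop true c s = some r ↔ c + 1 ≠ s ∧ r.1 = max (c + 1) s ∧ r.2 = min c (s - 1) := by
  obtain ⟨r1, r2⟩ := r
  rcases sortPair_cases c s with ⟨h, e⟩ | ⟨h, e⟩ | ⟨h, e⟩ <;> simp [hop, e] <;> omega

theorem hop_false_iff {c s : ℤ} {r : ℤ × ℤ} : hop false c s = some r ↔ r = (s, c) := by
  simp [hop, eq_comm]

/-- A carrier passes a site. -/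
def passSite (e : Bool) (j : ZMod (k + 1)) (y : ℤ × Tops k) : Option (ℤ × Tops k) :=
  (hop e y.1 (y.2 j)).map fun r => (r.1, Function.update y.2 j r.2)

/-- A carrier passes the sites `0, …, m - 1`, acting at the sites in `A`. -/
noncomputable def pass (A : Finset (ZMod (k + 1))) : ℕ → ℤ × Tops k → Option (ℤ × Tops k)
  | 0, y => some y
  | m + 1, y => (pass A m y).bind (passSite (decide ((m : ZMod (k + 1)) ∈ A)) m)

/-- Both carriers pass the sites `0, …, m - 1`, acting at the sites in `A` and in `B`. -/
noncomputable def pass₂ (A B : Finset (ZMod (k + 1))) :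
    ℕ → ℤ × ℤ × Tops k → Option (ℤ × ℤ × Tops k)
  | 0, x => some x
  | m + 1, x => ((pass₂ A B m x).bind (opC (decide ((m : ZMod (k + 1)) ∈ B)) m)).bind
      (opD (decide ((m : ZMod (k + 1)) ∈ A)) m)

theorem pass_update (A : Finset (ZMod (k + 1))) {m l : ℕ} (hm : m ≤ l) (hl : l ≤ k) (c s : ℤ)
    (p : Tops k) : pass A m (c, Function.update p l s) =
      (pass A m (c, p)).map fun y => (y.1, Function.update y.2 (l : ZMod (k + 1)) s) := by
  induction m with
  | zero => simp [pass]
  | succ m ih =>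
    have hne : (m : ZMod (k + 1)) ≠ l := fun h => by
      have := natCast_inj_of_le (by omega) hl h
      omega
    rw [pass, pass, ih (by omega), Option.map_bind, Option.bind_map]
    congr 1
    funext y
    simp only [passSite, Function.comp_def, Option.map_map, Function.update_of_ne hne,
      Function.update_comm hne]

theorem pass_apply {A : Finset (ZMod (k + 1))} {m l : ℕ} (hm : m ≤ l) (hl : l ≤ k)
    {x y : ℤ × Tops k} (h : pass A m x = some y) : y.2 l = x.2 l := by
  induction m generalizing y with
  | zero => simp only [pass, Option.some.injEq] at h; rw [h]
  | succ m ih =>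
    have hne : (l : ZMod (k + 1)) ≠ m := fun h => by
      have := natCast_inj_of_le hl (by omega) h
      omega
    obtain ⟨z, hz, hy⟩ := Option.bind_eq_some_iff.1 h
    obtain ⟨r, -, rfl⟩ := Option.map_eq_some_iff.1 hy
    rw [← ih (by omega) hz]
    simp [Function.update_of_ne hne]

theorem pass₂_eq (A B : Finset (ZMod (k + 1))) {m : ℕ} (hm : m ≤ k + 1) (d c : ℤ) (p : Tops k) :
    pass₂ A B m (d, c, p) = (pass B m (c, p)).bind fun y =>
      (pass A m (d, y.2)).map fun z => (z.1, y.1, z.2) := by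
  induction m with
  | zero => simp [pass, pass₂]
  | succ m ih =>
    rw [pass₂, ih (by omega), pass]
    cases h : pass B m (c, p) with
    | none => rfl
    | some y =>
      obtain ⟨y1, y2⟩ := y
      simp only [Option.bind_some, passSite]
      cases h' : pass A m (d, y2) with
      | none =>
        rw [Option.map_none, Option.bind_none, Option.bind_none, eq_comm, Option.bind_eq_none_iff]
        intro r hr
        obtain ⟨s, -, rfl⟩ := Option.map_eq_some_iff.1 hr
        simp [pass, pass_update A le_rfl (show m ≤ k by omega), h']
      | some z =>
        obtain ⟨z1, z2⟩ := z
        have hz : z2 m = y2 m := pass_apply le_rfl (show m ≤ k by omega) h'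
        simp only [Option.map_some, Option.bind_some, opC, hz]
        cases hr : hop _ y1 (y2 m) with
        | none => rfl
        | some r =>
          simp [pass, pass_update A le_rfl (show m ≤ k by omega), h', opD, passSite,
            Function.comp_def]

theorem pass_eq_some {A : Finset (ZMod (k + 1))} {m : ℕ} (hm : m ≤ k + 1) {c c' : ℤ}
    {p y : Tops k} : pass A m (c, p) = some (c', y) ↔ ∃ a : ℕ → ℤ, a 0 = c ∧ a m = c' ∧
      (∀ t < m, hop (decide ((t : ZMod (k + 1)) ∈ A)) (a t) (p t) = some (a (t + 1), y t)) ∧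
      ∀ l : ℕ, m ≤ l → l ≤ k → y l = p l := by
  induction m generalizing c' y with
  | zero =>
    simp only [pass, Option.some.injEq, Prod.mk.injEq]
    constructor
    · rintro ⟨rfl, rfl⟩
      exact ⟨fun _ => c, by simp⟩
    · rintro ⟨a, rfl, rfl, -, h⟩
      refine ⟨rfl, ?_⟩
      funext j
      obtain ⟨t, ht, rfl⟩ : ∃ t : ℕ, t ≤ k ∧ j = t :=
        ⟨j.val, Nat.lt_succ_iff.1 (ZMod.val_lt j), by simp⟩
      exact (h t (by omega) ht).symm
  | succ m ih =>
    have ne : ∀ l : ℕ, l ≤ k → l ≠ m → (l : ZMod (k + 1)) ≠ m := fun l hl hlm h =>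
      hlm (natCast_inj_of_le hl (by omega) h)
    rw [pass, Option.bind_eq_some_iff]
    constructor
    · rintro ⟨⟨c1, y1⟩, h1, h2⟩
      obtain ⟨a, h0, ham, ha, hl⟩ := (ih (by omega)).1 h1
      obtain ⟨r, hr, hy⟩ := Option.map_eq_some_iff.1 h2
      simp only [Prod.mk.injEq] at hy
      obtain ⟨rfl, rfl⟩ := hy
      refine ⟨fun t => if t ≤ m then a t else r.1, by simpa using h0, by simp, ?_, ?_⟩
      · intro t ht
        rcases Nat.lt_succ_iff_lt_or_eq.1 ht with h | rfl
        · rw [Function.update_of_ne (ne t (by omega) (by omega))]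
          simpa [h.le, Nat.succ_le_iff.2 h] using ha t h
        · simp only at hr
          simp [ham, ← hl t le_rfl (by omega), hr]
      · intro l h h'
        rw [Function.update_of_ne (ne l h' (by omega))]
        exact hl l (by omega) h'
    · rintro ⟨a, h0, rfl, ha, hl⟩
      refine ⟨(a m, Function.update y m (p m)), (ih (by omega)).2 ⟨a, h0, rfl, ?_, ?_⟩, ?_⟩
      · intro t ht
        rw [Function.update_of_ne (ne t (by omega) (by omega))]
        exact ha t (by omega)
      · intro l h h'
        by_cases e : l = m
        · subst e; simp
        · rw [Function.update_of_ne (ne l h' e)]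
          exact hl l (by omega) h'
      · simp [passSite, ha m (by omega)]

/-- Rotation of a state. -/
def rot (q : Tops k) : Tops k := fun j => q (j - 1)

theorem pass_closed_iff {A : Finset (ZMod (k + 1))} {c : ℤ} {p y : Tops k} :
    pass A (k + 1) (c, p) = some (c, y) ↔
      ∃ C, IsCarrier A p C ∧ C (k : ZMod (k + 1)) = c ∧ rot (carryOut A p C) = y := by
  have kz : (k : ZMod (k + 1)) = 0 - 1 := by
    have := ZMod.natCast_self (k + 1)
    push_cast at this
    linear_combination this
  have main : ∀ C : Tops k, (∀ j, hop (decide (j ∈ A)) (C (j - 1)) (p j) = some (C j, y j)) ↔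
      IsCarrier A p C ∧ rot (carryOut A p C) = y := by
    intro C
    have aux : ∀ j, hop (decide (j ∈ A)) (C (j - 1)) (p j) = some (C j, y j) ↔
        ((j ∈ A → C j = max (C (j - 1) + 1) (p j)) ∧ (j ∉ A → C j = p j) ∧
          (j ∈ A → C (j - 1) + 1 ≠ p j)) ∧ rot (carryOut A p C) j = y j := by
      intro j
      by_cases h : j ∈ A
      · simp only [h, decide_true, hop_true_iff, rot, carryOut, sub_add_cancel]
        simp
        grind
      · simp only [h, decide_false, hop_false_iff, rot, carryOut, sub_add_cancel]
        simp
        grind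
    simp only [aux, forall_and, funext_iff, IsCarrier]
  rw [pass_eq_some le_rfl]
  constructor
  · rintro ⟨a, h0, hk, ha, -⟩
    refine ⟨fun j => a (j.val + 1), ?_⟩
    rw [← and_assoc, and_right_comm, ← main]
    refine ⟨fun j => ?_, ?_⟩
    · have hj := ZMod.val_lt j
      have h1 := ha j.val hj
      rw [ZMod.natCast_zmod_val] at h1
      have h2 : a ((j - 1).val + 1) = a j.val := by
        by_cases hj0 : j = 0
        · subst hj0
          rw [← kz, ZMod.val_natCast_of_lt (by omega), hk, ZMod.val_zero, h0]
        · have : j.val ≠ 0 := fun h => hj0 ((ZMod.val_eq_zero j).1 h)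
          have : (j - 1) = ((j.val - 1 : ℕ) : ZMod (k + 1)) := by
            rw [Nat.cast_sub (by omega)]; simp
          rw [this, ZMod.val_natCast_of_lt (by omega), Nat.sub_add_cancel (by omega)]
      rw [h2]
      exact h1
    · simp only
      rw [ZMod.val_natCast_of_lt (by omega), hk]
  · rintro ⟨C, hC, hc, hy⟩
    have := (main C).2 ⟨hC, hy⟩
    refine ⟨fun t => C ((t : ZMod (k + 1)) - 1), ?_, ?_, ?_, ?_⟩
    · simp only [Nat.cast_zero]
      rwa [← kz]
    · push_cast
      rwa [add_sub_cancel_right]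
    · intro t _
      simpa using this t
    · intro l h h'
      omega

end Trace

section Commutation

variable {k : ℕ} {R : Type*} [CommRing R]

/-- The residues of the sites `0, …, m - 1`. -/
noncomputable def initSites (k m : ℕ) : Finset (ZMod (k + 1)) :=
  (Finset.range m).image Nat.cast

theorem initSites_succ (m : ℕ) : initSites k (m + 1) = insert (m : ZMod (k + 1)) (initSites k m) := by
  simp [initSites, Finset.range_add_one]

theorem natCast_notMem_initSites {m : ℕ} (hm : m ≤ k) : (m : ZMod (k + 1)) ∉ initSites k m := by
  simp only [initSites, Finset.mem_image, Finset.mem_range, not_exists, not_and]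
  intro t ht h
  have := natCast_inj_of_le (by omega) hm h
  omega

theorem initSites_full : initSites k (k + 1) = Finset.univ := by
  refine Finset.eq_univ_iff_forall.2 fun j => ?_
  simp only [initSites, Finset.mem_image, Finset.mem_range]
  exact ⟨j.val, ZMod.val_lt j, by simp⟩

theorem pass₂_congr {A A' B B' : Finset (ZMod (k + 1))} {m : ℕ}
    (hA : ∀ t < m, (t : ZMod (k + 1)) ∈ A ↔ (t : ZMod (k + 1)) ∈ A')
    (hB : ∀ t < m, (t : ZMod (k + 1)) ∈ B ↔ (t : ZMod (k + 1)) ∈ B') :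
    pass₂ A B m = pass₂ A' B' m := by
  induction m with
  | zero => rfl
  | succ m ih =>
    funext x
    rw [pass₂, pass₂, ih (fun t ht => hA t (by omega)) fun t ht => hB t (by omega)]
    simp only [hA m (by omega), hB m (by omega)]

theorem lin_pass₂_succ (A B : Finset (ZMod (k + 1))) (m : ℕ) :
    lin R (pass₂ A B (m + 1)) = (lin R (opD (decide ((m : ZMod (k + 1)) ∈ A)) m) *
      lin R (opC (decide ((m : ZMod (k + 1)) ∈ B)) m)) * lin R (pass₂ A B m) := by
  simp only [Module.End.mul_eq_comp, lin_comp]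
  congr 1
  funext x
  rw [pass₂, Option.bind_assoc]

theorem pairPass_eq_sum (u v : R) {m : ℕ} (hm : m ≤ k + 1) :
    (pairPass u v m : Module.End R ((ℤ × ℤ × Tops k) →₀ R)) =
      ∑ A ∈ (initSites k m).powerset, ∑ B ∈ (initSites k m).powerset,
        (u ^ A.card * v ^ B.card) • lin R (pass₂ A B m) := by
  induction m with
  | zero =>
    have : lin R (pass₂ (k := k) ∅ ∅ 0) = 1 := lin_some
    simp [pairPass, initSites, this]
  | succ m ih =>
    have hn := natCast_notMem_initSites (show m ≤ k by omega)
    rw [pairPass, ih (by omega), initSites_succ]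
    simp only [Finset.sum_powerset_insert hn]
    rw [← Finset.sum_add_distrib, Finset.mul_sum]
    refine Finset.sum_congr rfl fun A hA => ?_
    rw [← Finset.sum_add_distrib, ← Finset.sum_add_distrib, ← Finset.sum_add_distrib,
      Finset.mul_sum]
    refine Finset.sum_congr rfl fun B hB => ?_
    have hA' : (m : ZMod (k + 1)) ∉ A := fun h => hn (Finset.mem_powerset.1 hA h)
    have hB' : (m : ZMod (k + 1)) ∉ B := fun h => hn (Finset.mem_powerset.1 hB h)
    have hne : ∀ t < m, (t : ZMod (k + 1)) ≠ m := fun t ht h => by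
      have := natCast_inj_of_le (by omega) (by omega) h
      omega
    have hi : ∀ (D : Finset (ZMod (k + 1))), ∀ t < m,
        (t : ZMod (k + 1)) ∈ insert (m : ZMod (k + 1)) D ↔ (t : ZMod (k + 1)) ∈ D :=
      fun D t ht => by simp [hne t ht]
    simp only [lin_pass₂_succ, Finset.mem_insert_self, hA', hB', decide_true, decide_false,
      Finset.card_insert_of_notMem hA', Finset.card_insert_of_notMem hB',
      pass₂_congr (hi A) fun _ _ => Iff.rfl,
      pass₂_congr (fun _ _ => Iff.rfl) (hi B), locD, locC]
    simp only [add_mul, mul_add, smul_mul_assoc, mul_smul_comm, smul_add, smul_smul]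
    module

/-- The trace of an operator over the pairs of carriers in `S`, with states from `p` to `z`. -/
noncomputable def carTrace (S : Finset (ℤ × ℤ)) (p z : Tops k)
    (M : Module.End R ((ℤ × ℤ × Tops k) →₀ R)) : R :=
  ∑ x ∈ S, M (Finsupp.single (x.1, x.2, p) 1) (x.1, x.2, z)

theorem carTrace_add (S : Finset (ℤ × ℤ)) (p z : Tops k)
    (M N : Module.End R ((ℤ × ℤ × Tops k) →₀ R)) :
    carTrace S p z (M + N) = carTrace S p z M + carTrace S p z N := by
  simp [carTrace, Finset.sum_add_distrib]

theorem carTrace_smul (S : Finset (ℤ × ℤ)) (p z : Tops k) (a : R)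
    (M : Module.End R ((ℤ × ℤ × Tops k) →₀ R)) :
    carTrace S p z (a • M) = a * carTrace S p z M := by
  simp [carTrace, Finset.mul_sum]

theorem carTrace_sum {ι : Type*} (T : Finset ι) (S : Finset (ℤ × ℤ)) (p z : Tops k)
    (M : ι → Module.End R ((ℤ × ℤ × Tops k) →₀ R)) :
    carTrace S p z (∑ i ∈ T, M i) = ∑ i ∈ T, carTrace S p z (M i) := by
  induction T using Finset.induction_on with
  | empty => simp [carTrace]
  | insert a s ha ih => rw [Finset.sum_insert ha, Finset.sum_insert ha, carTrace_add, ih]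

/-- Stability of a set of pairs of carriers under the drifted exchange. -/
def ExchangeStable (S : Finset (ℤ × ℤ)) : Prop :=
  ∀ x : ℤ × ℤ, x ∈ S → (x.2 - 1, x.1 + 1) ∈ S

theorem ExchangeStable.mem_iff {S : Finset (ℤ × ℤ)} (hS : ExchangeStable S) {x y : ℤ × ℤ}
    (h : sortPair x.1 x.2 = some y) : x ∈ S ↔ y ∈ S := by
  obtain ⟨a, b⟩ := x
  rcases sortPair_cases a b with ⟨_, e⟩ | ⟨_, e⟩ | ⟨_, e⟩
  · simp only [e, Option.some.injEq] at h
    subst h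
    refine ⟨hS _, fun h => ?_⟩
    simpa using hS _ h
  · simp only [e, Option.some.injEq] at h
    rw [h]
  · simp [e] at h

theorem lin_sortCar_apply {S : Finset (ℤ × ℤ)} (hS : ExchangeStable S) {x : ℤ × ℤ} (hx : x ∈ S)
    (z : Tops k) (f : (ℤ × ℤ × Tops k) →₀ R) :
    lin R sortCar f (x.1, x.2, z) =
      ∑ y ∈ S, f (y.1, y.2, z) * if sortPair y.1 y.2 = some x then 1 else 0 := by
  induction f using Finsupp.induction_linear with
  | zero => simp
  | add f g hf hg => simp only [map_add, Finsupp.add_apply, hf, hg, add_mul, Finset.sum_add_distrib]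
  | single w r =>
    obtain ⟨a, b, q⟩ := w
    have h1 : (Finsupp.single (a, b, q) r : (ℤ × ℤ × Tops k) →₀ R) =
        r • Finsupp.single (a, b, q) 1 := by simp
    rw [h1, map_smul, Finsupp.smul_apply, lin_single_apply]
    have h2 : sortCar (a, b, q) = some (x.1, x.2, z) ↔ sortPair a b = some x ∧ q = z := by
      obtain ⟨x1, x2⟩ := x
      simp only [sortCar, Option.map_eq_some_iff, Prod.mk.injEq]
      constructor
      · rintro ⟨⟨r1, r2⟩, hr, rfl, rfl, rfl⟩
        exact ⟨hr, rfl⟩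
      · rintro ⟨hr, rfl⟩
        exact ⟨_, hr, rfl, rfl, rfl⟩
    have h3 : ∀ y : ℤ × ℤ, (r • (Finsupp.single (a, b, q) 1 : (ℤ × ℤ × Tops k) →₀ R))
        (y.1, y.2, z) = if (a, b) = y then (if q = z then r else 0) else 0 := by
      rintro ⟨y1, y2⟩
      simp [Finsupp.single_apply, ← ite_and, and_assoc]
    simp only [h3, ite_mul, zero_mul, Finset.sum_ite_eq, h2]
    by_cases h : sortPair a b = some x
    · rw [if_pos ((hS.mem_iff (x := (a, b)) h).2 hx)]
      simp [h]
    · simp [h]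

theorem carTrace_sortCar {S : Finset (ℤ × ℤ)} (hS : ExchangeStable S) (p z : Tops k)
    (M : Module.End R ((ℤ × ℤ × Tops k) →₀ R)) :
    carTrace S p z (lin R sortCar * M) = carTrace S p z (M * lin R sortCar) := by
  have h1 : carTrace S p z (lin R sortCar * M) = ∑ x ∈ S, ∑ y ∈ S,
      M (Finsupp.single (x.1, x.2, p) 1) (y.1, y.2, z) *
        if sortPair y.1 y.2 = some x then 1 else 0 :=
    Finset.sum_congr rfl fun x hx => by rw [Module.End.mul_apply, lin_sortCar_apply hS hx]
  rw [h1, Finset.sum_comm]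
  refine Finset.sum_congr rfl fun x hx => ?_
  rw [Module.End.mul_apply, lin_single, sortCar]
  cases h : sortPair x.1 x.2 with
  | none => simp
  | some w =>
    have hw := (hS.mem_iff h).1 hx
    simp [hw]

theorem carTrace_carR {S : Finset (ℤ × ℤ)} (hS : ExchangeStable S) (p z : Tops k) (u v : R)
    (M : Module.End R ((ℤ × ℤ × Tops k) →₀ R)) :
    carTrace S p z (carR u v * M) = carTrace S p z (M * carR u v) := by
  simp only [carR, add_mul, mul_add, smul_mul_assoc, mul_smul_comm, one_mul, mul_one,
    carTrace_add, carTrace_smul, carTrace_sortCar hS]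

theorem carTrace_pairPass [IsDomain R] {S : Finset (ℤ × ℤ)} (hS : ExchangeStable S) (p z : Tops k)
    {u v : R} (huv : (1 + u) * (1 + v) ≠ 0) (m : ℕ) :
    carTrace S p z (pairPass u v m) = carTrace S p z (pairPass v u m) := by
  have h1 : carTrace S p z (carR v u * (carR u v * pairPass u v m)) =
      carTrace S p z (pairPass v u m * (carR u v * carR v u)) := by
    rw [carR_mul_pairPass, carTrace_carR hS, mul_assoc]
  rw [← mul_assoc, carR_mul_carR, carR_mul_carR, smul_mul_assoc, one_mul, mul_smul_comm, mul_one,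
    carTrace_smul, carTrace_smul, mul_comm (1 + v)] at h1
  exact mul_left_cancel₀ huv h1

end Commutation

section HCommute

variable {k : ℕ}

theorem rot_carrier_iff {A : Finset (ZMod (k + 1))} {p y : Tops k} :
    (dec A p).map rot = some y ↔ ∃ c, pass A (k + 1) (c, p) = some (c, y) := by
  simp only [pass_closed_iff, Option.map_eq_some_iff, dec_eq_some]
  constructor
  · rintro ⟨_, ⟨C, hC, rfl⟩, rfl⟩
    exact ⟨_, C, hC, rfl, rfl⟩
  · rintro ⟨_, C, hC, rfl, rfl⟩
    exact ⟨_, ⟨C, hC, rfl⟩, rfl⟩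

theorem pass_closed_unique {A : Finset (ZMod (k + 1))} {p y y' : Tops k} {c c' : ℤ}
    (h : pass A (k + 1) (c, p) = some (c, y)) (h' : pass A (k + 1) (c', p) = some (c', y')) :
    c = c' ∧ y = y' := by
  obtain ⟨C, hC, rfl, rfl⟩ := pass_closed_iff.1 h
  obtain ⟨C', hC', rfl, rfl⟩ := pass_closed_iff.1 h'
  rw [hC.unique hC']
  exact ⟨rfl, rfl⟩

theorem pass₂_closed_iff {A B : Finset (ZMod (k + 1))} {p z : Tops k} {d c : ℤ} :
    pass₂ A B (k + 1) (d, c, p) = some (d, c, z) ↔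
      ∃ y, pass B (k + 1) (c, p) = some (c, y) ∧ pass A (k + 1) (d, y) = some (d, z) := by
  rw [pass₂_eq A B le_rfl, Option.bind_eq_some_iff]
  constructor
  · rintro ⟨⟨c1, y⟩, h1, h2⟩
    obtain ⟨⟨d1, w⟩, h3, h4⟩ := Option.map_eq_some_iff.1 h2
    simp only [Prod.mk.injEq] at h4
    obtain ⟨rfl, rfl, rfl⟩ := h4
    exact ⟨y, h1, h3⟩
  · rintro ⟨y, h1, h2⟩
    exact ⟨_, h1, by simp [h2]⟩

theorem rot_dec_bind_iff {A B : Finset (ZMod (k + 1))} {p z : Tops k} :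
    (((dec B p).map rot).bind fun y => (dec A y).map rot) = some z ↔
      ∃ x : ℤ × ℤ, pass₂ A B (k + 1) (x.1, x.2, p) = some (x.1, x.2, z) := by
  simp only [Option.bind_eq_some_iff, pass₂_closed_iff, rot_carrier_iff]
  constructor
  · rintro ⟨y, ⟨c, hc⟩, d, hd⟩
    exact ⟨(d, c), y, hc, hd⟩
  · rintro ⟨⟨d, c⟩, y, hc, hd⟩
    exact ⟨y, ⟨c, hc⟩, d, hd⟩

theorem pass₂_closed_unique {A B : Finset (ZMod (k + 1))} {p z : Tops k} {x x' : ℤ × ℤ}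
    (h : pass₂ A B (k + 1) (x.1, x.2, p) = some (x.1, x.2, z))
    (h' : pass₂ A B (k + 1) (x'.1, x'.2, p) = some (x'.1, x'.2, z)) : x = x' := by
  obtain ⟨y, h1, h2⟩ := pass₂_closed_iff.1 h
  obtain ⟨y', h1', h2'⟩ := pass₂_closed_iff.1 h'
  obtain ⟨e, rfl⟩ := pass_closed_unique h1 h1'
  exact Prod.ext (pass_closed_unique h2 h2').1 e

/-- A stable finite set of pairs of carriers supporting all closed passes. -/
theorem exists_exchangeStable (p z : Tops k) : ∃ S : Finset (ℤ × ℤ), ExchangeStable S ∧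
    ∀ (A B : Finset (ZMod (k + 1))) (x : ℤ × ℤ),
      pass₂ A B (k + 1) (x.1, x.2, p) = some (x.1, x.2, z) → x ∈ S := by
  have hfin : (⋃ A : Finset (ZMod (k + 1)), ⋃ B : Finset (ZMod (k + 1)),
      {x : ℤ × ℤ | pass₂ A B (k + 1) (x.1, x.2, p) = some (x.1, x.2, z)}).Finite :=
    Set.finite_iUnion fun A => Set.finite_iUnion fun B =>
      Set.Subsingleton.finite fun x hx y hy => pass₂_closed_unique hx hy
  refine ⟨hfin.toFinset ∪ hfin.toFinset.image fun x => (x.2 - 1, x.1 + 1), ?_, ?_⟩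
  · intro x hx
    rcases Finset.mem_union.1 hx with h | h
    · exact Finset.mem_union_right _ (Finset.mem_image_of_mem _ h)
    · obtain ⟨y, hy, rfl⟩ := Finset.mem_image.1 h
      refine Finset.mem_union_left _ ?_
      simpa using hy
  · intro A B x hx
    refine Finset.mem_union_left _ (hfin.mem_toFinset.2 ?_)
    simp only [Set.mem_iUnion]
    exact ⟨A, B, hx⟩

theorem carTrace_pass₂ {R : Type*} [CommRing R] {S : Finset (ℤ × ℤ)} {p z : Tops k}
    {A B : Finset (ZMod (k + 1))}
    (hS : ∀ x : ℤ × ℤ, pass₂ A B (k + 1) (x.1, x.2, p) = some (x.1, x.2, z) → x ∈ S) :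
    carTrace S p z (lin R (pass₂ A B (k + 1))) =
      if (((dec B p).map rot).bind fun y => (dec A y).map rot) = some z then 1 else 0 := by
  simp only [carTrace, lin_single_apply]
  split_ifs with h
  · obtain ⟨x, hx⟩ := rot_dec_bind_iff.1 h
    rw [Finset.sum_eq_single x]
    · simp [hx]
    · intro y _ hy
      rw [if_neg]
      exact fun h' => hy (pass₂_closed_unique h' hx)
    · exact fun h' => absurd (hS x hx) h'
  · refine Finset.sum_eq_zero fun x _ => ?_
    rw [if_neg]
    exact fun hx => h (rot_dec_bind_iff.2 ⟨x, hx⟩)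

/-- Translation of a set of residues. -/
def rotSet (A : Finset (ZMod (k + 1))) : Finset (ZMod (k + 1)) :=
  A.map (Equiv.addRight (1 : ZMod (k + 1))).toEmbedding

theorem mem_rotSet {A : Finset (ZMod (k + 1))} {j : ZMod (k + 1)} : j ∈ rotSet A ↔ j - 1 ∈ A := by
  simp [rotSet, sub_eq_add_neg]

/-- Translation as a permutation of the sets of residues. -/
def rotSetEquiv : Finset (ZMod (k + 1)) ≃ Finset (ZMod (k + 1)) :=
  (Equiv.addRight (1 : ZMod (k + 1))).finsetCongr

theorem dec_rotSet (A : Finset (ZMod (k + 1))) (p : Tops k) :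
    dec (rotSet A) (rot p) = (dec A p).map rot := by
  have key : ∀ C : Tops k, IsCarrier (rotSet A) (rot p) (rot C) ↔ IsCarrier A p C := by
    intro C
    simp only [IsCarrier, mem_rotSet, rot]
    have hs : ∀ P : ZMod (k + 1) → Prop, (∀ j, P (j - 1)) ↔ ∀ j, P j :=
      fun P => ⟨fun h j => by
        have := h (j + 1)
        rwa [add_sub_cancel_right] at this, fun h j => h (j - 1)⟩
    rw [← hs fun j => j ∈ A → C j = max (C (j - 1) + 1) (p j), ← hs fun j => j ∉ A → C j = p j,
      ← hs fun j => j ∈ A → C (j - 1) + 1 ≠ p j]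
  have hrot : ∀ C : Tops k, ∃ D, rot D = C :=
    fun C => ⟨fun j => C (j + 1), by funext j; simp [rot]⟩
  have hout : ∀ C : Tops k, carryOut (rotSet A) (rot p) (rot C) = rot (carryOut A p C) := by
    intro C
    funext j
    simp [carryOut, mem_rotSet, rot]
  ext q
  rw [dec_eq_some, Option.map_eq_some_iff]
  constructor
  · rintro ⟨C, hC, rfl⟩
    obtain ⟨D, rfl⟩ := hrot C
    exact ⟨_, dec_eq_some.2 ⟨D, (key D).1 hC, rfl⟩, (hout D).symm⟩
  · rintro ⟨r, hr, rfl⟩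
    obtain ⟨D, hD, rfl⟩ := dec_eq_some.1 hr
    exact ⟨rot D, (key D).2 hD, hout D⟩

theorem rot_injective : Function.Injective (rot (k := k)) := by
  intro p q h
  funext j
  simpa [rot] using congrFun h (j + 1)

/-- The matrix entry of a product of two cyclically decreasing elements. -/
noncomputable def decEntry (R : Type*) [CommRing R] (p z : Tops k) (A B : Finset (ZMod (k + 1))) : R :=
  if (dec B p).bind (dec A) = some z then 1 else 0

theorem decEntry_symm {R : Type*} [CommRing R] [IsDomain R] (p z : Tops k) {u v : R}
    (huv : (1 + u) * (1 + v) ≠ 0) :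
    ∑ A, ∑ B, u ^ A.card * v ^ B.card * decEntry R p z A B =
      ∑ A, ∑ B, v ^ A.card * u ^ B.card * decEntry R p z A B := by
  obtain ⟨S, hS, hmem⟩ := exists_exchangeStable p (rot (rot z))
  have h1 : ∀ a b : R, carTrace S p (rot (rot z)) (pairPass a b (k + 1)) =
      ∑ A, ∑ B, a ^ A.card * b ^ B.card * decEntry R p z A B := by
    intro a b
    rw [pairPass_eq_sum _ _ le_rfl, carTrace_sum, initSites_full, Finset.powerset_univ]
    simp only [carTrace_sum, carTrace_smul]
    have h2 : ∀ A B : Finset (ZMod (k + 1)),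
        carTrace S p (rot (rot z)) (lin R (pass₂ (rotSet A) B (k + 1))) = decEntry R p z A B := by
      intro A B
      rw [carTrace_pass₂ fun x hx => hmem _ _ x hx, decEntry]
      congr 1
      rw [Option.bind_map]
      simp only [Function.comp_def, dec_rotSet, Option.map_map]
      have : ((dec B p).bind fun x => (dec A x).map fun y => rot (rot y)) =
          ((dec B p).bind (dec A)).map fun y => rot (rot y) := by
        rw [Option.map_bind]
        rfl
      rw [this, eq_iff_iff, Option.map_eq_some_iff]
      constructor
      · rintro ⟨w, hw, h⟩
        rw [hw, rot_injective (rot_injective h)]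
      · exact fun h => ⟨z, h, rfl⟩
    rw [← Equiv.sum_comp rotSetEquiv]
    refine Finset.sum_congr rfl fun A _ => Finset.sum_congr rfl fun B _ => ?_
    rw [← h2]
    simp [rotSetEquiv, rotSet]
  rw [← h1, ← h1, carTrace_pairPass hS _ _ huv]

/-- The signless operator attached to `h_r`. -/
noncomputable def hOp (k r : ℕ) : Module.End ℤ (Tops k →₀ ℤ) :=
  ∑ A ∈ Finset.univ.filter fun A : Finset (ZMod (k + 1)) => A.card = r, lin ℤ (dec A)

theorem hOp_mul_apply (r s : ℕ) (p z : Tops k) : (hOp k r * hOp k s) (Finsupp.single p 1) z =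
    ∑ A, ∑ B, if A.card = r ∧ B.card = s then decEntry ℤ p z A B else 0 := by
  rw [hOp, hOp, Finset.sum_mul_sum]
  simp only [Finset.sum_filter, Module.End.mul_eq_comp, lin_comp, LinearMap.sum_apply,
    Finsupp.finsetSum_apply]
  refine Finset.sum_congr rfl fun A _ => ?_
  by_cases hA : A.card = r
  · simp only [hA, if_true, true_and, LinearMap.sum_apply, Finsupp.finsetSum_apply]
    refine Finset.sum_congr rfl fun B _ => ?_
    by_cases hB : B.card = s
    · simp [hB, lin_single_apply, decEntry]
    · simp [hB]
  · simp [hA]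

theorem hOp_commute (r s : ℕ) : Commute (hOp k r) (hOp k s) := by
  refine lin_ext fun p => Finsupp.ext fun z => ?_
  rw [hOp_mul_apply, hOp_mul_apply]
  have huv : (1 + (Polynomial.C Polynomial.X : Polynomial (Polynomial ℤ))) *
      (1 + Polynomial.X) ≠ 0 := by
    intro h
    have := congrArg (fun f => (f.eval 1).eval 1) h
    simp at this
  have h := congrArg (fun f => (f.coeff s).coeff r)
    (decEntry_symm (R := Polynomial (Polynomial ℤ)) p z huv)
  have hc : ∀ A B, decEntry (Polynomial (Polynomial ℤ)) p z A B =
      Polynomial.C (Polynomial.C (decEntry ℤ p z A B)) := by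
    intro A B
    unfold decEntry
    split_ifs <;> simp
  have hcf : ∀ a b : ℕ, (((Polynomial.C Polynomial.X : Polynomial (Polynomial ℤ)) ^ a *
      Polynomial.X ^ b).coeff s).coeff r = if a = r ∧ b = s then 1 else 0 := by
    intro a b
    rw [← Polynomial.C_pow, Polynomial.coeff_C_mul, Polynomial.coeff_X_pow]
    by_cases hb : b = s
    · by_cases ha : a = r
      · simp [ha, hb]
      · simp [ha, hb, Polynomial.coeff_X_pow, Ne.symm ha]
    · simp [hb, Ne.symm hb]
  have hcf' : ∀ a b : ℕ, ((Polynomial.X ^ b * (Polynomial.C Polynomial.X :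
      Polynomial (Polynomial ℤ)) ^ a).coeff s).coeff r = if b = s ∧ a = r then 1 else 0 := by
    intro a b
    rw [mul_comm, hcf]
    simp only [and_comm]
  simp only [Polynomial.finsetSum_coeff, hc, Polynomial.coeff_mul_C, hcf, hcf', ite_mul, one_mul,
    zero_mul] at h
  exact h

end HCommute

section Duality

variable {k : ℕ} {R : Type*} [CommRing R]

/-- Transposition of states. -/
def tau (p : Tops k) : Tops k := fun j => -(k + 2 : ℤ) - p (-1 - j)

theorem tau_tau (p : Tops k) : tau (tau p) = p := by
  funext j
  simp [tau]

/-- Negation of a set of residues. -/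
def negSet (A : Finset (ZMod (k + 1))) : Finset (ZMod (k + 1)) :=
  A.map (Equiv.neg (ZMod (k + 1))).toEmbedding

theorem mem_negSet {A : Finset (ZMod (k + 1))} {j : ZMod (k + 1)} : j ∈ negSet A ↔ -j ∈ A := by
  simp only [negSet, Finset.mem_map, Equiv.coe_toEmbedding, Equiv.neg_apply]
  exact ⟨fun ⟨a, ha, h⟩ => by rwa [← h, neg_neg], fun h => ⟨-j, h, neg_neg j⟩⟩

theorem negSet_negSet (A : Finset (ZMod (k + 1))) : negSet (negSet A) = A := by
  ext j; simp [mem_negSet]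

theorem card_negSet (A : Finset (ZMod (k + 1))) : (negSet A).card = A.card := by simp [negSet]

/-- The transpose of the action of a cyclically decreasing element. -/
noncomputable def decT (A : Finset (ZMod (k + 1))) (p : Tops k) : Option (Tops k) :=
  (dec (negSet A) (tau p)).map tau

/-- Transposition of states as a linear map. -/
noncomputable def tauOp (k : ℕ) (R : Type*) [CommRing R] : Module.End R (Tops k →₀ R) :=
  lin R fun p => some (tau p)

theorem tauOp_mul_self : tauOp k R * tauOp k R = 1 := by
  rw [tauOp, Module.End.mul_eq_comp, lin_comp]
  simp only [Option.bind_some, tau_tau]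
  exact lin_some

theorem lin_decT (A : Finset (ZMod (k + 1))) :
    lin R (decT A) = tauOp k R * lin R (dec (negSet A)) * tauOp k R := by
  simp only [tauOp, Module.End.mul_eq_comp, lin_comp]
  congr 1
  funext p
  simp [decT, Option.map_eq_bind]

/-- The product `x (m - 1) * ⋯ * x 0`. -/
def descProd {M : Type*} [Monoid M] (x : ℕ → M) : ℕ → M
  | 0 => 1
  | m + 1 => x m * descProd x m

theorem descProd_succ' {M : Type*} [Monoid M] (x : ℕ → M) (m : ℕ) :
    descProd x (m + 1) = descProd (fun t => x (t + 1)) m * x 0 := by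
  induction m with
  | zero => simp [descProd]
  | succ m ih => rw [descProd, ih, descProd, mul_assoc]

theorem descProd_mul_descProd {M : Type*} [Monoid M] {x y : ℕ → M} {m : ℕ}
    (h : ∀ t < m, y t * x (m - 1 - t) = 1) : descProd y m * descProd x m = 1 := by
  induction m generalizing x with
  | zero => simp [descProd]
  | succ m ih =>
    have h1 : descProd y m * descProd (fun t => x (t + 1)) m = 1 := ih fun t ht => by
      have := h t (by omega)
      rwa [show m + 1 - 1 - t = m - 1 - t + 1 by omega] at this
    have h2 := h m (by omega)
    rw [show m + 1 - 1 - m = 0 by omega] at h2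
    rw [descProd_succ' x, descProd, mul_assoc, ← mul_assoc (descProd y m), h1, one_mul, h2]

variable [Nontrivial (ZMod (k + 1))]

theorem step_tau (i : ZMod (k + 1)) (p : Tops k) : step i (tau p) = (step (-i) p).map tau := by
  have e1 : -1 - i = -i - 1 := by ring
  have e2 : -1 - (i - 1) = -i := by ring
  ext q
  rw [step_eq_some, Option.map_eq_some_iff]
  have hr : raise i (tau p) = tau (raise (-i) p) := by
    funext j
    have f1 : -1 - j = -i ↔ j = i - 1 := by
      constructor
      · intro h; linear_combination -h
      · rintro rfl; ring
    have f2 : -1 - j = -i - 1 ↔ j = i := by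
      constructor
      · intro h; linear_combination -h
      · rintro rfl; ring
    simp only [tau, raise, f1, f2, e1, e2]
    by_cases h : j = i
    · have h0 : i ≠ i - 1 := (sub_one_ne i).symm
      simp only [h, h0, if_true, if_false, e1]
      ring
    · by_cases h' : j = i - 1
      · simp [h']
        ring
      · simp [h, h']
  have hl : (tau p) i = -(k + 2 : ℤ) - p (-i - 1) := by simp only [tau, e1]
  have hl' : (tau p) (i - 1) = -(k + 2 : ℤ) - p (-i) := by simp only [tau, e2]
  rw [hr, hl, hl']
  simp only [step_eq_some]
  constructor
  · rintro (⟨h, rfl⟩ | ⟨h, rfl⟩)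
    · exact ⟨_, Or.inl ⟨by omega, rfl⟩, rfl⟩
    · exact ⟨_, Or.inr ⟨by omega, rfl⟩, rfl⟩
  · rintro ⟨_, ⟨h, rfl⟩ | ⟨h, rfl⟩, rfl⟩
    · exact Or.inl ⟨by omega, rfl⟩
    · exact Or.inr ⟨by omega, rfl⟩

theorem step_bind_step (i : ZMod (k + 1)) (p : Tops k) : (step i p).bind (step i) = step i p := by
  cases h : step i p with
  | none => rfl
  | some q =>
    rw [Option.bind_some]
    rcases step_eq_some.1 h with ⟨h1, rfl⟩ | ⟨h1, rfl⟩
    · refine step_eq_some.2 (Or.inr ⟨?_, rfl⟩)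
      simp only [raise, if_true, sub_one_ne, if_false]
      omega
    · exact h

/-- The signless `0`-Hecke generator as an operator. -/
noncomputable def stepOp (R : Type*) [CommRing R] (i : ZMod (k + 1)) : Module.End R (Tops k →₀ R) :=
  lin R (step i)

theorem stepOp_mul_self (i : ZMod (k + 1)) : stepOp R i * stepOp R i = stepOp R i := by
  rw [stepOp, Module.End.mul_eq_comp, lin_comp]
  congr 1
  funext p
  exact step_bind_step i p

theorem tauOp_stepOp (i : ZMod (k + 1)) :
    tauOp k R * stepOp R (-i) * tauOp k R = stepOp R i := by
  simp only [tauOp, stepOp, Module.End.mul_eq_comp, lin_comp]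
  congr 1
  funext p
  have := step_tau (-i) p
  rw [neg_neg] at this
  rw [Option.bind_some, this, Option.bind_map]
  simp [tau_tau]

/-- The factor of residue `i` in the product over a set of residues. -/
noncomputable def facOp (u : R) (U : Finset (ZMod (k + 1))) (i : ZMod (k + 1)) :
    Module.End R (Tops k →₀ R) :=
  if i ∈ U then 1 + u • stepOp R i else 1

theorem sum_dec_eq_descProd (u : R) {U : Finset (ZMod (k + 1))} {a : ZMod (k + 1)} (ha : a ∉ U) :
    ∑ A ∈ U.powerset, u ^ A.card • lin R (dec A) =
      descProd (fun t : ℕ => facOp u U (a + t + 1)) k := by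
  have key : ∀ m ≤ k, ∑ A ∈ (U.filter fun j => ∃ t < m, j = a + (t : ℕ) + 1).powerset,
      u ^ A.card • lin R (dec A) = descProd (fun t : ℕ => facOp u U (a + t + 1)) m := by
    intro m
    induction m with
    | zero =>
      intro _
      have : lin R (dec (k := k) ∅) = 1 := by
        rw [show dec (k := k) ∅ = fun p => some p from funext dec_empty]
        exact lin_some
      simp [descProd, this]
    | succ m ih =>
      intro hm
      set P := U.filter fun j => ∃ t < m, j = a + (t : ℕ) + 1 with hP
      have hcast : ∀ s t : ℕ, s ≤ k → t ≤ k → (a + s + 1 : ZMod (k + 1)) = a + t + 1 → s = t := by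
        intro s t hs ht h
        exact natCast_inj_of_le hs ht (by linear_combination h)
      have hmem : a + (m : ZMod (k + 1)) + 1 ∉ P := by
        intro h
        obtain ⟨t, ht, h⟩ := (Finset.mem_filter.1 h).2
        have := hcast m t (by omega) (by omega) h
        omega
      have hmem1 : a + (m : ZMod (k + 1)) + 1 + 1 ∉ P := by
        intro h
        obtain ⟨t, ht, h⟩ := (Finset.mem_filter.1 h).2
        have := hcast (m + 1) t (by omega) (by omega) (by push_cast; linear_combination h)
        omega
      rw [descProd, ← ih (by omega)]
      by_cases hU : a + (m : ZMod (k + 1)) + 1 ∈ U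
      · have hs : (U.filter fun j => ∃ t < m + 1, j = a + (t : ℕ) + 1) =
            insert (a + (m : ZMod (k + 1)) + 1) P := by
          ext j
          simp only [hP, Finset.mem_filter, Finset.mem_insert]
          constructor
          · rintro ⟨hj, t, ht, rfl⟩
            rcases Nat.lt_succ_iff_lt_or_eq.1 ht with h | rfl
            · exact Or.inr ⟨hj, t, h, rfl⟩
            · exact Or.inl rfl
          · rintro (rfl | ⟨hj, t, ht, rfl⟩)
            · exact ⟨hU, m, by omega, rfl⟩
            · exact ⟨hj, t, by omega, rfl⟩
        rw [hs, Finset.sum_powerset_insert hmem, facOp, if_pos hU, add_mul, one_mul]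
        congr 1
        rw [Finset.mul_sum]
        refine Finset.sum_congr rfl fun A hA => ?_
        have hA' := Finset.mem_powerset.1 hA
        rw [Finset.card_insert_of_notMem fun h => hmem (hA' h)]
        have : lin R (dec (insert (a + (m : ZMod (k + 1)) + 1) A)) =
            stepOp R (a + (m : ZMod (k + 1)) + 1) * lin R (dec A) := by
          rw [stepOp, Module.End.mul_eq_comp, lin_comp]
          congr 1
          funext p
          exact dec_insert (fun h => hmem (hA' h)) (fun h => hmem1 (hA' h)) p
        rw [this, smul_mul_assoc, mul_smul_comm, smul_smul, pow_succ, mul_comm u]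
      · have hs : (U.filter fun j => ∃ t < m + 1, j = a + (t : ℕ) + 1) = P := by
          ext j
          simp only [hP, Finset.mem_filter]
          constructor
          · rintro ⟨hj, t, ht, rfl⟩
            rcases Nat.lt_succ_iff_lt_or_eq.1 ht with h | rfl
            · exact ⟨hj, t, h, rfl⟩
            · exact absurd hj hU
          · rintro ⟨hj, t, ht, rfl⟩
            exact ⟨hj, t, by omega, rfl⟩
        rw [hs, facOp, if_neg hU, one_mul]
  rw [← key k le_rfl]
  congr 2
  ext j
  simp only [Finset.mem_filter, iff_self_and]
  intro hj
  refine ⟨(j - a - 1).val, ?_, by rw [ZMod.natCast_zmod_val]; ring⟩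
  have h1 := ZMod.val_lt (j - a - 1)
  refine lt_of_le_of_ne (by omega) fun h => ha ?_
  have h2 : ((j - a - 1).val : ZMod (k + 1)) = (k : ZMod (k + 1)) := by rw [h]
  rw [ZMod.natCast_zmod_val] at h2
  have h3 := ZMod.natCast_self (k + 1)
  push_cast at h3
  have : j = a := by linear_combination h2 + h3
  rwa [← this]

theorem sum_decT_mul_sum_dec {u v : R} (huv : u + v + u * v = 0) {U : Finset (ZMod (k + 1))}
    (hU : U ≠ Finset.univ) :
    (∑ A ∈ U.powerset, v ^ A.card • lin R (decT A)) * ∑ A ∈ U.powerset, u ^ A.card • lin R (dec A) =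
      1 := by
  obtain ⟨a, ha⟩ : ∃ a, a ∉ U := by
    by_contra! h
    exact hU (Finset.eq_univ_iff_forall.2 h)
  have h1 : ∑ A ∈ U.powerset, v ^ A.card • lin R (decT A) =
      tauOp k R * (∑ A ∈ (negSet U).powerset, v ^ A.card • lin R (dec A)) * tauOp k R := by
    rw [Finset.mul_sum, Finset.sum_mul]
    refine Finset.sum_bij' (fun A _ => negSet A) (fun A _ => negSet A) ?_ ?_ ?_ ?_ ?_
    · intro A hA
      rw [Finset.mem_powerset] at hA ⊢
      exact fun j hj => mem_negSet.2 (hA (mem_negSet.1 hj))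
    · intro A hA
      rw [Finset.mem_powerset] at hA ⊢
      intro j hj
      have := mem_negSet.1 (hA (mem_negSet.1 hj))
      rwa [neg_neg] at this
    · exact fun A _ => negSet_negSet A
    · exact fun A _ => negSet_negSet A
    · intro A _
      rw [lin_decT, card_negSet, mul_smul_comm, smul_mul_assoc]
  have h2 : ∀ i : ZMod (k + 1), tauOp k R * facOp v (negSet U) i * tauOp k R = facOp v U (-i) := by
    intro i
    have := tauOp_stepOp (R := R) (-i)
    rw [neg_neg] at this
    unfold facOp
    by_cases h : -i ∈ U
    · rw [if_pos h, if_pos (mem_negSet.2 h), mul_add, add_mul, mul_one, tauOp_mul_self,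
        mul_smul_comm, smul_mul_assoc, this]
    · rw [if_neg h, if_neg fun h' => h (mem_negSet.1 h'), mul_one, tauOp_mul_self]
  have h3 : ∀ (x : ℕ → Module.End R (Tops k →₀ R)) (m : ℕ),
      tauOp k R * descProd x m * tauOp k R =
        descProd (fun t => tauOp k R * x t * tauOp k R) m := by
    intro x m
    induction m with
    | zero => simp [descProd, tauOp_mul_self]
    | succ m ih =>
      rw [descProd, descProd, ← ih]
      have : ∀ y z : Module.End R (Tops k →₀ R), tauOp k R * (y * z) * tauOp k R =
          tauOp k R * y * tauOp k R * (tauOp k R * z * tauOp k R) := by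
        intro y z
        calc _ = tauOp k R * y * 1 * z * tauOp k R := by simp only [mul_one, mul_assoc]
          _ = _ := by rw [← tauOp_mul_self (k := k)]; simp only [mul_assoc]
      exact this _ _
  have ha' : -a ∉ negSet U := fun h => ha (by simpa using mem_negSet.1 h)
  rw [h1, sum_dec_eq_descProd v ha', sum_dec_eq_descProd u ha, h3]
  simp only [h2]
  refine descProd_mul_descProd fun t ht => ?_
  have e : -(-a + (t : ZMod (k + 1)) + 1) = a + ((k - 1 - t : ℕ) : ZMod (k + 1)) + 1 := by
    rw [Nat.sub_sub, Nat.cast_sub (by omega)]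
    have h3 := ZMod.natCast_self (k + 1)
    push_cast at h3 ⊢
    linear_combination -h3
  rw [e]
  unfold facOp
  split_ifs
  · simp only [add_mul, mul_add, one_mul, mul_one, smul_mul_assoc, mul_smul_comm, stepOp_mul_self]
    generalize stepOp R (a + ((k - 1 - t : ℕ) : ZMod (k + 1)) + 1) = S
    calc _ = 1 + (u + v + u * v) • S := by module
      _ = 1 := by rw [huv, zero_smul, add_zero]
  · simp

end Duality

section Duality

variable {k : ℕ} {R : Type*} [CommRing R]

theorem sum_decT_mul_dec_univ [Nontrivial (ZMod (k + 1))] {u v : R} (huv : u + v + u * v = 0) :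
    ∑ A : Finset (ZMod (k + 1)), ∑ B : Finset (ZMod (k + 1)),
      (v ^ A.card * u ^ B.card) • (lin R (decT A) * lin R (dec B)) =
    1 + ∑ A : Finset (ZMod (k + 1)), ∑ B : Finset (ZMod (k + 1)), if A ∪ B = Finset.univ then
      (v ^ A.card * u ^ B.card) • (lin R (decT A) * lin R (dec B)) else 0 := by
  set D : Finset (ZMod (k + 1)) → Finset (ZMod (k + 1)) → Module.End R (Tops k →₀ R) :=
    fun A B => (v ^ A.card * u ^ B.card) • (lin R (decT A) * lin R (dec B)) with hD
  set G : Finset (ZMod (k + 1)) → Module.End R (Tops k →₀ R) :=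
    fun W => ∑ A, ∑ B, if A ∪ B = W then D A B else 0 with hG
  have h1 : ∀ U : Finset (ZMod (k + 1)), U ≠ Finset.univ → ∑ W ∈ U.powerset, G W = 1 := by
    intro U hU
    rw [← sum_decT_mul_sum_dec huv hU, Finset.sum_mul_sum]
    simp only [hG]
    rw [Finset.sum_comm]
    rw [← Finset.sum_subset (Finset.subset_univ U.powerset)]
    · refine Finset.sum_congr rfl fun A hA => ?_
      rw [Finset.sum_comm, ← Finset.sum_subset (Finset.subset_univ U.powerset)]
      · refine Finset.sum_congr rfl fun B hB => ?_
        rw [Finset.sum_ite_eq, if_pos]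
        · simp only [hD, smul_mul_assoc, mul_smul_comm, smul_smul, mul_comm]
        · exact Finset.mem_powerset.2
            (Finset.union_subset (Finset.mem_powerset.1 hA) (Finset.mem_powerset.1 hB))
      · intro B _ hB
        rw [Finset.sum_ite_eq, if_neg]
        exact fun h => hB (Finset.mem_powerset.2
          (Finset.subset_union_right.trans (Finset.mem_powerset.1 h)))
    · intro A _ hA
      rw [Finset.sum_comm]
      refine Finset.sum_eq_zero fun B _ => ?_
      rw [Finset.sum_ite_eq, if_neg]
      exact fun h => hA (Finset.mem_powerset.2
        (Finset.subset_union_left.trans (Finset.mem_powerset.1 h)))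
  have h2 : ∀ U : Finset (ZMod (k + 1)), U ≠ Finset.univ → G U = if U = ∅ then 1 else 0 := by
    intro U
    induction U using Finset.strongInduction with
    | H U ih =>
      intro hU
      have h3 : ∑ W ∈ U.powerset, (if W = ∅ then 1 else 0 : Module.End R (Tops k →₀ R)) = 1 := by
        rw [Finset.sum_ite_eq', if_pos (by simp)]
      have hUU : U ∈ U.powerset := by simp
      replace h3 := h3.trans (h1 U hU).symm
      rw [← Finset.add_sum_erase _ _ hUU, ← Finset.add_sum_erase U.powerset G hUU] at h3
      have h5 : ∑ W ∈ U.powerset.erase U, (if W = ∅ then 1 else 0 : Module.End R (Tops k →₀ R)) =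
          ∑ W ∈ U.powerset.erase U, G W := by
        refine Finset.sum_congr rfl fun W hW => ?_
        have hW' := Finset.mem_powerset.1 (Finset.mem_of_mem_erase hW)
        rw [ih W (lt_of_le_of_ne hW' (Finset.ne_of_mem_erase hW))]
        rintro rfl
        exact hU (Finset.univ_subset_iff.1 hW')
      rw [h5] at h3
      refine LinearMap.ext fun x => (add_right_cancel (b := (∑ W ∈ U.powerset.erase U, G W) x) ?_).symm
      exact LinearMap.congr_fun h3 x
  have h4 : ∑ W, G W = 1 + G Finset.univ := by
    have : ∀ W, G W = (if W = ∅ then 1 else 0) + if W = Finset.univ then G Finset.univ else 0 := by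
      intro W
      by_cases h : W = Finset.univ
      · subst h
        rw [if_pos rfl, if_neg, zero_add]
        exact Finset.univ_nonempty.ne_empty
      · rw [if_neg h, add_zero, h2 W h]
    rw [Finset.sum_congr rfl fun W _ => this W, Finset.sum_add_distrib]
    simp
  rw [← h4]
  simp only [hG]
  have h6 : ∀ A B : Finset (ZMod (k + 1)), D A B = ∑ W, if A ∪ B = W then D A B else 0 :=
    fun A B => ((Finset.sum_ite_eq Finset.univ (A ∪ B) fun _ => D A B).trans
      (if_pos (Finset.mem_univ _))).symm
  conv_rhs => rw [Finset.sum_comm]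
  refine Finset.sum_congr rfl fun A _ => ?_
  conv_rhs => rw [Finset.sum_comm]
  exact Finset.sum_congr rfl fun B _ => h6 A B

open PowerSeries in
/-- The coefficients of the powers of `X / (1 - X)`. -/
noncomputable def altCoeff (a l : ℕ) : ℤ := coeff l ((X * mk 1 : ℤ⟦X⟧) ^ a)

theorem altCoeff_zero_left (l : ℕ) : altCoeff 0 l = if l = 0 then 1 else 0 := by
  simp [altCoeff, PowerSeries.coeff_one]

theorem altCoeff_succ_succ (a l : ℕ) : altCoeff (a + 1) (l + 1) = l.choose a := by
  rw [altCoeff, mul_pow, PowerSeries.mk_one_pow_eq_mk_choose_add, PowerSeries.coeff_X_pow_mul']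
  split_ifs with h
  · rw [PowerSeries.coeff_mk, show a + (l + 1 - (a + 1)) = l by omega]
  · rw [Nat.choose_eq_zero_of_lt (by omega), Nat.cast_zero]

/-- The operator attached to `e_l`, up to sign. -/
noncomputable def eOp (k l : ℕ) : Module.End ℤ (Tops k →₀ ℤ) :=
  ∑ A : Finset (ZMod (k + 1)), altCoeff A.card l • lin ℤ (decT A)

theorem lin_mul_apply (A B : Finset (ZMod (k + 1))) (p z : Tops k) :
    (lin R (decT A) * lin R (dec B)) (Finsupp.single p 1) z =
      if (dec B p).bind (decT A) = some z then 1 else 0 := by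
  rw [Module.End.mul_eq_comp, lin_comp, lin_single_apply]
  congr

open PowerSeries in
theorem sum_eOp_mul_hOp [Nontrivial (ZMod (k + 1))] {m : ℕ} (hm : m ≤ k) :
    ∑ b ∈ Finset.range (m + 1), (-1 : ℤ) ^ b • (eOp k (m - b) * hOp k b) = if m = 0 then 1 else 0 := by
  have huv : (-X : ℤ⟦X⟧) + X * mk 1 + -X * (X * mk 1) = 0 := by
    have := PowerSeries.mk_one_mul_one_sub_eq_one ℤ
    linear_combination X * this
  refine lin_ext fun p => Finsupp.ext fun z => ?_
  have h := congrArg (fun f => coeff m (f (Finsupp.single p 1) z)) (sum_decT_mul_dec_univ (k := k) huv)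
  set ent : Finset (ZMod (k + 1)) → Finset (ZMod (k + 1)) → ℤ :=
    fun A B => if (dec B p).bind (decT A) = some z then 1 else 0 with hent
  have hentC : ∀ A B, (if (dec B p).bind (decT A) = some z then 1 else 0 : ℤ⟦X⟧) = C (ent A B) := by
    intro A B
    simp only [hent]
    split_ifs <;> simp
  have hsplit : ∀ a b : ℕ, ((X * mk 1 : ℤ⟦X⟧) ^ a * (-X) ^ b) =
      X ^ b * ((X * mk 1 : ℤ⟦X⟧) ^ a * C ((-1) ^ b)) := by
    intro a b
    rw [neg_pow]
    simp only [map_pow, map_neg, map_one]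
    ring
  have hcoef : ∀ a b : ℕ, coeff m ((X * mk 1 : ℤ⟦X⟧) ^ a * (-X) ^ b) =
      if b ≤ m then altCoeff a (m - b) * (-1) ^ b else 0 := by
    intro a b
    rw [hsplit, coeff_X_pow_mul']
    split_ifs
    · rw [coeff_mul_C, altCoeff]
    · rfl
  have hzero : ∀ a b : ℕ, m < a + b → coeff m ((X * mk 1 : ℤ⟦X⟧) ^ a * (-X) ^ b) = 0 := by
    intro a b hab
    rw [hsplit, mul_pow, show X ^ b * (X ^ a * mk 1 ^ a * C ((-1) ^ b)) =
      (X : ℤ⟦X⟧) ^ (a + b) * (mk 1 ^ a * C ((-1) ^ b)) by ring, coeff_X_pow_mul', if_neg (by omega)]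
  have hbad : ∀ A B : Finset (ZMod (k + 1)), coeff m (((if A ∪ B = Finset.univ then
      ((X * mk 1 : ℤ⟦X⟧) ^ A.card * (-X) ^ B.card) • (lin ℤ⟦X⟧ (decT A) * lin ℤ⟦X⟧ (dec B)) else 0)
        (Finsupp.single p 1)) z) = 0 := by
    intro A B
    split_ifs with hAB
    · have hc := Finset.card_union_le A B
      rw [hAB, Finset.card_univ, ZMod.card] at hc
      rw [LinearMap.smul_apply, Finsupp.smul_apply, lin_mul_apply, hentC, smul_eq_mul, coeff_mul_C,
        hzero _ _ (by omega), zero_mul]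
    · simp
  simp only [LinearMap.sum_apply, LinearMap.add_apply, Finsupp.add_apply, Finsupp.finsetSum_apply,
    map_sum, map_add, hbad, Finset.sum_const_zero, add_zero, LinearMap.smul_apply,
    Finsupp.smul_apply, lin_mul_apply, hentC, smul_eq_mul, coeff_mul_C, hcoef,
    Module.End.one_apply] at h
  have hr : coeff m ((Finsupp.single p (1 : ℤ⟦X⟧)) z) =
      ((if m = 0 then 1 else 0 : Module.End ℤ (Tops k →₀ ℤ)) (Finsupp.single p 1)) z := by
    by_cases h0 : m = 0
    · by_cases hz : p = z
      · simp [h0, hz]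
      · simp [h0, hz]
    · by_cases hz : p = z
      · simp [h0, hz, coeff_one]
      · simp [h0, hz]
  rw [← hr, ← h]
  have hl : ∀ b, ((-1 : ℤ) ^ b • (eOp k (m - b) * hOp k b)) (Finsupp.single p 1) z =
      ∑ A : Finset (ZMod (k + 1)), ∑ B : Finset (ZMod (k + 1)), if B.card = b then
        altCoeff A.card (m - b) * (-1) ^ b * ent A B else 0 := by
    intro b
    rw [eOp, hOp, Finset.sum_mul_sum]
    simp only [Finset.smul_sum, LinearMap.sum_apply, Finsupp.finsetSum_apply, Finset.sum_filter]
    refine Finset.sum_congr rfl fun A _ => Finset.sum_congr rfl fun B _ => ?_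
    split_ifs
    · rw [smul_mul_assoc, LinearMap.smul_apply, LinearMap.smul_apply, Finsupp.smul_apply,
        Finsupp.smul_apply, lin_mul_apply, smul_eq_mul, smul_eq_mul]
      ring
    · simp
  simp only [LinearMap.sum_apply, Finsupp.finsetSum_apply, hl]
  rw [Finset.sum_comm]
  refine Finset.sum_congr rfl fun A _ => ?_
  rw [Finset.sum_comm]
  refine Finset.sum_congr rfl fun B _ => ?_
  rw [Finset.sum_ite_eq, ite_mul, zero_mul]
  simp only [Finset.mem_range, Nat.lt_succ_iff]

/-- The transposed operators. -/
noncomputable def hOpT (k r : ℕ) : Module.End ℤ (Tops k →₀ ℤ) := tauOp k ℤ * hOp k r * tauOp k ℤ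

theorem hOpT_eq (r : ℕ) : hOpT k r =
    ∑ A ∈ Finset.univ.filter fun A : Finset (ZMod (k + 1)) => A.card = r, lin ℤ (decT A) := by
  rw [hOpT, hOp, Finset.mul_sum, Finset.sum_mul]
  refine Finset.sum_bij' (fun A _ => negSet A) (fun A _ => negSet A) ?_ ?_ ?_ ?_ ?_
  · intro A hA
    simpa [card_negSet] using hA
  · intro A hA
    simpa [card_negSet] using hA
  · exact fun A _ => negSet_negSet A
  · exact fun A _ => negSet_negSet A
  · intro A _
    rw [lin_decT, negSet_negSet]

theorem eOp_eq_sum_hOpT (l : ℕ) :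
    eOp k l = ∑ a ∈ Finset.range (k + 2), altCoeff a l • hOpT k a := by
  simp only [hOpT_eq, Finset.smul_sum, Finset.sum_filter]
  rw [Finset.sum_comm, eOp]
  refine Finset.sum_congr rfl fun A _ => ?_
  have : A.card < k + 2 := by
    have := Finset.card_le_univ A
    rw [ZMod.card] at this
    omega
  simp only [smul_ite, smul_zero]
  rw [Finset.sum_ite_eq, if_pos (Finset.mem_range.2 this)]

theorem sum_choose_mul_altCoeff (m a : ℕ) :
    ∑ j ∈ Finset.range (m + 1), (m.choose j : ℤ) * (-1) ^ (j + 1) * altCoeff a (j + 1) =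
      if a = m + 1 then (-1) ^ (m + 1) else 0 := by
  cases a with
  | zero => simp [altCoeff_zero_left]
  | succ a =>
    simp only [altCoeff_succ_succ, add_left_inj]
    have h1 : ∀ j ∈ Finset.range (m + 1), (m.choose j : ℤ) * (-1) ^ (j + 1) * (j.choose a : ℤ) =
        if a ≤ j then (m.choose a : ℤ) * ((-1) ^ (j + 1) * ((m - a).choose (j - a) : ℤ)) else 0 := by
      intro j hj
      split_ifs with h
      · have := Nat.choose_mul (n := m) (k := j) (s := a) h
        have h' : (m.choose j : ℤ) * j.choose a = m.choose a * (m - a).choose (j - a) := by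
          exact_mod_cast this
        linear_combination (-1) ^ (j + 1) * h'
      · rw [Nat.choose_eq_zero_of_lt (not_le.1 h), Nat.cast_zero, mul_zero]
    rw [Finset.sum_congr rfl h1]
    rcases lt_or_ge m a with h | h
    · rw [if_neg (by omega)]
      refine Finset.sum_eq_zero fun j hj => if_neg ?_
      have := Finset.mem_range.1 hj
      omega
    · obtain ⟨d, rfl⟩ := Nat.exists_eq_add_of_le h
      rw [show a + d + 1 = a + (d + 1) by ring, Finset.sum_range_add, Finset.sum_eq_zero, zero_add]
      · simp only [le_add_iff_nonneg_right, zero_le, if_true, add_tsub_cancel_left]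
        rw [← Finset.mul_sum]
        have h2 : ∑ x ∈ Finset.range (d + 1), (-1 : ℤ) ^ (a + x + 1) * (d.choose x : ℤ) =
            (-1) ^ (a + 1) * if d = 0 then 1 else 0 := by
          rw [← Int.alternating_sum_range_choose, Finset.mul_sum]
          refine Finset.sum_congr rfl fun x _ => ?_
          ring
        rw [h2]
        by_cases hd : d = 0
        · simp [hd]
        · simp [hd]
      · intro j hj
        have := Finset.mem_range.1 hj
        exact if_neg (by omega)

theorem sum_choose_smul_eOp {m : ℕ} (hm : m ≤ k) :
    ∑ j ∈ Finset.range (m + 1), ((m.choose j : ℤ) * (-1) ^ (j + 1)) • eOp k (j + 1) =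
      (-1 : ℤ) ^ (m + 1) • hOpT k (m + 1) := by
  simp only [eOp_eq_sum_hOpT, Finset.smul_sum, smul_smul]
  rw [Finset.sum_comm]
  simp only [← Finset.sum_smul, sum_choose_mul_altCoeff, ite_smul, zero_smul]
  rw [Finset.sum_ite_eq', if_pos (by simp; omega)]

theorem hOp_zero : hOp k 0 = 1 := by
  have : (Finset.univ.filter fun A : Finset (ZMod (k + 1)) => A.card = 0) = {∅} := by
    ext A; simp
  rw [hOp, this, Finset.sum_singleton, show dec (k := k) ∅ = fun p => some p from funext dec_empty]
  exact lin_some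

end Duality

section Omega

variable {k : ℕ}

/-- Prepending a block to a composition. -/
def consComposition (n : ℕ) (x : Σ b : Fin n, Composition (n - (b + 1))) : Composition n where
  blocks := (x.1 + 1 : ℕ) :: x.2.blocks
  blocks_pos := by
    intro i hi
    rcases List.mem_cons.1 hi with rfl | h
    · omega
    · exact x.2.blocks_pos h
  blocks_sum := by
    rw [List.sum_cons, x.2.blocks_sum]
    have := x.1.2
    omega

theorem consComposition_bijective {n : ℕ} (hn : n ≠ 0) :
    Function.Bijective (consComposition n) := by
  constructor
  · rintro ⟨b, c⟩ ⟨b', c'⟩ h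
    have h1 := congrArg Composition.blocks h
    simp only [consComposition, List.cons.injEq, add_left_inj] at h1
    obtain rfl := Fin.ext h1.1
    rw [Composition.ext h1.2]
  · intro c
    cases hc : c.blocks with
    | nil =>
      have := c.blocks_sum
      rw [hc] at this
      exact absurd this.symm hn
    | cons a l =>
      have hs := c.blocks_sum
      rw [hc, List.sum_cons] at hs
      have ha : 0 < a := c.blocks_pos (by rw [hc]; simp)
      refine ⟨⟨⟨a - 1, by omega⟩, ⟨l, fun {i} hi => c.blocks_pos (by rw [hc]; simp [hi]), ?_⟩⟩, ?_⟩
      · simp only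
        omega
      · refine Composition.ext ?_
        simp only [consComposition, hc]
        rw [show a - 1 + 1 = a by omega]

theorem eSym_zero : eSym 0 = 1 := by
  have h : ∀ c : Composition 0, c.blocks = [] := fun c => c.blocks_eq_nil.2 rfl
  have hs : (Finset.univ : Finset (Composition 0)) = {⟨[], by simp, rfl⟩} := by
    ext c
    simp [Composition.ext_iff, h c]
  rw [eSym, hs, Finset.sum_singleton]
  simp

theorem eSym_eq_sum {n : ℕ} (hn : n ≠ 0) : eSym n =
    ∑ b ∈ Finset.range n, (-1 : ℤ) ^ b • (eSym (n - (b + 1)) * hSym (b + 1)) := by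
  rw [eSym, ← (consComposition_bijective hn).sum_comp, Fintype.sum_sigma, Finset.sum_range]
  refine Finset.sum_congr rfl fun b _ => ?_
  rw [eSym, Finset.sum_mul, Finset.smul_sum]
  refine Finset.sum_congr rfl fun c _ => ?_
  have h1 := c.length_le
  have h2 : n - (consComposition n ⟨b, c⟩).length = b + (n - (b + 1) - c.length) := by
    simp only [consComposition, Composition.length, List.length_cons] at h1 ⊢
    omega
  rw [h2, pow_add]
  simp only [consComposition, List.map_cons, List.prod_cons, zsmul_eq_mul]
  push_cast
  ring

open scoped IsMulCommutative in
/-- The action of symmetric functions on states, with signs. -/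
noncomputable def phi (k : ℕ) : SymFunc →ₐ[ℤ] Module.End ℤ (Tops k →₀ ℤ) :=
  haveI : IsMulCommutative (Algebra.adjoin ℤ (Set.range (hOp k))) :=
    Algebra.isMulCommutative_adjoin ℤ (by
      rintro _ ⟨r, rfl⟩ _ ⟨s, rfl⟩
      exact hOp_commute r s)
  (Algebra.adjoin ℤ (Set.range (hOp k))).val.comp
    (MvPolynomial.aeval fun n => (-1 : ℤ) ^ (n + 1) •
      (⟨hOp k (n + 1), Algebra.subset_adjoin ⟨n + 1, rfl⟩⟩ : Algebra.adjoin ℤ (Set.range (hOp k))))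

open scoped IsMulCommutative in
theorem phi_X (n : ℕ) : phi k (MvPolynomial.X n) = (-1 : ℤ) ^ (n + 1) • hOp k (n + 1) := by
  simp [phi]

theorem phi_hSym (r : ℕ) : phi k (hSym r) = (-1 : ℤ) ^ r • hOp k r := by
  cases r with
  | zero => simp [hSym, hOp_zero]
  | succ n => exact phi_X n

theorem eSym_mem_LambdaK {n : ℕ} (hn : n ≤ k) : eSym n ∈ LambdaK k := by
  refine Subalgebra.sum_mem _ fun c _ => Subalgebra.mul_mem _
    (Subalgebra.pow_mem _ (Subalgebra.neg_mem _ (Subalgebra.one_mem _)) _)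
    (Subalgebra.list_prod_mem _ fun x hx => ?_)
  obtain ⟨r, hr, rfl⟩ := List.mem_map.1 hx
  have h1 := c.blocks_pos hr
  have h2 : r ≤ n := c.blocks_sum ▸ List.le_sum_of_mem hr
  obtain ⟨s, rfl⟩ := Nat.exists_eq_succ_of_ne_zero h1.ne'
  exact MvPolynomial.X_mem_supported.2 (show s < k by omega)

theorem OmegaMap_mem_LambdaK {f : SymFunc} (hf : f ∈ LambdaK k) : OmegaMap f ∈ LambdaK k := by
  induction hf using Algebra.adjoin_induction with
  | mem x hx =>
    obtain ⟨n, hn, rfl⟩ := hx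
    rw [OmegaMap, MvPolynomial.aeval_X, gColumn, if_neg (by omega)]
    refine Subalgebra.sum_mem _ fun j hj => Subalgebra.zsmul_mem _ (eSym_mem_LambdaK ?_) _
    have := Finset.mem_Icc.1 hj
    have hn : n < k := hn
    omega
  | algebraMap r => rw [AlgHom.commutes]; exact Subalgebra.algebraMap_mem _ r
  | add x y _ _ hx hy => rw [map_add]; exact Subalgebra.add_mem _ hx hy
  | mul x y _ _ hx hy => rw [map_mul]; exact Subalgebra.mul_mem _ hx hy

variable [Nontrivial (ZMod (k + 1))]

theorem eOp_zero : eOp k 0 = 1 := by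
  have := sum_eOp_mul_hOp (k := k) (m := 0) (Nat.zero_le k)
  simpa [hOp_zero] using this

theorem eOp_eq_sum {n : ℕ} (hn : n ≠ 0) (hk : n ≤ k) : eOp k n =
    ∑ b ∈ Finset.range n, (-1 : ℤ) ^ b • (eOp k (n - (b + 1)) * hOp k (b + 1)) := by
  have h := sum_eOp_mul_hOp hk
  rw [if_neg hn, Finset.sum_range_succ'] at h
  simp only [pow_zero, one_smul, Nat.sub_zero, hOp_zero, mul_one] at h
  rw [eq_comm, ← sub_eq_zero, ← neg_eq_zero, ← h, neg_sub, sub_eq_add_neg, add_comm,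
    ← Finset.sum_neg_distrib]
  congr 1
  refine Finset.sum_congr rfl fun b _ => ?_
  rw [pow_succ, mul_neg_one, neg_smul]

theorem phi_eSym {n : ℕ} (hk : n ≤ k) : phi k (eSym n) = (-1 : ℤ) ^ n • eOp k n := by
  induction n using Nat.strong_induction_on with
  | _ n ih =>
    by_cases hn : n = 0
    · subst hn
      simp [eSym_zero, eOp_zero]
    · rw [eSym_eq_sum hn, eOp_eq_sum hn hk, map_sum, Finset.smul_sum]
      refine Finset.sum_congr rfl fun b hb => ?_
      have hb := Finset.mem_range.1 hb
      rw [map_zsmul, map_mul, ih _ (by omega) (by omega), phi_hSym]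
      simp only [smul_mul_assoc, mul_smul_comm, smul_smul]
      congr 1
      rw [← pow_add, ← pow_add, ← pow_add, show b + 1 + (n - (b + 1)) = n by omega, add_comm]

theorem phi_gColumn {m : ℕ} (hm : m + 1 ≤ k) :
    phi k (gColumn (m + 1)) = (-1 : ℤ) ^ (m + 1) • hOpT k (m + 1) := by
  rw [← sum_choose_smul_eOp (by omega), gColumn, if_neg (by omega), map_sum]
  have h := Finset.sum_Ico_add' (fun j => ((m.choose (j - 1) : ℤ) * (-1) ^ j) • eOp k j) 0 (m + 1) 1
  simp only [add_tsub_cancel_right] at h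
  rw [Finset.range_eq_Ico, h]
  refine Finset.sum_congr (by ext j; simp only [Finset.mem_Icc, Finset.mem_Ico]; omega)
    fun j hj => ?_
  have hj := Finset.mem_Icc.1 hj
  rw [map_zsmul, phi_eSym (by omega), smul_smul]
  simp

theorem phi_OmegaMap {f : SymFunc} (hf : f ∈ LambdaK k) :
    phi k (OmegaMap f) = tauOp k ℤ * phi k f * tauOp k ℤ := by
  induction hf using Algebra.adjoin_induction with
  | mem x hx =>
    obtain ⟨n, hn, rfl⟩ := hx
    rw [OmegaMap, MvPolynomial.aeval_X, phi_gColumn hn, phi_X, mul_smul_comm, smul_mul_assoc, hOpT]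
  | algebraMap r =>
    rw [AlgHom.commutes, AlgHom.commutes, Algebra.algebraMap_eq_smul_one, mul_smul_comm, mul_one,
      smul_mul_assoc, tauOp_mul_self]
  | add x y _ _ hx hy => rw [map_add, map_add, map_add, hx, hy, mul_add, add_mul]
  | mul x y _ _ hx hy =>
    rw [map_mul, map_mul, map_mul, hx, hy]
    calc _ = tauOp k ℤ * phi k x * (tauOp k ℤ * tauOp k ℤ) * phi k y * tauOp k ℤ := by
          simp only [mul_assoc]
      _ = _ := by rw [tauOp_mul_self]; simp only [mul_one, mul_assoc]

end Omega

section Cores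

variable {k : ℕ} {γ δ : YoungDiagram}

/-- The Young diagram with prescribed row lengths. -/
noncomputable def ofRows (f : ℕ → ℕ) (hf : Antitone f) (N : ℕ) (_hN : ∀ r, N ≤ r → f r = 0) :
    YoungDiagram where
  cells := (Finset.range N ×ˢ Finset.range (f 0)).filter fun c => c.2 < f c.1
  isLowerSet := by
    rintro ⟨a, b⟩ ⟨c, d⟩ hle hab
    obtain ⟨h1, h2⟩ : c ≤ a ∧ d ≤ b := hle
    simp only [Finset.coe_filter, Finset.mem_product, Finset.mem_range, Set.mem_ofPred_eq] at hab ⊢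
    have := hf h1
    omega

theorem mem_ofRows {f : ℕ → ℕ} {hf : Antitone f} {N : ℕ} {hN : ∀ r, N ≤ r → f r = 0}
    {c : ℕ × ℕ} :
    c ∈ ofRows f hf N hN ↔ c.2 < f c.1 := by
  rw [← YoungDiagram.mem_cells]
  simp only [ofRows, Finset.mem_filter, Finset.mem_product, Finset.mem_range, and_iff_right_iff_imp]
  intro h
  refine ⟨?_, h.trans_le (hf (Nat.zero_le _))⟩
  by_contra h'
  rw [hN _ (not_lt.1 h')] at h
  omega

theorem rowLen_eq_of_forall {r m : ℕ} (h : ∀ c, (r, c) ∈ γ ↔ c < m) : γ.rowLen r = m := by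
  have h1 := h m
  have h2 := h (γ.rowLen r)
  rw [YoungDiagram.mem_iff_lt_rowLen] at h1 h2
  omega

theorem colLen_eq_of_forall {c m : ℕ} (h : ∀ r, (r, c) ∈ γ ↔ r < m) : γ.colLen c = m := by
  have h1 := h m
  have h2 := h (γ.colLen c)
  rw [YoungDiagram.mem_iff_lt_colLen] at h1 h2
  omega

theorem rowLen_ofRows {f : ℕ → ℕ} {hf : Antitone f} {N : ℕ} {hN : ∀ r, N ≤ r → f r = 0}
    (r : ℕ) :
    (ofRows f hf N hN).rowLen r = f r :=
  rowLen_eq_of_forall fun _ => mem_ofRows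

theorem ext_rowLen (h : ∀ r, γ.rowLen r = δ.rowLen r) : γ = δ := by
  refine YoungDiagram.ext (Finset.ext fun c => ?_)
  rw [YoungDiagram.mem_cells, YoungDiagram.mem_cells, ← Prod.mk.eta (p := c),
    YoungDiagram.mem_iff_lt_rowLen, YoungDiagram.mem_iff_lt_rowLen, h]

theorem lt_colLen_iff {r c : ℕ} : r < γ.colLen c ↔ c < γ.rowLen r := by
  rw [← YoungDiagram.mem_iff_lt_colLen, YoungDiagram.mem_iff_lt_rowLen]

theorem rowLen_eq_zero {r : ℕ} (h : γ.colLen 0 ≤ r) : γ.rowLen r = 0 := by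
  have := lt_colLen_iff (γ := γ) (r := r) (c := 0)
  omega

theorem hookLen_anti {r c c' : ℕ} (h : c ≤ c') : hookLen γ r c' ≤ hookLen γ r c := by
  have := γ.colLen_anti c c' h
  unfold hookLen
  omega

theorem pRow_eq_card (r : ℕ) :
    pRow k γ r = ((Finset.range (γ.rowLen r)).filter fun c => hookLen γ r c ≤ k).card := by
  rw [pRow]
  refine Finset.card_bij' (fun c _ => c.2) (fun c _ => (r, c)) ?_ ?_ ?_ ?_
  · rintro ⟨a, b⟩ h
    simp only [Finset.mem_filter, YoungDiagram.mem_cells] at h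
    obtain ⟨h1, rfl, h2⟩ := h
    simpa [YoungDiagram.mem_iff_lt_rowLen.1 h1] using h2
  · intro c h
    simpa [YoungDiagram.mem_iff_lt_rowLen] using h
  · rintro ⟨a, b⟩ h
    simp only [Finset.mem_filter] at h
    rw [h.2.1]
  · intro c h
    rfl

theorem pRow_eq_of_forall {r m : ℕ} (hm : m ≤ γ.rowLen r)
    (h : ∀ c < γ.rowLen r, (hookLen γ r c ≤ k ↔ γ.rowLen r - m ≤ c)) : pRow k γ r = m := by
  rw [pRow_eq_card]
  have : ((Finset.range (γ.rowLen r)).filter fun c => hookLen γ r c ≤ k) =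
      Finset.Ico (γ.rowLen r - m) (γ.rowLen r) := by
    ext c
    simp only [Finset.mem_filter, Finset.mem_range, Finset.mem_Ico]
    exact ⟨fun ⟨h1, h2⟩ => ⟨(h c h1).1 h2, h1⟩, fun ⟨h1, h2⟩ => ⟨h2, (h c h2).2 h1⟩⟩
  rw [this, Nat.card_Ico]
  omega

theorem pRow_spec (k : ℕ) (γ : YoungDiagram) (r : ℕ) : pRow k γ r ≤ γ.rowLen r ∧
    ∀ c < γ.rowLen r, (hookLen γ r c ≤ k ↔ γ.rowLen r - pRow k γ r ≤ c) := by
  obtain ⟨m, hm, h⟩ : ∃ m ≤ γ.rowLen r,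
      ∀ c < γ.rowLen r, (hookLen γ r c ≤ k ↔ γ.rowLen r - m ≤ c) := by
    have hex : ∃ x, γ.rowLen r ≤ x ∨ hookLen γ r x ≤ k := ⟨_, Or.inl le_rfl⟩
    have hx : Nat.find hex ≤ γ.rowLen r := Nat.find_min' hex (Or.inl le_rfl)
    refine ⟨γ.rowLen r - Nat.find hex, Nat.sub_le _ _, fun c hc => ?_⟩
    rw [Nat.sub_sub_self hx]
    constructor
    · exact fun h => Nat.find_min' hex (Or.inr h)
    · intro h
      rcases Nat.find_spec hex with h' | h'
      · omega
      · exact (hookLen_anti h).trans h'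
  rw [pRow_eq_of_forall hm h]
  exact ⟨hm, h⟩

theorem pRow_pos (hγ : IsCore (k + 1) γ) {r : ℕ} (hr : 0 < γ.rowLen r) : 0 < pRow k γ r := by
  obtain ⟨h1, h2⟩ := pRow_spec k γ r
  by_contra h0
  have h3 := h2 (γ.rowLen r - 1) (by omega)
  set c := γ.rowLen r - 1 with hc
  have h4 : r < γ.colLen c := lt_colLen_iff.2 (by omega)
  have h5 : r + k < γ.colLen c := by
    by_contra h5
    unfold hookLen at h3
    omega
  have h6 : γ.colLen c - 1 - k < γ.colLen c := by omega
  have h7 := lt_colLen_iff.1 h6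
  have h8 := γ.rowLen_anti r (γ.colLen c - 1 - k) (by omega)
  refine hγ (γ.colLen c - 1 - k, c) (YoungDiagram.mem_iff_lt_colLen.2 h6) ?_
  simp only [hookLen]
  omega

theorem pRow_le (hγ : IsCore (k + 1) γ) (r : ℕ) : pRow k γ r ≤ k := by
  obtain ⟨h1, h2⟩ := pRow_spec k γ r
  rcases Nat.eq_zero_or_pos (γ.rowLen r) with h | h
  · omega
  · have hp := pRow_pos hγ h
    have h3 := (h2 (γ.rowLen r - pRow k γ r) (by omega)).2 le_rfl
    have h4 : r < γ.colLen (γ.rowLen r - pRow k γ r) := lt_colLen_iff.2 (by omega)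
    unfold hookLen at h3
    omega

theorem colLen_ge_of_lt_pRow (hγ : IsCore (k + 1) γ) {r c : ℕ} (hc : c < γ.rowLen r - pRow k γ r) :
    r + (k + 1) - pRow k γ r < γ.colLen c := by
  obtain ⟨h1, h2⟩ := pRow_spec k γ r
  have hle := pRow_le hγ r
  have hx : γ.rowLen r - pRow k γ r - 1 < γ.rowLen r := by omega
  have h3 := h2 (γ.rowLen r - pRow k γ r - 1) hx
  have h4 := hγ (r, γ.rowLen r - pRow k γ r - 1) (YoungDiagram.mem_iff_lt_rowLen.2 hx)
  have h5 := γ.colLen_anti c (γ.rowLen r - pRow k γ r - 1) (by omega)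
  have h6 := lt_colLen_iff.2 hx
  simp only [hookLen] at h3 h4
  omega

theorem rowLen_eq_pRow_add (hγ : IsCore (k + 1) γ) (r : ℕ) :
    γ.rowLen r = pRow k γ r + γ.rowLen (r + (k + 1) - pRow k γ r) := by
  obtain ⟨h1, h2⟩ := pRow_spec k γ r
  have hle := pRow_le hγ r
  have hge : γ.rowLen r - pRow k γ r ≤ γ.rowLen (r + (k + 1) - pRow k γ r) := by
    by_contra h
    have := lt_colLen_iff.1 (colLen_ge_of_lt_pRow hγ (r := r)
      (c := γ.rowLen r - pRow k γ r - 1) (by omega))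
    omega
  have hle' : γ.rowLen (r + (k + 1) - pRow k γ r) ≤ γ.rowLen r - pRow k γ r := by
    rcases Nat.eq_zero_or_pos (γ.rowLen r) with h | h
    · have := γ.rowLen_anti r (r + (k + 1) - pRow k γ r) (by omega)
      omega
    · have hp := pRow_pos hγ h
      have hx : γ.rowLen r - pRow k γ r < γ.rowLen r := by omega
      have h3 := (h2 _ hx).2 le_rfl
      have h4 := lt_colLen_iff.2 hx
      by_contra h5
      have h6 := lt_colLen_iff.2 (not_le.1 h5)
      unfold hookLen at h3
      omega
  omega

theorem pRow_antitone (hγ : IsCore (k + 1) γ) : Antitone (pRow k γ) := by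
  refine antitone_nat_of_succ_le fun r => ?_
  by_contra h
  obtain ⟨h1, h2⟩ := pRow_spec k γ r
  obtain ⟨h1', h2'⟩ := pRow_spec k γ (r + 1)
  have hle := pRow_le hγ r
  have hanti := γ.rowLen_anti r (r + 1) (by omega)
  have hx : γ.rowLen (r + 1) - pRow k γ r - 1 < γ.rowLen (r + 1) := by omega
  have h3 := (h2' _ hx).2 (by omega)
  have h4 := colLen_ge_of_lt_pRow hγ (r := r) (c := γ.rowLen (r + 1) - pRow k γ r - 1) (by omega)
  unfold hookLen at h3
  omega

theorem core_ext (hγ : IsCore (k + 1) γ) (hδ : IsCore (k + 1) δ)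
    (h : ∀ r, pRow k γ r = pRow k δ r) : γ = δ := by
  have key : ∀ m r, γ.colLen 0 + δ.colLen 0 ≤ r + m → γ.rowLen r = δ.rowLen r := by
    intro m
    induction m with
    | zero =>
      intro r hr
      rw [rowLen_eq_zero (by omega), rowLen_eq_zero (by omega)]
    | succ m ih =>
      intro r hr
      have := pRow_le hδ r
      rw [rowLen_eq_pRow_add hγ, rowLen_eq_pRow_add hδ, h, ih]
      omega
  exact ext_rowLen fun r => key (γ.colLen 0 + δ.colLen 0) r (by omega)

theorem exists_core (N : ℕ) : ∀ f : ℕ → ℕ, Antitone f → (∀ r, f r ≤ k) → (∀ r, N ≤ r → f r = 0) →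
    ∃ γ : YoungDiagram, IsCore (k + 1) γ ∧ ∀ r, pRow k γ r = f r := by
  induction N with
  | zero =>
    intro f _ _ h0
    refine ⟨⊥, fun c hc => absurd hc (YoungDiagram.notMem_bot c), fun r => ?_⟩
    have h1 : (⊥ : YoungDiagram).rowLen r = 0 := rowLen_eq_of_forall fun c => by simp
    have h2 := (pRow_spec k ⊥ r).1
    rw [h0 r (Nat.zero_le _)]
    omega
  | succ N ih =>
    intro f hf hk h0
    obtain ⟨γ, hγ, hp⟩ := ih (fun r => f (r + 1)) (fun a b h => hf (by omega)) (fun r => hk _)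
      (fun r hr => h0 _ (by omega))
    have hk0 := hk 0
    set x := γ.rowLen (k - f 0) with hx
    have hx0 : γ.rowLen 0 ≤ f 0 + x := by
      have h1 := rowLen_eq_pRow_add hγ 0
      have h2 : f 1 ≤ f 0 := hf (by omega)
      rw [hp, zero_add, zero_add] at h1
      have h3 := γ.rowLen_anti (k - f 0) (k + 1 - f 1) (by omega)
      omega
    have hg : Antitone fun r : ℕ => Nat.casesOn (motive := fun _ => ℕ) r (f 0 + x) γ.rowLen := by
      refine antitone_nat_of_succ_le fun r => ?_
      cases r with
      | zero => exact hx0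
      | succ r => exact γ.rowLen_anti r (r + 1) (by omega)
    have hN : ∀ r, γ.colLen 0 + 1 ≤ r → Nat.casesOn (motive := fun _ => ℕ) r (f 0 + x) γ.rowLen = 0 := by
      intro r hr
      cases r with
      | zero => omega
      | succ r => exact rowLen_eq_zero (by omega)
    set δ := ofRows _ hg _ hN with hδ
    have hr0 : δ.rowLen 0 = f 0 + x := rowLen_ofRows 0
    have hr1 : ∀ r, δ.rowLen (r + 1) = γ.rowLen r := fun r => rowLen_ofRows (r + 1)
    have hcol : ∀ c < f 0 + x, δ.colLen c = γ.colLen c + 1 := by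
      intro c hc
      refine colLen_eq_of_forall fun r => ?_
      rw [YoungDiagram.mem_iff_lt_rowLen]
      cases r with
      | zero => rw [hr0]; omega
      | succ r => rw [hr1, ← lt_colLen_iff]; omega
    have hhook : ∀ r c, c < γ.rowLen r → hookLen δ (r + 1) c = hookLen γ r c := by
      intro r c hc
      have := γ.rowLen_anti 0 r (Nat.zero_le _)
      simp only [hookLen, hr1, hcol c (by omega)]
      omega
    have h0small : ∀ c, c < f 0 + x → x ≤ c → hookLen δ 0 c ≤ k := by
      intro c hc hxc
      have h1 : ¬ (k - f 0 < γ.colLen c) := by rw [lt_colLen_iff]; omega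
      simp only [hookLen, hr0, hcol c hc]
      omega
    have h0big : ∀ c < x, k + 1 < hookLen δ 0 c := by
      intro c hc
      have h1 : k - f 0 < γ.colLen c := lt_colLen_iff.2 hc
      simp only [hookLen, hr0, hcol c (by omega)]
      omega
    refine ⟨δ, ?_, ?_⟩
    · rintro ⟨r, c⟩ hc
      rw [YoungDiagram.mem_iff_lt_rowLen] at hc
      cases r with
      | zero =>
        rw [hr0] at hc
        rcases lt_or_ge c x with h | h
        · exact (h0big c h).ne'
        · exact (Nat.lt_succ_of_le (h0small c hc h)).ne
      | succ r =>
        rw [hr1] at hc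
        rw [hhook r c hc]
        exact hγ (r, c) (YoungDiagram.mem_iff_lt_rowLen.2 hc)
    · intro r
      cases r with
      | zero =>
        refine pRow_eq_of_forall (by omega) fun c hc => ?_
        rw [hr0] at hc ⊢
        constructor
        · intro h
          by_contra h'
          have := h0big c (by omega)
          omega
        · exact fun h => h0small c hc (by omega)
      | succ r =>
        rw [← hp r]
        obtain ⟨h1, h2⟩ := pRow_spec k γ r
        refine pRow_eq_of_forall (by rwa [hr1]) fun c hc => ?_
        rw [hr1] at hc ⊢
        rw [hhook r c hc]
        exact h2 c hc

theorem exists_pPart (hγ : IsCore (k + 1) γ) :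
    ∃ lam : YoungDiagram, ∀ i, lam.rowLen i = pRow k γ i :=
  ⟨ofRows (pRow k γ) (pRow_antitone hγ) (γ.colLen 0) fun r hr => by
    have := (pRow_spec k γ r).1
    rw [rowLen_eq_zero hr] at this
    omega, fun _ => rowLen_ofRows _⟩

theorem rowLen_pPart (hγ : IsCore (k + 1) γ) (i : ℕ) : (pPart k γ).rowLen i = pRow k γ i :=
  Classical.epsilon_spec (exists_pPart hγ) i

theorem isKBounded_pPart (hγ : IsCore (k + 1) γ) : IsKBounded k (pPart k γ) := fun i => by
  rw [rowLen_pPart hγ]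
  exact pRow_le hγ i

theorem coreOf_spec {lam : YoungDiagram} (h : IsKBounded k lam) :
    IsCore (k + 1) (coreOf k lam) ∧ ∀ i, pRow k (coreOf k lam) i = lam.rowLen i :=
  Classical.epsilon_spec (exists_core (lam.colLen 0) lam.rowLen
    (fun _ _ h => lam.rowLen_anti _ _ h) h fun _ hr => rowLen_eq_zero hr)

theorem pPart_coreOf {lam : YoungDiagram} (h : IsKBounded k lam) : pPart k (coreOf k lam) = lam :=
  ext_rowLen fun r => by rw [rowLen_pPart (coreOf_spec h).1, (coreOf_spec h).2]

theorem coreOf_pPart (hγ : IsCore (k + 1) γ) : coreOf k (pPart k γ) = γ := by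
  obtain ⟨h1, h2⟩ := coreOf_spec (isKBounded_pPart hγ)
  exact core_ext h1 hγ fun r => by rw [h2, rowLen_pPart hγ]

theorem card_eq_sum_rowLen {N : ℕ} (hN : γ.colLen 0 ≤ N) :
    γ.card = ∑ r ∈ Finset.range N, γ.rowLen r := by
  rw [YoungDiagram.card, Finset.card_eq_sum_card_fiberwise (f := Prod.fst) (t := Finset.range N)]
  · refine Finset.sum_congr rfl fun r _ => ?_
    rw [γ.rowLen_eq_card, YoungDiagram.row]
  · intro c hc
    have h := γ.colLen_anti 0 c.2 (Nat.zero_le _)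
    have := YoungDiagram.mem_iff_lt_colLen.1 (show (c.1, c.2) ∈ γ from hc)
    simp only [Finset.coe_range, Set.mem_Iio]
    omega

theorem pSize_eq_sum {N : ℕ} (hN : γ.colLen 0 ≤ N) :
    pSize k γ = ∑ r ∈ Finset.range N, pRow k γ r := by
  rw [pSize, Finset.card_eq_sum_card_fiberwise (f := Prod.fst) (t := Finset.range N)]
  · refine Finset.sum_congr rfl fun r _ => ?_
    rw [pRow, Finset.filter_filter]
    congr 1
    ext c
    simp only [Finset.mem_filter]
    tauto
  · intro c hc
    have h := γ.colLen_anti 0 c.2 (Nat.zero_le _)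
    have hc' : c ∈ γ.cells := (Finset.mem_filter.1 hc).1
    have := YoungDiagram.mem_iff_lt_colLen.1 (show (c.1, c.2) ∈ γ from hc')
    simp only [Finset.coe_range, Set.mem_Iio]
    omega

theorem card_pPart (hγ : IsCore (k + 1) γ) : (pPart k γ).card = pSize k γ := by
  rw [card_eq_sum_rowLen (le_max_left _ (γ.colLen 0)), pSize_eq_sum (le_max_right _ _)]
  exact Finset.sum_congr rfl fun r _ => rowLen_pPart hγ r

theorem hookLen_transpose (r c : ℕ) : hookLen γ.transpose r c = hookLen γ c r := by
  simp [hookLen, add_comm]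

theorem IsCore.transpose {p : ℕ} (hγ : IsCore p γ) : IsCore p γ.transpose := fun c hc => by
  rw [hookLen_transpose]
  exact hγ c.swap (YoungDiagram.mem_transpose.1 hc)

theorem pSize_transpose : pSize k γ.transpose = pSize k γ := by
  refine Finset.card_bij' (fun c _ => c.swap) (fun c _ => c.swap) ?_ ?_ ?_ ?_
  · intro c hc
    simpa [hookLen_transpose] using hc
  · intro c hc
    simpa [hookLen_transpose] using hc
  · exact fun c _ => c.swap_swap
  · exact fun c _ => c.swap_swap

end Cores

section Beads

variable {k : ℕ} {γ δ : YoungDiagram}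

theorem add_le_of_cast_eq {a b : ℤ} (h : (a : ZMod (k + 1)) = b) (hab : a < b) :
    a + (k + 1) ≤ b := by
  rw [ZMod.intCast_eq_intCast_iff_dvd_sub] at h
  have := Int.le_of_dvd (by omega) h
  push_cast at this
  omega

/-- The position of the bead attached to a row: the content of its last cell. -/
noncomputable def bead (γ : YoungDiagram) (r : ℕ) : ℤ := γ.rowLen r - r - 1

/-- The content of the cell just below the top of the column, up to a shift. -/
noncomputable def gap (γ : YoungDiagram) (c : ℕ) : ℤ := c - γ.colLen c

theorem bead_strictAnti : StrictAnti (bead γ) := by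
  intro r s h
  have := γ.rowLen_anti r s h.le
  unfold bead
  omega

/-- The positions of the beads. -/
def IsBead (γ : YoungDiagram) (b : ℤ) : Prop := ∃ r, bead γ r = b

theorem bead_lt_gap {r c : ℕ} : bead γ r < gap γ c ↔ γ.rowLen r ≤ c := by
  have := lt_colLen_iff (γ := γ) (r := r) (c := c)
  unfold bead gap
  omega

theorem gap_lt_bead {r c : ℕ} : gap γ c < bead γ r ↔ c < γ.rowLen r := by
  have := lt_colLen_iff (γ := γ) (r := r) (c := c)
  unfold bead gap
  omega

theorem not_isBead_iff {b : ℤ} : ¬ IsBead γ b ↔ ∃ c, gap γ c = b := by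
  constructor
  · intro h
    have hex : ∃ r, bead γ r < b := by
      refine ⟨γ.colLen 0 + b.natAbs, ?_⟩
      have := rowLen_eq_zero (γ := γ) (r := γ.colLen 0 + b.natAbs) (by omega)
      unfold bead
      omega
    have h1 := Nat.find_spec hex
    have h2 := fun m => Nat.find_min (m := m) hex
    set r := Nat.find hex
    have hc : 0 ≤ b + r := by unfold bead at h1; omega
    refine ⟨(b + r).toNat, ?_⟩
    have : γ.colLen (b + r).toNat = r := by
      refine colLen_eq_of_forall fun s => ?_
      rw [YoungDiagram.mem_iff_lt_rowLen]
      constructor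
      · intro hs
        by_contra hrs
        have := γ.rowLen_anti r s (by omega)
        unfold bead at h1
        omega
      · intro hs
        have h3 := γ.rowLen_anti s (r - 1) (by omega)
        have h4 := h2 (r - 1) (by omega)
        have h5 : bead γ (r - 1) ≠ b := fun h' => h ⟨_, h'⟩
        unfold bead at h4 h5
        omega
    unfold gap
    omega
  · rintro ⟨c, rfl⟩ ⟨r, hr⟩
    have h1 := bead_lt_gap (γ := γ) (r := r) (c := c)
    have h2 := gap_lt_bead (γ := γ) (r := r) (c := c)
    omega

theorem eq_of_isBead (h : ∀ b, IsBead γ b ↔ IsBead δ b) : γ = δ := by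
  have : bead γ = bead δ := by
    have hr : Set.range (OrderDual.toDual ∘ bead γ) = Set.range (OrderDual.toDual ∘ bead δ) :=
      Set.ext fun b => h (OrderDual.ofDual b)
    have := (StrictMono.range_inj (f := OrderDual.toDual ∘ bead γ) (g := OrderDual.toDual ∘ bead δ)
      (fun _ _ h => bead_strictAnti h) (fun _ _ h => bead_strictAnti h)).1 hr
    exact funext fun r => congrFun this r
  refine ext_rowLen fun r => ?_
  have := congrFun this r
  unfold bead at this
  omega

theorem isBead_transpose {b : ℤ} : IsBead γ.transpose b ↔ ¬ IsBead γ (-1 - b) := by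
  rw [not_isBead_iff]
  refine exists_congr fun c => ?_
  simp only [bead, gap, YoungDiagram.rowLen_transpose]
  omega

theorem hookLen_eq {r c : ℕ} (h : c < γ.rowLen r) : (hookLen γ r c : ℤ) = bead γ r - gap γ c := by
  have := lt_colLen_iff.2 h
  unfold hookLen bead gap
  omega

theorem removable_iff {r c : ℕ} :
    Removable γ (r, c) ↔ bead γ r = c - r ∧ gap γ c = c - r - 1 := by
  have h := lt_colLen_iff (γ := γ) (r := r + 1) (c := c)
  have h' := lt_colLen_iff (γ := γ) (r := r) (c := c)
  simp only [Removable, YoungDiagram.mem_iff_lt_rowLen]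
  unfold bead gap
  omega

theorem exists_removable_iff {a : ℤ} : (∃ r c : ℕ, Removable γ (r, c) ∧ (c : ℤ) - r = a) ↔
    IsBead γ a ∧ ¬ IsBead γ (a - 1) := by
  simp only [removable_iff]
  constructor
  · rintro ⟨r, c, ⟨h1, h2⟩, rfl⟩
    exact ⟨⟨r, h1⟩, not_isBead_iff.2 ⟨c, h2⟩⟩
  · rintro ⟨⟨r, h1⟩, h2⟩
    obtain ⟨c, h2⟩ := not_isBead_iff.1 h2
    have h3 := gap_lt_bead (γ := γ) (r := r) (c := c)
    have h4 := lt_colLen_iff (γ := γ) (r := r) (c := c)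
    refine ⟨r, c, ?_⟩
    unfold bead gap at *
    omega

/-- The abacus state `p` represents the diagram `γ`. -/
def Rep (γ : YoungDiagram) (p : Tops k) : Prop :=
  (∀ j, (p j : ZMod (k + 1)) = j) ∧ ∀ b : ℤ, IsBead γ b ↔ b ≤ p b

theorem IsCore.exists_rep (hγ : IsCore (k + 1) γ) : ∃ p : Tops k, Rep γ p := by
  have hdown : ∀ b, IsBead γ b → IsBead γ (b - (k + 1)) := by
    rintro _ ⟨r, rfl⟩
    by_contra h
    obtain ⟨c, hc⟩ := not_isBead_iff.1 h
    have h1 : c < γ.rowLen r := gap_lt_bead.1 (by omega)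
    refine hγ (r, c) (YoungDiagram.mem_iff_lt_rowLen.2 h1) ?_
    have := hookLen_eq h1
    simp only
    omega
  have hdown' : ∀ t : ℕ, ∀ b, IsBead γ b → IsBead γ (b - (k + 1) * t) := by
    intro t
    induction t with
    | zero => simp
    | succ t ih =>
      intro b hb
      have := hdown _ (ih b hb)
      push_cast
      convert this using 1
      ring
  have hex : ∀ j : ZMod (k + 1), ∃ b : ℤ, ((b : ZMod (k + 1)) = j ∧ IsBead γ b) ∧
      ∀ b' : ℤ, ((b' : ZMod (k + 1)) = j ∧ IsBead γ b') → b' ≤ b := by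
    intro j
    refine Int.exists_greatest_of_bdd ⟨bead γ 0, ?_⟩ ⟨j.val - (k + 1) * (γ.colLen 0 + 1 : ℕ), ?_, ?_⟩
    · rintro _ ⟨_, r, rfl⟩
      exact bead_strictAnti.antitone (Nat.zero_le r)
    · have : ((k : ZMod (k + 1)) + 1) = 0 := by exact_mod_cast ZMod.natCast_self (k + 1)
      push_cast
      rw [this]
      simp
    · have h1 := ZMod.val_lt j
      have h2 : γ.colLen 0 + 1 + k * (γ.colLen 0 + 1) = (k + 1) * (γ.colLen 0 + 1) := by ring
      have h3 : k ≤ k * (γ.colLen 0 + 1) := Nat.le_mul_of_pos_right _ (by omega)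
      refine ⟨(k + 1) * (γ.colLen 0 + 1) - j.val - 1, ?_⟩
      have := rowLen_eq_zero (γ := γ) (r := (k + 1) * (γ.colLen 0 + 1) - j.val - 1) (by omega)
      unfold bead
      rw [this]
      push_cast [show j.val ≤ (k + 1) * (γ.colLen 0 + 1) by omega,
        show 1 ≤ (k + 1) * (γ.colLen 0 + 1) - j.val by omega]
      ring
  choose p hp using hex
  refine ⟨p, fun j => (hp j).1.1, fun b => ⟨fun h => (hp b).2 b ⟨rfl, h⟩, fun h => ?_⟩⟩
  have h1 := (hp b).1.1
  rw [eq_comm, ZMod.intCast_eq_intCast_iff_dvd_sub] at h1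
  obtain ⟨t, ht⟩ := h1
  have ht0 : 0 ≤ t := by
    by_contra hneg
    push_cast at ht
    nlinarith
  have := hdown' t.toNat _ (hp b).1.2
  push_cast at ht
  rw [Int.toNat_of_nonneg ht0] at this
  convert this using 1
  linarith

theorem Rep.isCore {p : Tops k} (h : Rep γ p) : IsCore (k + 1) γ := by
  rintro ⟨r, c⟩ hc hook
  have h1 := hookLen_eq (YoungDiagram.mem_iff_lt_rowLen.1 hc)
  simp only at hook
  have h2 := (h.2 _).1 ⟨r, rfl⟩
  have h3 : ((gap γ c : ℤ) : ZMod (k + 1)) = (bead γ r : ℤ) := by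
    rw [ZMod.intCast_eq_intCast_iff_dvd_sub]
    exact ⟨1, by push_cast; omega⟩
  refine not_isBead_iff.2 ⟨c, rfl⟩ ((h.2 _).2 ?_)
  rw [h3]
  omega

theorem Rep.isBead_top {p : Tops k} (h : Rep γ p) (j : ZMod (k + 1)) : IsBead γ (p j) := by
  rw [h.2, h.1]

theorem Rep.unique {p q : Tops k} (hp : Rep γ p) (hq : Rep γ q) : p = q := by
  funext j
  have h1 := (hq.2 _).1 (hp.isBead_top j)
  have h2 := (hp.2 _).1 (hq.isBead_top j)
  rw [hp.1] at h1
  rw [hq.1] at h2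
  omega

theorem Rep.unique_left {p : Tops k} (hγ : Rep γ p) (hδ : Rep δ p) : γ = δ :=
  eq_of_isBead fun b => by rw [hγ.2, hδ.2]

theorem Rep.transpose {p : Tops k} (h : Rep γ p) : Rep γ.transpose (tau p) := by
  have hk0 : ((k : ZMod (k + 1)) + 1) = 0 := by exact_mod_cast ZMod.natCast_self (k + 1)
  have key : ∀ j, ((tau p j : ℤ) : ZMod (k + 1)) = j := by
    intro j
    simp only [tau]
    push_cast
    rw [h.1]
    linear_combination -hk0
  refine ⟨key, fun b => ?_⟩
  rw [isBead_transpose, h.2]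
  have h1 := h.1 (-1 - b)
  simp only [tau]
  push_cast
  set s := p (-1 - (b : ZMod (k + 1)))
  have h2 : (s : ZMod (k + 1)) = ((-1 - b : ℤ) : ZMod (k + 1)) := by rw [h1]; push_cast; ring
  have h3 := fun h => add_le_of_cast_eq (a := s) (b := -1 - b) h2 h
  omega

/-- The number of `k`-bounded hooks in a row, read off the abacus. -/
theorem Rep.pRow {p : Tops k} (h : Rep γ p) (r : ℕ) :
    pRow k γ r = (Finset.univ.filter fun j => p j + (k + 1) < bead γ r).card := by
  rw [pRow_eq_card]
  have hhook : ∀ c ∈ (Finset.range (γ.rowLen r)).filter (fun c => hookLen γ r c ≤ k),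
      gap γ c < bead γ r ∧ bead γ r - gap γ c ≤ k := by
    intro c hc
    simp only [Finset.mem_filter, Finset.mem_range] at hc
    have := hookLen_eq hc.1
    exact ⟨gap_lt_bead.2 hc.1, by omega⟩
  refine Finset.card_bij (fun c _ => ((gap γ c : ℤ) : ZMod (k + 1))) ?_ ?_ ?_
  · intro c hc
    have h1 := hhook c hc
    have h2 := (not_isBead_iff (γ := γ)).2 ⟨c, rfl⟩
    have h3 := h.1 (gap γ c)
    rw [h.2] at h2
    have h4 := add_le_of_cast_eq h3 (by omega)
    simp only [Finset.mem_filter, Finset.mem_univ, true_and]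
    omega
  · intro c hc d hd hcd
    have h1 := hhook c hc
    have h2 := hhook d hd
    have h3 := add_le_of_cast_eq hcd
    have h4 := add_le_of_cast_eq hcd.symm
    have h5 := γ.colLen_anti c d
    have h6 := γ.colLen_anti d c
    unfold gap at *
    omega
  · intro j hj
    simp only [Finset.mem_filter, Finset.mem_univ, true_and] at hj
    have hbd := Int.emod_nonneg (bead γ r - 1 - p j) (b := (k + 1 : ℤ)) (by omega)
    have hbd' := Int.emod_lt_of_pos (bead γ r - 1 - p j) (b := (k + 1 : ℤ)) (by omega)
    set v := bead γ r - 1 - (bead γ r - 1 - p j) % (k + 1) with hv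
    have hvj : (v : ZMod (k + 1)) = j := by
      rw [← h.1 j, ZMod.intCast_eq_intCast_iff_dvd_sub]
      have h1 := Int.dvd_sub_self_of_emod_eq (a := bead γ r - 1 - p j) (b := (k + 1 : ℤ)) rfl
      have h2 : p j - v = (bead γ r - 1 - p j) % (k + 1) - (bead γ r - 1 - p j) := by
        rw [hv]
        ring
      rw [h2]
      exact_mod_cast h1
    have h1 : ¬ IsBead γ v := by
      rw [h.2, hvj]
      omega
    obtain ⟨c, hc⟩ := not_isBead_iff.1 h1
    have hc' : c < γ.rowLen r := gap_lt_bead.1 (by omega)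
    have h2 := hookLen_eq hc'
    have h3 : v ≠ bead γ r - (k + 1) := by
      intro h3
      have h4 : ((bead γ r : ℤ) : ZMod (k + 1)) = j := by
        rw [← hvj, h3, ZMod.intCast_eq_intCast_iff_dvd_sub]
        exact ⟨-1, by push_cast; ring⟩
      have h5 := (h.2 _).1 ⟨r, rfl⟩
      rw [h4] at h5
      omega
    refine ⟨c, ?_, by rw [hc, hvj]⟩
    simp only [Finset.mem_filter, Finset.mem_range]
    omega

end Beads

section CoreStep

variable {k : ℕ} {γ δ : YoungDiagram}

/-- The core `δ` arises from `γ` by adding cells, all of which are removable corners of `δ` of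
residue `i`, and `δ` has a removable corner of residue `i`. -/
structure CoreStep (i : ZMod (k + 1)) (γ δ : YoungDiagram) : Prop where
  le : γ ≤ δ
  exists_removable : ∃ c, Removable δ c ∧ residue k c = i
  removable_of_mem : ∀ c ∈ δ, c ∉ γ → Removable δ c ∧ residue k c = i

theorem residue_eq_cast {r c : ℕ} : residue k (r, c) = ((c - r : ℤ) : ZMod (k + 1)) := by
  simp [residue]

theorem cast_ne_of_succ [Nontrivial (ZMod (k + 1))] {a b : ℤ} {i : ZMod (k + 1)} (h : b = a + 1)
    (ha : (a : ZMod (k + 1)) = i) : (b : ZMod (k + 1)) ≠ i := by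
  rw [h, ← ha]
  push_cast
  simp

theorem coreStep_iff [Nontrivial (ZMod (k + 1))] {i : ZMod (k + 1)} : CoreStep i γ δ ↔
    (∃ b : ℤ, (b : ZMod (k + 1)) = i ∧ IsBead δ b ∧ ¬ IsBead δ (b - 1)) ∧
      ∀ r, bead δ r = bead γ r ∨
        (bead δ r = bead γ r + 1 ∧ ((bead δ r : ℤ) : ZMod (k + 1)) = i) := by
  have hrem : (∃ c, Removable δ c ∧ residue k c = i) ↔
      ∃ b : ℤ, (b : ZMod (k + 1)) = i ∧ IsBead δ b ∧ ¬ IsBead δ (b - 1) := by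
    simp only [← exists_removable_iff]
    constructor
    · rintro ⟨⟨r, c⟩, h1, h2⟩
      exact ⟨c - r, by rw [← h2, residue_eq_cast], r, c, h1, rfl⟩
    · rintro ⟨b, h1, r, c, h2, rfl⟩
      exact ⟨(r, c), h2, by rw [← h1, residue_eq_cast]⟩
  constructor
  · intro h
    refine ⟨hrem.1 h.exists_removable, fun r => ?_⟩
    have hle : γ.rowLen r ≤ δ.rowLen r := by
      by_contra hlt
      have := h.le (YoungDiagram.mem_iff_lt_rowLen.2 (not_le.1 hlt))
      rw [YoungDiagram.mem_iff_lt_rowLen] at this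
      omega
    rcases hle.eq_or_lt with heq | hlt
    · left
      simp [bead, heq]
    · right
      obtain ⟨h1, h2⟩ := h.removable_of_mem (r, γ.rowLen r) (YoungDiagram.mem_iff_lt_rowLen.2 hlt)
        (by rw [YoungDiagram.mem_iff_lt_rowLen]; omega)
      rw [removable_iff] at h1
      rw [residue_eq_cast] at h2
      refine ⟨?_, by rw [h1.1, h2]⟩
      unfold bead at *
      omega
  · rintro ⟨h1, h2⟩
    refine ⟨?_, hrem.2 h1, ?_⟩
    · rintro ⟨r, c⟩ hc
      rw [YoungDiagram.mem_iff_lt_rowLen] at hc ⊢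
      have := h2 r
      unfold bead at this
      omega
    · rintro ⟨r, c⟩ hc hc'
      rw [YoungDiagram.mem_iff_lt_rowLen] at hc hc'
      have hr := (h2 r).resolve_left fun h => by unfold bead at h; omega
      have hrc : δ.rowLen r = c + 1 := by
        have := hr.1
        unfold bead at this
        omega
      refine ⟨⟨YoungDiagram.mem_iff_lt_rowLen.2 hc, ?_, ?_⟩, ?_⟩
      · rw [YoungDiagram.mem_iff_lt_rowLen]
        intro h3
        simp only at h3
        have h4 := γ.rowLen_anti r (r + 1) (by omega)
        have h5 := δ.rowLen_anti r (r + 1) (by omega)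
        have h6 := (h2 (r + 1)).resolve_left fun h => by unfold bead at h; omega
        exact cast_ne_of_succ (by unfold bead; push_cast; omega) h6.2 hr.2
      · rw [YoungDiagram.mem_iff_lt_rowLen]
        simp only
        omega
      · rw [residue_eq_cast, ← hr.2]
        congr 1
        unfold bead
        omega

theorem Rep.isBead_iff {p : Tops k} (h : Rep γ p) {b : ℤ} {j : ZMod (k + 1)}
    (hb : (b : ZMod (k + 1)) = j) : IsBead γ b ↔ b ≤ p j := by
  rw [h.2, hb]

theorem step_of_coreStep [Nontrivial (ZMod (k + 1))] {i : ZMod (k + 1)} {p q : Tops k}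
    (hp : Rep γ p) (hq : Rep δ q) (h : CoreStep i γ δ) : step i p = some q := by
  obtain ⟨⟨b₀, hb₀, hb₁, hb₂⟩, hr⟩ := coreStep_iff.1 h
  have hqi : q (i - 1) + 1 < q i := by
    rw [hq.isBead_iff hb₀] at hb₁
    rw [hq.isBead_iff (j := i - 1) (by rw [← hb₀]; push_cast; ring)] at hb₂
    omega
  have hpc := hp.1
  have hqc := hq.1
  have hp1 : ((p (i - 1) + 1 : ℤ) : ZMod (k + 1)) = i := by push_cast; rw [hpc]; ring
  have hq1 : ((q (i - 1) + 1 : ℤ) : ZMod (k + 1)) = i := by push_cast; rw [hqc]; ring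
  have hpi : ((p i - 1 : ℤ) : ZMod (k + 1)) = i - 1 := by push_cast; rw [hpc]
  have hqi' : ((q i - 1 : ℤ) : ZMod (k + 1)) = i - 1 := by push_cast; rw [hqc]
  by_cases hall : ∀ r, bead δ r = bead γ r
  · have hpq : p = q := by
      refine hp.unique ⟨hq.1, fun b => ?_⟩
      rw [← hq.2]
      simp only [IsBead, hall]
    subst hpq
    rw [step, if_neg (by omega), if_pos hqi]
  -- a raised row starts just below an empty position
  have hadd : ∀ r, bead δ r = bead γ r + 1 → ((bead δ r : ℤ) : ZMod (k + 1)) = i →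
      ¬ IsBead γ (bead δ r) := by
    rintro r h1 h2 ⟨s, hs⟩
    rcases hr s with h3 | ⟨h3, h4⟩
    · have := bead_strictAnti.injective (h3.trans hs)
      subst this
      omega
    · exact cast_ne_of_succ (by rw [h3, hs]) h2 h4
  have hlow : ∀ r, bead δ r = bead γ r + 1 → ((bead δ r : ℤ) : ZMod (k + 1)) = i →
      p i < bead δ r ∧ bead δ r ≤ p (i - 1) + 1 := by
    intro r h1 h2
    have h3 := hadd r h1 h2
    rw [hp.isBead_iff h2] at h3
    have h4 := (hp.isBead_iff (j := i - 1) (b := bead γ r)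
      (by rw [← h2, h1]; push_cast; ring)).1 ⟨r, rfl⟩
    omega
  obtain ⟨r₀, hr₀⟩ := not_forall.1 hall
  have hr₀ := (hr r₀).resolve_left hr₀
  have hr₁ := hlow r₀ hr₀.1 hr₀.2
  rw [step, if_pos (by omega)]
  congr 1
  have hother : ∀ j, j ≠ i → j ≠ i - 1 → p j = q j := by
    intro j hj hj'
    have h1 : p j ≤ q j := by
      obtain ⟨r, hb⟩ := hp.isBead_top j
      rw [← hq.isBead_iff (hpc j)]
      refine ⟨r, ?_⟩
      rcases hr r with h1 | ⟨h1, h2⟩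
      · omega
      · rw [h1, hb] at h2
        push_cast at h2
        rw [hpc] at h2
        exact absurd (by rw [← h2]; ring) hj'
    have h2 : q j ≤ p j := by
      obtain ⟨r, hb⟩ := hq.isBead_top j
      rw [← hp.isBead_iff (hqc j)]
      refine ⟨r, ?_⟩
      rcases hr r with h1 | ⟨h1, h2⟩
      · omega
      · rw [hb, hqc] at h2
        exact absurd h2 hj
    omega
  have htop : q i = p (i - 1) + 1 := by
    have hle : q i ≤ p (i - 1) + 1 := by
      obtain ⟨r, hb⟩ := hq.isBead_top i
      rcases hr r with h1 | ⟨h1, h2⟩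
      · have := (hp.isBead_iff (hqc i)).1 ⟨r, by omega⟩
        omega
      · have := hlow r h1 h2
        omega
    obtain ⟨r, hb⟩ := hp.isBead_top (i - 1)
    rcases hr r with h1 | ⟨h1, h2⟩
    · have := (hq.isBead_iff (hpc (i - 1))).1 ⟨r, by omega⟩
      omega
    · have := (hq.isBead_iff h2).1 ⟨r, rfl⟩
      omega
  have hbot : q (i - 1) = p i - 1 := by
    have h1 : p i - 1 ≤ q (i - 1) := by
      obtain ⟨r, hb⟩ := (hp.isBead_iff hpi).2 (by omega)
      rw [← hq.isBead_iff hpi]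
      refine ⟨r, ?_⟩
      rcases hr r with h1 | ⟨h1, h2⟩
      · omega
      · have := hlow r h1 h2
        omega
    by_contra hne
    obtain ⟨r, hb⟩ := hq.isBead_top (i - 1)
    have hbγ : bead γ r = q (i - 1) := by
      rcases hr r with h2 | ⟨h2, h3⟩
      · omega
      · rw [hb, hqc] at h3
        exact absurd h3 (sub_one_ne i)
    obtain ⟨s, hs⟩ := (hq.isBead_iff hq1).2 hqi.le
    rcases hr s with h2 | ⟨h2, h3⟩
    · have := (hp.isBead_iff hq1).1 ⟨s, by omega⟩
      omega
    · have := bead_strictAnti.injective (show bead γ s = bead γ r by omega)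
      subst this
      omega
  funext j
  simp only [raise]
  split_ifs with h1 h2
  · rw [h1, htop]
  · rw [h2, hbot]
  · exact hother j h1 h2

/-- The diagram obtained by adding all addable corners of residue `i`. -/
theorem exists_raise [Nontrivial (ZMod (k + 1))] (γ : YoungDiagram) (i : ZMod (k + 1)) :
    ∃ δ : YoungDiagram, ∀ r, bead δ r = bead γ r +
      if ((bead γ r + 1 : ℤ) : ZMod (k + 1)) = i ∧ ¬ IsBead γ (bead γ r + 1) then 1 else 0 := by
  have hanti : Antitone fun r => γ.rowLen r +
      if ((bead γ r + 1 : ℤ) : ZMod (k + 1)) = i ∧ ¬ IsBead γ (bead γ r + 1) then 1 else 0 := by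
    refine antitone_nat_of_succ_le fun r => ?_
    have h := γ.rowLen_anti r (r + 1) (by omega)
    rcases h.lt_or_eq with h1 | h1
    · split_ifs <;> omega
    · rw [if_neg]
      · omega
      · rintro ⟨-, h2⟩
        exact h2 ⟨r, by unfold bead; omega⟩
  obtain ⟨N, hN⟩ : ∃ N, ∀ r, N ≤ r → γ.rowLen r +
      (if ((bead γ r + 1 : ℤ) : ZMod (k + 1)) = i ∧ ¬ IsBead γ (bead γ r + 1) then 1 else 0) = 0 := by
    refine ⟨γ.colLen 0 + 1, fun r hr => ?_⟩
    have h1 := rowLen_eq_zero (γ := γ) (r := r) (by omega)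
    have h2 := rowLen_eq_zero (γ := γ) (r := r - 1) (by omega)
    rw [if_neg, h1]
    rintro ⟨-, h⟩
    exact h ⟨r - 1, by unfold bead; omega⟩
  refine ⟨ofRows _ hanti N hN, fun r => ?_⟩
  simp only [bead, rowLen_ofRows]
  split_ifs <;> push_cast <;> ring

theorem exists_coreStep [Nontrivial (ZMod (k + 1))] {i : ZMod (k + 1)} {p q : Tops k}
    (hp : Rep γ p) (h : step i p = some q) : ∃ δ, Rep δ q ∧ CoreStep i γ δ := by
  have hpc := hp.1
  have hp1 : ((p (i - 1) + 1 : ℤ) : ZMod (k + 1)) = i := by push_cast; rw [hpc]; ring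
  have hpi : ((p i - 1 : ℤ) : ZMod (k + 1)) = i - 1 := by push_cast; rw [hpc]
  unfold step at h
  split_ifs at h with h1 h2
  · obtain rfl := Option.some_injective _ h
    obtain ⟨δ, hδ⟩ := exists_raise γ i
    have hrep : Rep δ (raise i p) := by
      refine ⟨fun j => ?_, fun b => ?_⟩
      · simp only [raise]
        split_ifs with h3 h4
        · rw [hp1, h3]
        · rw [hpi, h4]
        · exact hpc j
      have hbead : IsBead δ b ↔
          (IsBead γ b ∧ ¬ (((b + 1 : ℤ) : ZMod (k + 1)) = i ∧ ¬ IsBead γ (b + 1))) ∨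
            (IsBead γ (b - 1) ∧ (b : ZMod (k + 1)) = i ∧ ¬ IsBead γ b) := by
        constructor
        · rintro ⟨r, rfl⟩
          rw [hδ]
          split_ifs with h3
          · right
            exact ⟨⟨r, by ring⟩, h3⟩
          · left
            rw [add_zero]
            exact ⟨⟨r, rfl⟩, h3⟩
        · rintro (⟨⟨r, rfl⟩, h3⟩ | ⟨⟨r, hr⟩, h3⟩)
          · exact ⟨r, by rw [hδ, if_neg h3, add_zero]⟩
          · refine ⟨r, ?_⟩
            rw [hδ, hr, sub_add_cancel, if_pos h3]
            ring
      rw [hbead, hp.isBead_iff rfl]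
      simp only [raise]
      split_ifs with h3 h4
      · have h4 : ((b + 1 : ℤ) : ZMod (k + 1)) ≠ i := cast_ne_of_succ rfl h3
        have h5 : ((b - 1 : ℤ) : ZMod (k + 1)) = i - 1 := by push_cast; rw [h3]
        rw [hp.isBead_iff h5]
        simp only [h3, h4]
        simp
        omega
      · have h5 : ((b + 1 : ℤ) : ZMod (k + 1)) = i := by push_cast; rw [h4]; ring
        rw [hp.isBead_iff h5]
        simp only [h4, h5]
        simp
        omega
      · have h5 : ((b + 1 : ℤ) : ZMod (k + 1)) ≠ i := by
          intro h5
          apply h4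
          rw [← h5]
          push_cast
          ring
        simp only [h3, h5]
        simp
    refine ⟨δ, hrep, coreStep_iff.2 ⟨⟨p (i - 1) + 1, hp1, ?_, ?_⟩, fun r => ?_⟩⟩
    · rw [hrep.isBead_iff hp1]
      simp [raise]
    · rw [hrep.isBead_iff (j := i - 1) (by push_cast; rw [hpc]; ring)]
      simp only [raise, if_neg (sub_one_ne i), if_true]
      omega
    · rw [hδ]
      split_ifs with h3
      · exact Or.inr ⟨rfl, h3.1⟩
      · left
        ring
  · obtain rfl := Option.some_injective _ h
    refine ⟨γ, hp, coreStep_iff.2 ⟨⟨p i, hpc i, ?_, ?_⟩, fun r => Or.inl rfl⟩⟩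
    · rw [hp.isBead_iff (hpc i)]
    · rw [hp.isBead_iff hpi]
      omega

end CoreStep

section CoreSize

variable {k : ℕ} {γ δ : YoungDiagram}

theorem pRow_le_of_raise [Nontrivial (ZMod (k + 1))] {i : ZMod (k + 1)} {p : Tops k}
    (hp : Rep γ p) (hq : Rep δ (raise i p)) (h : CoreStep i γ δ) (r : ℕ) :
    pRow k δ r ≤ pRow k γ r + if bead γ r + 1 = p i + (k + 1) then 1 else 0 := by
  have hpc := hp.1
  have hqi : raise i p i = p (i - 1) + 1 := by simp [raise]
  have hqi' : raise i p (i - 1) = p i - 1 := by simp [raise]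
  have hqj : ∀ j, j ≠ i → j ≠ i - 1 → raise i p j = p j := fun j h1 h2 => by simp [raise, h1, h2]
  have hn : ∀ j, ((p j + (k + 1) : ℤ) : ZMod (k + 1)) = j := fun j => by
    have : ((k : ZMod (k + 1)) + 1) = 0 := by exact_mod_cast ZMod.natCast_self (k + 1)
    push_cast
    rw [this, hpc, add_zero]
  have hb := (hp.2 _).1 ⟨r, rfl⟩
  rw [hq.pRow, hp.pRow]
  set T := Finset.univ.filter fun j => p j + (k + 1) < bead γ r with hT
  have hsub : (Finset.univ.filter fun j => raise i p j + (k + 1) < bead δ r) ⊆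
      T.image (Equiv.swap i (i - 1)) ∪ if bead γ r + 1 = p i + (k + 1) then {i - 1} else ∅ := by
    intro j hj
    simp only [Finset.mem_filter, Finset.mem_univ, true_and] at hj
    have hmem : ∀ l, Equiv.swap i (i - 1) l = j → p l + (k + 1) < bead γ r →
        j ∈ T.image (Equiv.swap i (i - 1)) :=
      fun l h hl => Finset.mem_image.2 ⟨l, by simpa [hT] using hl, h⟩
    rcases (coreStep_iff.1 h).2 r with h1 | ⟨h1, h2⟩
    · refine Finset.mem_union_left _ ?_
      rw [h1] at hj
      by_cases hji : j = i
      · exact hmem (i - 1) (by rw [hji, Equiv.swap_apply_right]) (by rw [hji, hqi] at hj; omega)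
      · by_cases hji' : j = i - 1
        · refine hmem i (by rw [hji', Equiv.swap_apply_left]) ?_
          rw [hji', hqi'] at hj
          have h3 : p i + (k + 1) ≠ bead γ r := by
            intro h3
            rw [← h3, hn] at hb
            omega
          omega
        · exact hmem j (Equiv.swap_apply_of_ne_of_ne hji hji') (by rwa [hqj j hji hji'] at hj)
    · have hbr : ((bead γ r : ℤ) : ZMod (k + 1)) = i - 1 := by
        rw [← h2, h1]
        push_cast
        ring
      rw [hbr] at hb
      rw [h1] at hj
      have hne : ∀ l, l ≠ i - 1 → p l + (k + 1) ≠ bead γ r := by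
        intro l hl h3
        exact hl (by rw [← hn l, h3, hbr])
      by_cases hji : j = i
      · rw [hji, hqi] at hj
        omega
      · by_cases hji' : j = i - 1
        · by_cases hs : bead γ r + 1 = p i + (k + 1)
          · rw [if_pos hs, hji']
            exact Finset.mem_union_right _ (Finset.mem_singleton_self _)
          · refine Finset.mem_union_left _ (hmem i (by rw [hji', Equiv.swap_apply_left]) ?_)
            rw [hji', hqi'] at hj
            have := hne i (sub_one_ne i).symm
            omega
        · refine Finset.mem_union_left _ (hmem j (Equiv.swap_apply_of_ne_of_ne hji hji') ?_)
          rw [hqj j hji hji'] at hj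
          have := hne j hji'
          omega
  refine (Finset.card_le_card hsub).trans ((Finset.card_union_le _ _).trans
    (add_le_add Finset.card_image_le ?_))
  split_ifs <;> simp

theorem pSize_le_of_step [Nontrivial (ZMod (k + 1))] {i : ZMod (k + 1)} {p q : Tops k}
    (hp : Rep γ p) (hq : Rep δ q) (h : step i p = some q) : pSize k δ ≤ pSize k γ + 1 := by
  obtain ⟨δ', hδ', hcs⟩ := exists_coreStep hp h
  obtain rfl := hδ'.unique_left hq
  unfold step at h
  split_ifs at h with h1 h2
  · obtain rfl := Option.some_injective _ h
    rw [pSize_eq_sum (le_max_left _ (γ.colLen 0)), pSize_eq_sum (le_max_right (δ'.colLen 0) _)]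
    refine (Finset.sum_le_sum fun r _ => pRow_le_of_raise hp hδ' hcs r).trans ?_
    rw [Finset.sum_add_distrib, Finset.sum_boole]
    refine add_le_add le_rfl ?_
    rw [Nat.cast_id, Finset.card_le_one]
    intro a ha b hb
    simp only [Finset.mem_filter] at ha hb
    exact bead_strictAnti.injective (a₁ := a) (a₂ := b) (f := bead γ) (by omega)
  · obtain rfl := Option.some_injective _ h
    rw [hp.unique_left hδ']
    omega

end CoreSize

section Words

variable {k : ℕ}

/-- Apply the generators of a word of residues successively. -/
noncomputable def run (p : Tops k) : List (ZMod (k + 1)) → Option (Tops k)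
  | [] => some p
  | i :: w => (step i p).bind fun q => run q w

theorem run_append (p : Tops k) (u w : List (ZMod (k + 1))) :
    run p (u ++ w) = (run p u).bind fun q => run q w := by
  induction u generalizing p with
  | nil => rfl
  | cons i u ih =>
    simp only [List.cons_append, run, Option.bind_assoc]
    exact congrArg _ (funext fun q => ih q)

theorem run_singleton (p : Tops k) (i : ZMod (k + 1)) : run p [i] = step i p := by
  simp [run]

/-- The letters at the places `y < z` of the word `w` may belong to the same block. -/
def Compat (p : Tops k) (w : List (ZMod (k + 1))) (y z : ℕ) : Prop :=
  ∀ i j s t, w[y]? = some i → w[z]? = some j → run p (w.take (y + 1)) = some s →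
    run p (w.take (z + 1)) = some t → j ≠ i ∧ j + 1 ≠ i ∧ s i < t j

theorem compat_append_left {p : Tops k} {u w : List (ZMod (k + 1))} {y z : ℕ} (hy : y < u.length)
    (hz : z < u.length) : Compat p (u ++ w) y z ↔ Compat p u y z := by
  simp only [Compat, List.getElem?_append_left hy, List.getElem?_append_left hz,
    List.take_append_of_le_length (show y + 1 ≤ u.length from hy),
    List.take_append_of_le_length (show z + 1 ≤ u.length from hz)]

theorem compat_append_right {p q : Tops k} {u w : List (ZMod (k + 1))} (hu : run p u = some q)
    (y z : ℕ) : Compat p (u ++ w) (u.length + y) (u.length + z) ↔ Compat q w y z := by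
  simp only [Compat, List.getElem?_append_right (Nat.le_add_right _ _), Nat.add_sub_cancel_left,
    add_assoc, List.take_length_add_append, run_append, hu, Option.bind_some]

/-- All letters of the word may belong to the same block. -/
def BlockOK (p : Tops k) (u : List (ZMod (k + 1))) : Prop :=
  ∀ y z, y < z → z < u.length → Compat p u y z

theorem toFinset_snoc (u : List (ZMod (k + 1))) (i : ZMod (k + 1)) :
    (u ++ [i]).toFinset = insert i u.toFinset := by
  ext j
  simp

variable [Nontrivial (ZMod (k + 1))]

theorem carrier_of_run {p q : Tops k} {u : List (ZMod (k + 1))} (hu : run p u = some q)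
    (h : BlockOK p u) : ∃ C, IsCarrier u.toFinset p C ∧ u.Pairwise (fun i j => C i < C j) ∧
      carryOut u.toFinset p C = q ∧
      ∀ y i s, u[y]? = some i → run p (u.take (y + 1)) = some s → s i = C i := by
  induction u using List.reverseRecOn generalizing q with
  | nil =>
    refine ⟨p, ⟨by simp, by simp, by simp⟩, by simp, ?_, by simp⟩
    obtain rfl : p = q := by simpa [run] using hu
    funext j
    simp [carryOut]
  | append_singleton u i ih =>
    rw [run_append, Option.bind_eq_some_iff] at hu
    obtain ⟨s, hs, hq⟩ := hu
    rw [run_singleton] at hq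
    obtain ⟨C, hC, hsort, rfl, htop⟩ := ih hs fun y z hyz hz =>
      (compat_append_left (hyz.trans hz) hz).1 (h y z hyz (by simp; omega))
    have hlast : ∀ (y : ℕ) (j : ZMod (k + 1)), u[y]? = some j → i ≠ j ∧ i + 1 ≠ j ∧ C j < q i := by
      intro y j hj
      have hy : y < u.length := (List.getElem?_eq_some_iff.1 hj).1
      have hy' : ∃ t, run p (u.take (y + 1)) = some t := by
        have h1 := hs
        rw [← List.take_append_drop (y + 1) u, run_append, Option.bind_eq_some_iff] at h1
        exact ⟨_, h1.choose_spec.1⟩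
      obtain ⟨t, ht⟩ := hy'
      have h1 := h y u.length hy (by simp) j i t q (by rw [List.getElem?_append_left hy, hj])
        (by simp) (by rwa [List.take_append_of_le_length (by omega)])
        (by rw [List.take_of_length_le (by simp), run_append, hs]
            simpa [run_singleton] using hq)
      rwa [htop y j t hj ht] at h1
    have hi : i ∉ u.toFinset := by
      rw [List.mem_toFinset]
      intro hmem
      obtain ⟨y, hy⟩ := List.mem_iff_getElem?.1 hmem
      exact (hlast y i hy).1 rfl
    have hi1 : i + 1 ∉ u.toFinset := by
      rw [List.mem_toFinset]
      intro hmem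
      obtain ⟨y, hy⟩ := List.mem_iff_getElem?.1 hmem
      exact (hlast y _ hy).2.1 rfl
    have hne : C (i - 1) + 1 ≠ p i := by
      intro e
      have q1 : carryOut u.toFinset p C i = p i := by simp only [carryOut, if_neg hi1, hC.2.1 i hi]
      have q2 : carryOut u.toFinset p C (i - 1) = C (i - 1) := by
        simp only [carryOut, sub_add_cancel, if_neg hi]
      rw [step_eq_some, q1, q2] at hq
      omega
    have hq' := (hC.step_carryOut hi hi1 hne).symm.trans hq
    rw [Option.some.injEq] at hq'
    have hCi := hC.insert hi1 hne
    rw [← toFinset_snoc] at hCi hq'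
    set C' := Function.update C i (max (C (i - 1) + 1) (p i)) with hC'
    have hne' : ∀ j ∈ u, C' j = C j := fun j hj =>
      Function.update_of_ne (by rintro rfl; exact hi (List.mem_toFinset.2 hj)) _ _
    have hqi : q i = C' i := by
      rw [← hq', carryOut, if_neg]
      rw [toFinset_snoc, Finset.mem_insert, not_or]
      exact ⟨by simp, hi1⟩
    refine ⟨C', hCi, ?_, hq', ?_⟩
    · rw [List.pairwise_append]
      refine ⟨hsort.imp_of_mem fun {a b} ha hb hab => ?_, List.pairwise_singleton _ _, ?_⟩
      · rwa [hne' a ha, hne' b hb]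
      · intro j hj l hl
        obtain rfl := List.mem_singleton.1 hl
        obtain ⟨y, hy⟩ := List.mem_iff_getElem?.1 hj
        rw [hne' j hj, ← hqi]
        exact (hlast y j hy).2.2
    · intro y j t hj ht
      rcases lt_or_ge y u.length with hy | hy
      · rw [List.getElem?_append_left hy] at hj
        rw [List.take_append_of_le_length (by omega)] at ht
        rw [hne' j (List.mem_of_getElem? hj), htop y j t hj ht]
      · have hy1 := (List.getElem?_eq_some_iff.1 hj).1
        simp only [List.length_append, List.length_singleton] at hy1
        obtain rfl : y = u.length := by omega
        obtain rfl : i = j := by simpa using hj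
        rw [List.take_of_length_le (by simp), run_append, hs] at ht
        obtain rfl : t = q := by simpa [run_singleton, hq] using ht.symm
        exact hqi

theorem run_of_carrier {p C : Tops k} {u : List (ZMod (k + 1))} (hC : IsCarrier u.toFinset p C)
    (hsort : u.Pairwise fun i j => C i < C j) :
    run p u = some (carryOut u.toFinset p C) ∧ BlockOK p u ∧
      ∀ y i s, u[y]? = some i → run p (u.take (y + 1)) = some s → s i = C i := by
  induction u using List.reverseRecOn generalizing C with
  | nil =>
    refine ⟨?_, fun y z _ hz => by simp at hz, by simp⟩
    have : C = p := funext fun j => hC.2.1 j (by simp)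
    subst this
    simp only [run, Option.some.injEq]
    funext j
    simp [carryOut]
  | append_singleton u i ih =>
    rw [List.pairwise_append] at hsort
    obtain ⟨hsort, -, hlt⟩ := hsort
    have hlt : ∀ j ∈ u, C j < C i := fun j hj => hlt j hj i (List.mem_singleton_self i)
    have hi : i ∉ u.toFinset := fun hmem => (hlt i (List.mem_toFinset.1 hmem)).false
    have hi1 : i + 1 ∉ u.toFinset := by
      intro hmem
      have h1 := hC.1 (i + 1) (by rw [toFinset_snoc]; exact Finset.mem_insert_of_mem hmem)
      have h2 := hlt _ (List.mem_toFinset.1 hmem)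
      rw [add_sub_cancel_right] at h1
      omega
    rw [toFinset_snoc] at hC ⊢
    have hC₀ := hC.of_insert hi hi1
    set C₀ := Function.update C i (p i) with hC₀_def
    have hne' : ∀ j ∈ u, C₀ j = C j := fun j hj =>
      Function.update_of_ne (by rintro rfl; exact hi (List.mem_toFinset.2 hj)) _ _
    obtain ⟨hrun, hok, htop⟩ := ih hC₀
      (hsort.imp_of_mem fun {a b} ha hb hab => by rwa [hne' a ha, hne' b hb])
    have hne : C₀ (i - 1) + 1 ≠ p i := by
      rw [hC₀_def, Function.update_of_ne (sub_one_ne _)]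
      exact hC.2.2 i (Finset.mem_insert_self _ _)
    have hstep := hC₀.step_carryOut hi hi1 hne
    rw [(hC₀.insert hi1 hne).unique hC] at hstep
    have hrun' : run p (u ++ [i]) = some (carryOut (insert i u.toFinset) p C) := by
      rw [run_append, hrun]
      simpa [run_singleton] using hstep
    have htop' : ∀ y j s, (u ++ [i])[y]? = some j → run p ((u ++ [i]).take (y + 1)) = some s →
        s j = C j := by
      intro y j t hj ht
      rcases lt_or_ge y u.length with hy | hy
      · rw [List.getElem?_append_left hy] at hj
        rw [List.take_append_of_le_length (by omega)] at ht
        rw [← hne' j (List.mem_of_getElem? hj), htop y j t hj ht]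
      · have hy1 := (List.getElem?_eq_some_iff.1 hj).1
        simp only [List.length_append, List.length_singleton] at hy1
        obtain rfl : y = u.length := by omega
        obtain rfl : i = j := by simpa using hj
        rw [List.take_of_length_le (by simp), hrun', Option.some.injEq] at ht
        rw [← ht, carryOut, if_neg]
        rw [Finset.mem_insert, not_or]
        exact ⟨by simp, hi1⟩
    refine ⟨hrun', fun y z hyz hz => ?_, htop'⟩
    rcases lt_or_ge z u.length with hz' | hz'
    · exact (compat_append_left (hyz.trans hz') hz').2 (hok y z hyz hz')
    · intro a b s t ha hb hs ht
      rw [htop' y a s ha hs, htop' z b t hb ht]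
      simp only [List.length_append, List.length_singleton] at hz
      obtain rfl : z = u.length := by omega
      obtain rfl : i = b := by simpa using hb
      rw [List.getElem?_append_left hyz] at ha
      have hau := List.mem_of_getElem? ha
      refine ⟨?_, ?_, hlt a hau⟩
      · rintro rfl
        exact hi (List.mem_toFinset.2 hau)
      · rintro rfl
        exact hi1 (List.mem_toFinset.2 hau)

end Words

section Count

variable {k : ℕ}

theorem step_cast {i : ZMod (k + 1)} {p q : Tops k} (hp : ∀ j, (p j : ZMod (k + 1)) = j)
    (h : step i p = some q) (j : ZMod (k + 1)) : (q j : ZMod (k + 1)) = j := by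
  obtain ⟨-, rfl⟩ | ⟨-, rfl⟩ := step_eq_some.1 h
  · unfold raise
    split_ifs with h1 h2
    · simp [hp, h1]
    · simp [hp, h2]
    · exact hp j
  · exact hp j

theorem run_cast {w : List (ZMod (k + 1))} {p q : Tops k} (hp : ∀ j, (p j : ZMod (k + 1)) = j)
    (h : run p w = some q) (j : ZMod (k + 1)) : (q j : ZMod (k + 1)) = j := by
  induction w generalizing p with
  | nil =>
    obtain rfl : p = q := by simpa [run] using h
    exact hp j
  | cons i w ih =>
    obtain ⟨s, hs, hq⟩ := Option.bind_eq_some_iff.1 h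
    exact ih (step_cast hp hs) hq

theorem IsCarrier.cast {A : Finset (ZMod (k + 1))} {p C : Tops k} (hC : IsCarrier A p C)
    (hp : ∀ j, (p j : ZMod (k + 1)) = j) (j : ZMod (k + 1)) : (C j : ZMod (k + 1)) = j := by
  obtain ⟨i, hi⟩ : ∃ i, i ∉ A := by
    by_contra! h
    exact hC.ne_univ (Finset.eq_univ_iff_forall.2 h)
  obtain ⟨t, rfl⟩ := zmod_reach i j
  induction t with
  | zero => simp [hC.2.1 i hi, hp]
  | succ t ih =>
    by_cases hA : i + ((t + 1 : ℕ) : ZMod (k + 1)) ∈ A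
    · have e : i + ((t + 1 : ℕ) : ZMod (k + 1)) - 1 = i + t := by push_cast; ring
      rw [hC.1 _ hA, e]
      rcases max_choice (C (i + t) + 1) (p (i + ((t + 1 : ℕ) : ZMod (k + 1)))) with h | h
      · rw [h, Int.cast_add, ih]; push_cast; ring
      · rw [h, hp]
    · rw [hC.2.1 _ hA, hp]

theorem exists_sorted_word {A : Finset (ZMod (k + 1))} {C : Tops k}
    (hC : ∀ j, (C j : ZMod (k + 1)) = j) :
    ∃ u : List (ZMod (k + 1)), u.toFinset = A ∧ u.Pairwise fun i j => C i < C j := by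
  refine ⟨((A.image C).sort (· ≤ ·)).map fun b : ℤ => (b : ZMod (k + 1)), ?_, ?_⟩
  · ext j
    simp [hC]
  · rw [List.pairwise_map]
    refine (Finset.sortedLT_sort (A.image C)).pairwise.imp_of_mem ?_
    intro a b ha hb hab
    simp only [Finset.mem_sort, Finset.mem_image] at ha hb
    obtain ⟨i, -, rfl⟩ := ha
    obtain ⟨j, -, rfl⟩ := hb
    simpa [hC] using hab

theorem sorted_word_unique {u v : List (ZMod (k + 1))} {C : Tops k}
    (hu : u.Pairwise fun i j => C i < C j) (hv : v.Pairwise fun i j => C i < C j)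
    (h : u.toFinset = v.toFinset) : u = v := by
  have hnd : ∀ {l : List (ZMod (k + 1))}, (l.Pairwise fun i j => C i < C j) → l.Nodup :=
    fun hl => hl.imp fun hab => by rintro rfl; exact hab.false
  have hperm : u.Perm v := List.perm_of_nodup_nodup_toFinset_eq (hnd hu) (hnd hv) h
  exact hperm.eq_of_pairwise (fun a b _ _ h1 h2 => absurd (h1.trans h2) (lt_irrefl _)) hu hv

/-- Conditions for `w` to be the word of residues of an affine set-valued tableau of weight `α`. -/
def ValidWord (α : List ℕ) (p : Tops k) (w : List (ZMod (k + 1))) (q : Tops k) : Prop :=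
  run p w = some q ∧ w.length = α.sum ∧ ∀ x < α.length, ∀ y z, (α.take x).sum ≤ y → y < z →
    z < (α.take (x + 1)).sum → Compat p w y z

theorem validWord_nil {p q : Tops k} {w : List (ZMod (k + 1))} :
    ValidWord [] p w q ↔ w = [] ∧ p = q := by
  constructor
  · rintro ⟨h1, h2, -⟩
    obtain rfl : w = [] := by simpa using h2
    exact ⟨rfl, by simpa [run] using h1⟩
  · rintro ⟨rfl, rfl⟩
    exact ⟨rfl, rfl, by simp⟩

theorem validWord_cons_append {a : ℕ} {α : List ℕ} {p q : Tops k} {u w : List (ZMod (k + 1))}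
    (hu : u.length = a) : ValidWord (a :: α) p (u ++ w) q ↔
      ∃ s, run p u = some s ∧ BlockOK p u ∧ ValidWord α s w q := by
  subst hu
  constructor
  · rintro ⟨h1, h2, h3⟩
    rw [run_append, Option.bind_eq_some_iff] at h1
    obtain ⟨s, hs, hq⟩ := h1
    refine ⟨s, hs, fun y z hyz hz => ?_, hq, by simpa using h2, fun x hx y z hy hyz hz => ?_⟩
    · exact (compat_append_left (hyz.trans hz) hz).1
        (h3 0 (by simp) y z (by simp) hyz (by simpa using hz))
    · exact (compat_append_right hs y z).1
        (h3 (x + 1) (by simpa using hx) _ _ (by simpa using hy) (by omega) (by simpa using hz))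
  · rintro ⟨s, hs, hb, hq, hl, hc⟩
    refine ⟨by rw [run_append, hs]; exact hq, by simp [hl], fun x hx y z hy hyz hz => ?_⟩
    cases x with
    | zero =>
      simp only [zero_add, List.take_succ_cons, List.take_zero, List.sum_cons, List.sum_nil,
        add_zero] at hz
      exact (compat_append_left (hyz.trans hz) hz).2 (hb y z hyz hz)
    | succ x =>
      simp only [List.take_succ_cons, List.sum_cons] at hy hz
      obtain ⟨y, rfl⟩ := Nat.exists_eq_add_of_le (show u.length ≤ y by omega)
      obtain ⟨z, rfl⟩ := Nat.exists_eq_add_of_le (show u.length ≤ z by omega)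
      exact (compat_append_right hs y z).2
        (hc x (by simpa using hx) y z (by omega) (by omega) (by omega))

theorem finite_validWord (α : List ℕ) (P : List (ZMod (k + 1)) → Prop)
    (hP : ∀ w, P w → w.length = α.sum) : Finite {w // P w} :=
  ((List.finite_length_eq (ZMod (k + 1)) α.sum).subset hP).to_subtype

variable [Nontrivial (ZMod (k + 1))]

theorem exists_block {A : Finset (ZMod (k + 1))} {p q : Tops k}
    (hp : ∀ j, (p j : ZMod (k + 1)) = j) (h : dec A p = some q) :
    ∃ u : List (ZMod (k + 1)), u.toFinset = A ∧ run p u = some q ∧ BlockOK p u := by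
  obtain ⟨C, hC, rfl⟩ := dec_eq_some.1 h
  obtain ⟨u, rfl, hsort⟩ := exists_sorted_word (A := A) (hC.cast hp)
  obtain ⟨h1, h2, -⟩ := run_of_carrier hC hsort
  exact ⟨u, rfl, h1, h2⟩

theorem block_unique {p q q' : Tops k} {u v : List (ZMod (k + 1))}
    (hu : run p u = some q) (hu' : BlockOK p u) (hv : run p v = some q') (hv' : BlockOK p v)
    (h : u.toFinset = v.toFinset) : u = v := by
  obtain ⟨C, hC, hs, -⟩ := carrier_of_run hu hu'
  obtain ⟨D, hD, hs', -⟩ := carrier_of_run hv hv'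
  rw [h] at hC
  obtain rfl := hC.unique hD
  exact sorted_word_unique hs hs' h

theorem card_block {p q : Tops k} {u : List (ZMod (k + 1))} (hu : run p u = some q)
    (h : BlockOK p u) : u.toFinset.card = u.length := by
  obtain ⟨C, -, hs, -⟩ := carrier_of_run hu h
  exact List.toFinset_card_of_nodup (hs.imp fun hab => by rintro rfl; exact hab.false)

theorem dec_block {p q : Tops k} {u : List (ZMod (k + 1))} (hu : run p u = some q)
    (h : BlockOK p u) : dec u.toFinset p = some q := by
  obtain ⟨C, hC, -, hq, -⟩ := carrier_of_run hu h
  exact dec_eq_some.2 ⟨C, hC, hq⟩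

theorem card_validWord_cons (a : ℕ) (α : List ℕ) {p : Tops k}
    (hp : ∀ j, (p j : ZMod (k + 1)) = j) (q : Tops k) :
    Nat.card {w // ValidWord (a :: α) p w q} =
      ∑ A ∈ Finset.univ.filter fun A : Finset (ZMod (k + 1)) => A.card = a,
        Nat.card {w // ∃ s, dec A p = some s ∧ ValidWord α s w q} := by
  have hfin : ∀ A : Finset (ZMod (k + 1)),
      Finite {w // ∃ s, dec A p = some s ∧ ValidWord α s w q} := fun A =>
    finite_validWord α _ fun w ⟨s, _, hw⟩ => hw.2.1
  have hblk : ∀ A : Finset (ZMod (k + 1)), ∃ u : List (ZMod (k + 1)), ∀ s, dec A p = some s →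
      u.toFinset = A ∧ run p u = some s ∧ BlockOK p u := by
    intro A
    by_cases h : ∃ s, dec A p = some s
    · obtain ⟨s, hs⟩ := h
      obtain ⟨u, hu⟩ := exists_block hp hs
      refine ⟨u, fun t ht => ?_⟩
      rw [hs, Option.some.injEq] at ht
      exact ht ▸ hu
    · exact ⟨[], fun s hs => absurd ⟨s, hs⟩ h⟩
  choose U hU using hblk
  have hlen : ∀ A s, dec A p = some s → (U A).length = A.card := fun A s hs => by
    rw [← card_block (hU A s hs).2.1 (hU A s hs).2.2, (hU A s hs).1]
  rw [← Finset.sum_coe_sort, ← Nat.card_sigma]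
  symm
  let f : (Σ A : ↥(Finset.univ.filter fun A : Finset (ZMod (k + 1)) => A.card = a),
      {w // ∃ s, dec A.1 p = some s ∧ ValidWord α s w q}) → {w // ValidWord (a :: α) p w q} :=
    fun x => ⟨U x.1.1 ++ x.2.1, by
      obtain ⟨⟨A, hA⟩, w, s, hs, hw⟩ := x
      refine (validWord_cons_append ?_).2 ⟨s, (hU A s hs).2.1, (hU A s hs).2.2, hw⟩
      rw [hlen A s hs]
      exact (Finset.mem_filter.1 hA).2⟩
  refine Nat.card_congr (Equiv.ofBijective f ⟨?_, ?_⟩)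
  · rintro ⟨⟨A, hA⟩, w, s, hs, hw⟩ ⟨⟨B, hB⟩, v, t, ht, hv⟩ h
    have h' : U A ++ w = U B ++ v := congrArg Subtype.val h
    obtain ⟨h1, rfl⟩ := List.append_inj h' (by
      rw [hlen A s hs, hlen B t ht, (Finset.mem_filter.1 hA).2, (Finset.mem_filter.1 hB).2])
    obtain rfl : A = B := by rw [← (hU A s hs).1, ← (hU B t ht).1, h1]
    rfl
  · rintro ⟨w, hw⟩
    have hl : (w.take a).length = a := by
      have := hw.2.1
      rw [List.sum_cons] at this
      rw [List.length_take]
      omega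
    have hw' := hw
    rw [← List.take_append_drop a w, validWord_cons_append hl] at hw'
    obtain ⟨s, hs, hb, hv⟩ := hw'
    have hd := dec_block hs hb
    have hc := card_block hs hb
    refine ⟨⟨⟨(w.take a).toFinset, ?_⟩, w.drop a, s, hd, hv⟩, ?_⟩
    · simpa using hc.trans hl
    · apply Subtype.ext
      have := hU _ s hd
      change U (w.take a).toFinset ++ w.drop a = w
      rw [block_unique this.2.1 this.2.2 hs hb this.1]
      exact List.take_append_drop a w

theorem dec_cast {A : Finset (ZMod (k + 1))} {p q : Tops k} (hp : ∀ j, (p j : ZMod (k + 1)) = j)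
    (h : dec A p = some q) : ∀ j, (q j : ZMod (k + 1)) = j := by
  obtain ⟨u, -, hu, -⟩ := exists_block hp h
  exact run_cast hp hu

/-- Products of the operators `hOp` count valid words. -/
theorem card_validWord (α : List ℕ) {p : Tops k} (hp : ∀ j, (p j : ZMod (k + 1)) = j)
    (q : Tops k) : (Nat.card {w // ValidWord α p w q} : ℤ) =
      ((α.reverse.map (hOp k)).prod (Finsupp.single p 1)) q := by
  induction α generalizing p with
  | nil =>
    simp only [validWord_nil, List.reverse_nil, List.map_nil, List.prod_nil, Module.End.one_apply,
      Finsupp.single_apply]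
    split_ifs with h
    · simp [h]
    · simp [h]
  | cons a α ih =>
    rw [card_validWord_cons a α hp, List.reverse_cons, List.map_append, List.prod_append,
      Module.End.mul_apply]
    simp only [List.map_cons, List.map_nil, List.prod_cons, List.prod_nil, mul_one]
    rw [hOp, LinearMap.sum_apply, map_sum, Finsupp.finsetSum_apply, Nat.cast_sum]
    refine Finset.sum_congr rfl fun A _ => ?_
    rw [lin_single]
    rcases h : dec A p with _ | s
    · simp
    · simpa using ih (dec_cast hp h)

end Count

section Growth

variable {k : ℕ}

/-- A set-valued filling `e` recording the letter `y + 1` in the removable corners of residue `i y`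
of the `(y + 1)`-st core of a growing chain. -/
structure Growth (n : ℕ) (δ : ℕ → YoungDiagram) (s : ℕ → Tops k) (i : ℕ → ZMod (k + 1))
    (e : ℕ × ℕ → Finset ℕ) : Prop where
  zero : δ 0 = ⊥
  rep : ∀ y ≤ n, Rep (δ y) (s y)
  coreStep : ∀ y < n, CoreStep (i y) (δ y) (δ (y + 1))
  zero_notMem : ∀ c, 0 ∉ e c
  succ_mem : ∀ c y, y + 1 ∈ e c ↔ y < n ∧ Removable (δ (y + 1)) c ∧ residue k c = i y

namespace Growth

variable {n : ℕ} {δ : ℕ → YoungDiagram} {s : ℕ → Tops k} {i : ℕ → ZMod (k + 1)}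
  {e : ℕ × ℕ → Finset ℕ}

theorem mono (h : Growth n δ s i e) {x y : ℕ} (hxy : x ≤ y) (hy : y ≤ n) : δ x ≤ δ y := by
  induction y, hxy using Nat.le_induction with
  | base => exact le_rfl
  | succ y _ ih => exact (ih (by omega)).trans (h.coreStep y (by omega)).le

theorem mem_of_mem (h : Growth n δ s i e) {c : ℕ × ℕ} {x : ℕ} (hx : x ∈ e c) :
    1 ≤ x ∧ x ≤ n ∧ Removable (δ x) c ∧ residue k c = i (x - 1) := by
  cases x with
  | zero => exact absurd hx (h.zero_notMem c)
  | succ x =>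
    obtain ⟨h1, h2, h3⟩ := (h.succ_mem c x).1 hx
    exact ⟨by omega, h1, h2, h3⟩

theorem mem_iff (h : Growth n δ s i e) {c : ℕ × ℕ} {y : ℕ} (hy : y ≤ n) :
    c ∈ δ y ↔ ∃ x ∈ e c, x ≤ y := by
  constructor
  · induction y with
    | zero => rw [h.zero]; intro hc; exact absurd hc (YoungDiagram.notMem_bot c)
    | succ y ih =>
      intro hc
      by_cases hc' : c ∈ δ y
      · obtain ⟨x, hx, hxy⟩ := ih (by omega) hc'
        exact ⟨x, hx, by omega⟩
      · exact ⟨y + 1, (h.succ_mem c y).2 ⟨by omega,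
          (h.coreStep y (by omega)).removable_of_mem c hc hc'⟩, le_rfl⟩
  · rintro ⟨x, hx, hxy⟩
    exact h.mono hxy hy (h.mem_of_mem hx).2.2.1.1

theorem isStdASVT (h : Growth n δ s i e) : IsStdASVT k n (δ n) e := by
  refine ⟨⟨fun c => ?_, fun c x hx => (h.mem_of_mem hx).1, fun r c x hx y hy => ?_,
    fun r c x hx y hy => ?_⟩, fun c y hy => (h.mem_of_mem hy).2.1, fun x hx hxn => ?_⟩
  · rw [h.mem_iff le_rfl]
    exact ⟨fun ⟨x, hx, _⟩ => ⟨x, hx⟩, fun ⟨x, hx⟩ => ⟨x, hx, (h.mem_of_mem hx).2.1⟩⟩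
  · by_contra! hyx
    obtain ⟨-, hxn, hr, -⟩ := h.mem_of_mem hx
    exact hr.2.1 (h.mono hyx hxn (h.mem_of_mem hy).2.2.1.1)
  · by_contra! hyx
    obtain ⟨-, hxn, hr, -⟩ := h.mem_of_mem hx
    exact hr.2.2 (h.mono hyx.le hxn (h.mem_of_mem hy).2.2.1.1)
  · obtain ⟨y, rfl⟩ := Nat.exists_eq_add_of_le' hx
    refine ⟨δ (y + 1), (h.rep _ hxn).isCore, ?_, i y, ?_, fun c => ?_⟩
    · ext c
      simp only [shapeLe, YoungDiagram.mem_cells, Finset.mem_filter, h.mem_iff hxn]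
      rw [h.mem_iff le_rfl]
      exact ⟨fun ⟨x, hx, hxy⟩ => ⟨⟨x, hx, by omega⟩, x, hx, hxy⟩, fun hc => hc.2⟩
    · obtain ⟨c, hc⟩ := (h.coreStep y hxn).exists_removable
      exact ⟨c, (h.succ_mem c y).2 ⟨hxn, hc⟩⟩
    · rw [h.succ_mem]
      exact and_iff_right hxn

theorem exists_of_isStdASVT {γ : YoungDiagram} (h : IsStdASVT k n γ e) :
    ∃ δ s, ∃ i : ℕ → ZMod (k + 1), Growth n δ s i e ∧ δ n = γ := by
  obtain ⟨⟨hne, hpos, -, -⟩, hle, hx⟩ := h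
  have key : ∀ y, ∃ D : YoungDiagram, y < n → (IsCore (k + 1) D ∧ D.cells = shapeLe γ e (y + 1) ∧
      ∃ i : ZMod (k + 1), (∃ c, y + 1 ∈ e c) ∧
        ∀ c : ℕ × ℕ, y + 1 ∈ e c ↔ Removable D c ∧ residue k c = i) := by
    intro y
    by_cases hy : y < n
    · obtain ⟨D, hD⟩ := hx (y + 1) (by omega) hy
      exact ⟨D, fun _ => hD⟩
    · exact ⟨⊥, fun h => absurd h hy⟩
  choose D hD using key
  have hi : ∀ y, ∃ i : ZMod (k + 1), y < n → (∃ c, y + 1 ∈ e c) ∧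
      ∀ c : ℕ × ℕ, y + 1 ∈ e c ↔ Removable (D y) c ∧ residue k c = i := by
    intro y
    by_cases hy : y < n
    · obtain ⟨i, hi⟩ := (hD y hy).2.2
      exact ⟨i, fun _ => hi⟩
    · exact ⟨0, fun h => absurd h hy⟩
  choose i hi using hi
  let δ : ℕ → YoungDiagram := fun y => Nat.casesOn y ⊥ D
  have hδ : ∀ y ≤ n, (δ y).cells = shapeLe γ e y := by
    intro y hy
    cases y with
    | zero =>
      change (⊥ : YoungDiagram).cells = _
      rw [YoungDiagram.cells_bot, eq_comm, shapeLe, Finset.filter_eq_empty_iff]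
      rintro c - ⟨x, hxc, hx0⟩
      exact absurd (hpos c x hxc) (by omega)
    | succ y => exact (hD y hy).2.1
  have hmem : ∀ y ≤ n, ∀ c, c ∈ δ y ↔ ∃ x ∈ e c, x ≤ y := by
    intro y hy c
    rw [← YoungDiagram.mem_cells, hδ y hy, shapeLe, Finset.mem_filter, YoungDiagram.mem_cells, hne]
    exact ⟨fun hc => hc.2, fun ⟨x, hx, hxy⟩ => ⟨⟨x, hx⟩, x, hx, hxy⟩⟩
  have hcore : ∀ y ≤ n, IsCore (k + 1) (δ y) := by
    intro y hy
    cases y with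
    | zero => exact fun c hc => absurd hc (YoungDiagram.notMem_bot c)
    | succ y => exact (hD y hy).1
  have hs : ∀ y, ∃ s : Tops k, y ≤ n → Rep (δ y) s := by
    intro y
    by_cases hy : y ≤ n
    · obtain ⟨s, hs⟩ := (hcore y hy).exists_rep
      exact ⟨s, fun _ => hs⟩
    · exact ⟨0, fun h => absurd h hy⟩
  choose s hs using hs
  refine ⟨δ, s, i, ⟨rfl, hs, fun y hy => ⟨?_, ?_, ?_⟩, fun c h0 => ?_, fun c y => ?_⟩, ?_⟩
  · intro c hc
    obtain ⟨x, hx, hxy⟩ := (hmem y hy.le c).1 hc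
    exact (hmem (y + 1) hy c).2 ⟨x, hx, by omega⟩
  · obtain ⟨⟨c, hc⟩, h2⟩ := hi y hy
    exact ⟨c, (h2 c).1 hc⟩
  · intro c hc hc'
    rw [hmem (y + 1) hy] at hc
    rw [hmem y hy.le] at hc'
    obtain ⟨x, hx, hxy⟩ := hc
    rcases Nat.le_succ_iff.1 hxy with hxy | rfl
    · exact absurd ⟨x, hx, hxy⟩ hc'
    · exact ((hi y hy).2 c).1 hx
  · exact absurd (hpos c 0 h0) (lt_irrefl 0)
  · constructor
    · intro hy
      exact ⟨hle c _ hy, ((hi y (hle c _ hy)).2 c).1 hy⟩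
    · rintro ⟨hy, h2⟩
      exact ((hi y hy).2 c).2 h2
  · refine YoungDiagram.ext (Finset.ext fun c => ?_)
    rw [YoungDiagram.mem_cells, hmem n le_rfl, YoungDiagram.mem_cells, hne]
    exact ⟨fun ⟨x, hx, _⟩ => ⟨x, hx⟩, fun ⟨x, hx⟩ => ⟨x, hx, hle c x hx⟩⟩

theorem filling_eq {δ' : ℕ → YoungDiagram} {s' : ℕ → Tops k} {e' : ℕ × ℕ → Finset ℕ}
    (h : Growth n δ s i e) (h' : Growth n δ' s' i e') (hδ : ∀ y ≤ n, δ y = δ' y) : e = e' := by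
  funext c
  ext x
  cases x with
  | zero => simp [h.zero_notMem, h'.zero_notMem]
  | succ y =>
    rw [h.succ_mem, h'.succ_mem]
    refine and_congr_right fun hy => ?_
    rw [hδ _ hy]

theorem residue_eq {δ' : ℕ → YoungDiagram} {s' : ℕ → Tops k} {i' : ℕ → ZMod (k + 1)}
    (h : Growth n δ s i e) (h' : Growth n δ' s' i' e) {y : ℕ} (hy : y < n) : i y = i' y := by
  obtain ⟨c, hc⟩ := (h.coreStep y hy).exists_removable
  have := (h.succ_mem c y).2 ⟨hy, hc⟩
  rw [← hc.2, ((h'.succ_mem c y).1 this).2.2]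

theorem congr_residue {i' : ℕ → ZMod (k + 1)} (h : Growth n δ s i e)
    (hi : ∀ y < n, i y = i' y) : Growth n δ s i' e where
  zero := h.zero
  rep := h.rep
  coreStep y hy := hi y hy ▸ h.coreStep y hy
  zero_notMem := h.zero_notMem
  succ_mem c y := by
    rw [h.succ_mem]
    refine and_congr_right fun hy => ?_
    rw [hi y hy]

/-- A corner below a recorded one is added with the preceding residue. -/
theorem exists_above (h : Growth n δ s i e) {r c y z : ℕ} (hyz : y < z) (hz : z < n)
    (hy : y + 1 ∈ e (r, c)) (hc : (r + 1, c) ∈ δ (z + 1)) :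
    ∃ z', y < z' ∧ z' ≤ z ∧ z' + 1 ∈ e (r + 1, c) ∧ i z' + 1 = i y := by
  obtain ⟨-, hrem, hres⟩ := (h.succ_mem _ _).1 hy
  have hswitch : ∃ z', y < z' ∧ z' ≤ z ∧ (r + 1, c) ∉ δ z' ∧ (r + 1, c) ∈ δ (z' + 1) := by
    by_contra! hcon
    have : ∀ x, y + 1 ≤ x → x ≤ z + 1 → (r + 1, c) ∉ δ x := by
      intro x hx
      induction x, hx using Nat.le_induction with
      | base => exact fun _ => hrem.2.1
      | succ x hx ih => exact fun hxz => hcon x hx (by omega) (ih (by omega))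
    exact this (z + 1) (by omega) le_rfl hc
  obtain ⟨z', h1, h2, h3, h4⟩ := hswitch
  have h5 := (h.coreStep z' (by omega)).removable_of_mem _ h4 h3
  refine ⟨z', h1, h2, (h.succ_mem _ _).2 ⟨by omega, h5⟩, ?_⟩
  rw [← h5.2, ← hres]
  simp only [residue]
  push_cast
  ring

theorem exists_isLowestOcc (h : Growth n δ s i e) {y : ℕ} (hy : y < n) :
    ∃ c : ℕ × ℕ, IsLowestOcc e (y + 1) c := by
  obtain ⟨c, hc⟩ := (h.coreStep y hy).exists_removable
  have hne : ∃ r, ∃ c : ℕ, y + 1 ∈ e (r, c) := ⟨c.1, c.2, (h.succ_mem c y).2 ⟨hy, hc⟩⟩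
  obtain ⟨c, hc⟩ := Nat.find_spec hne
  exact ⟨(Nat.find hne, c), hc, fun d hd => Nat.find_min' hne ⟨d.2, hd⟩⟩

/-- The lowest occurrence of a letter sits on the topmost bead of its runner. -/
theorem content_of_isLowestOcc (h : Growth n δ s i e) {y r c : ℕ}
    (hl : IsLowestOcc e (y + 1) (r, c)) : (c : ℤ) - r = s (y + 1) (i y) := by
  obtain ⟨hy, hrem, hres⟩ := (h.succ_mem _ _).1 hl.1
  have hrep := h.rep (y + 1) hy
  set p := s (y + 1)
  rw [residue_eq_cast] at hres
  have h1 := exists_removable_iff.1 ⟨r, c, hrem, rfl⟩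
  have hc1 : (((c : ℤ) - r - 1 : ℤ) : ZMod (k + 1)) = i y - 1 := by
    rw [← hres]; push_cast; ring
  have hp1 : ((p (i y) - 1 : ℤ) : ZMod (k + 1)) = i y - 1 := by
    push_cast; rw [hrep.1]
  rw [hrep.isBead_iff hres, hrep.isBead_iff hc1] at h1
  obtain ⟨r', c', hrem', hcont⟩ := exists_removable_iff.2
    ⟨hrep.isBead_top (i y), fun hb => by rw [hrep.isBead_iff hp1] at hb; omega⟩
  have hmem : y + 1 ∈ e (r', c') := (h.succ_mem _ _).2 ⟨hy, hrem', by
    rw [residue_eq_cast, hcont, hrep.1]⟩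
  have hrr : r ≤ r' := hl.2 _ hmem
  have hb := (bead_strictAnti (γ := δ (y + 1))).antitone hrr
  rw [(removable_iff.1 hrem).1, (removable_iff.1 hrem').1] at hb
  omega

theorem bead_le (h : Growth n δ s i e) {x y r : ℕ} (hxy : x ≤ y) (hy : y ≤ n) :
    bead (δ x) r ≤ bead (δ y) r := by
  have : (δ x).rowLen r ≤ (δ y).rowLen r := by
    by_contra! hlt
    exact (YoungDiagram.mem_iff_lt_rowLen.not.2 (lt_irrefl _))
      (h.mono hxy hy (YoungDiagram.mem_iff_lt_rowLen.2 hlt))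
  unfold bead
  omega

/-- The conditions on a block of letters of an affine set-valued tableau, in terms of the
abacus. -/
theorem block_iff (h : Growth n δ s i e) {a b : ℕ} (hb : b ≤ n) :
    ((∀ y z : ℕ, y ∈ Finset.Ioc a b → z ∈ Finset.Ioc a b → y < z →
        ∀ cy cz : ℕ × ℕ, IsLowestOcc e y cy → IsLowestOcc e z cz → ReadBefore cy cz) ∧
      ((((δ n).cells.filter fun c => ∃ y ∈ Finset.Ioc a b, y ∈ e c).image (residue k)).card
        = b - a) ∧
      (∀ c d : ℕ × ℕ, (∃ y ∈ Finset.Ioc a b, y ∈ e c) → (∃ y ∈ Finset.Ioc a b, y ∈ e d) →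
        c.2 = d.2 → c = d)) ↔
    ∀ y z, a ≤ y → y < z → z < b →
      i z ≠ i y ∧ i z + 1 ≠ i y ∧ s (y + 1) (i y) < s (z + 1) (i z) := by
  have himage : (((δ n).cells.filter fun c => ∃ y ∈ Finset.Ioc a b, y ∈ e c).image (residue k)) =
      (Finset.Ico a b).image i := by
    ext j
    simp only [Finset.mem_image, Finset.mem_filter, YoungDiagram.mem_cells, Finset.mem_Ioc,
      Finset.mem_Ico]
    constructor
    · rintro ⟨c, ⟨-, y, hy, hc⟩, rfl⟩
      obtain ⟨-, -, -, h4⟩ := h.mem_of_mem hc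
      exact ⟨y - 1, by omega, h4.symm⟩
    · rintro ⟨y, hy, rfl⟩
      obtain ⟨c, hc⟩ := (h.coreStep y (by omega)).exists_removable
      have hm := (h.succ_mem c y).2 ⟨by omega, hc⟩
      exact ⟨c, ⟨(h.mem_iff le_rfl).2 ⟨_, hm, by omega⟩, y + 1, by omega, hm⟩, hc.2⟩
  have hcard : ((Finset.Ico a b).image i).card = b - a ↔ Set.InjOn i (Finset.Ico a b) := by
    rw [← Finset.card_image_iff, Nat.card_Ico]
  rw [himage, hcard]
  constructor
  · rintro ⟨hread, hinj, hstrip⟩ y z hay hyz hzb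
    obtain ⟨⟨r, c⟩, hcy⟩ := h.exists_isLowestOcc (y := y) (by omega)
    obtain ⟨⟨r', c'⟩, hcz⟩ := h.exists_isLowestOcc (y := z) (by omega)
    have hty := h.content_of_isLowestOcc hcy
    have htz := h.content_of_isLowestOcc hcz
    have hremy := ((h.succ_mem _ _).1 hcy.1).2.1
    have hremz := ((h.succ_mem _ _).1 hcz.1).2.1
    have hby := (removable_iff.1 hremy).1
    have hbz := (removable_iff.1 hremz).1
    have hle := h.bead_le (x := y + 1) (y := z + 1) (r := r) (by omega) (by omega)
    have hlt : s (y + 1) (i y) < s (z + 1) (i z) := by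
      rcases hread (y + 1) (z + 1) (by simp; omega) (by simp; omega) (by omega) _ _ hcy hcz with
        hr | ⟨hr, hc⟩
      · have := bead_strictAnti (γ := δ (z + 1)) hr
        simp only at this
        omega
      · simp only at hr hc
        omega
    refine ⟨fun hiz => ?_, fun hiz => ?_, hlt⟩
    · exact absurd (hinj (by simp; omega) (by simp; omega) hiz) (by omega)
    · have hrep := h.rep (z + 1) (by omega)
      have hrepy := h.rep (y + 1) (by omega)
      have hv : ((s (y + 1) (i y) - 1 : ℤ) : ZMod (k + 1)) = i z := by
        push_cast; rw [hrepy.1, ← hiz]; ring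
      obtain ⟨ρ, hρ⟩ := (hrep.isBead_iff hv).2 (by omega)
      have hrρ : r < ρ := by
        by_contra! hcon
        have := (bead_strictAnti (γ := δ (z + 1))).antitone hcon
        omega
      have hmem : (ρ, c) ∈ δ (z + 1) := by
        rw [YoungDiagram.mem_iff_lt_rowLen]
        unfold bead at hρ
        omega
      obtain ⟨z', h1, h2, h3, -⟩ := h.exists_above hyz (by omega) hcy.1
        ((δ (z + 1)).up_left_mem hrρ le_rfl hmem)
      have := hstrip (r, c) (r + 1, c) ⟨y + 1, by simp; omega, hcy.1⟩
        ⟨z' + 1, by simp; omega, h3⟩ rfl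
      simp at this
  · intro hc
    have habove : ∀ {r c y z}, a ≤ y → y < z → z < b → y + 1 ∈ e (r, c) →
        (r + 1, c) ∉ δ (z + 1) := by
      intro r c y z hay hyz hzb hy hmem
      obtain ⟨z', h1, h2, -, h4⟩ := h.exists_above hyz (by omega) hy hmem
      exact (hc y z' hay h1 (by omega)).2.1 h4
    refine ⟨?_, ?_, ?_⟩
    · rintro y z hy hz hyz ⟨r, c⟩ ⟨r', c'⟩ hcy hcz
      rw [Finset.mem_Ioc] at hy hz
      obtain ⟨y, rfl⟩ := Nat.exists_eq_add_of_le' (show 1 ≤ y by omega)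
      obtain ⟨z, rfl⟩ := Nat.exists_eq_add_of_le' (show 1 ≤ z by omega)
      have hty := h.content_of_isLowestOcc hcy
      have htz := h.content_of_isLowestOcc hcz
      have hlt := (hc y z (by omega) (by omega) (by omega)).2.2
      unfold ReadBefore
      by_contra! hcon
      simp only at hcon
      rcases hcon.1.lt_or_eq with hr | hr
      · refine habove (by omega) (show y < z by omega) (by omega) hcy.1 ?_
        exact (δ (z + 1)).up_left_mem hr (show c ≤ c' by omega) ((h.succ_mem _ _).1 hcz.1).2.1.1
      · have := hcon.2 hr
        omega
    · intro y hy z hz hyz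
      simp only [Finset.coe_Ico, Set.mem_Ico] at hy hz
      rcases lt_trichotomy y z with hlt | rfl | hlt
      · exact absurd hyz.symm (hc y z hy.1 hlt hz.2).1
      · rfl
      · exact absurd hyz (hc z y hz.1 hlt hy.2).1
    · have key : ∀ r c r', (∃ y ∈ Finset.Ioc a b, y ∈ e (r, c)) →
          (∃ y ∈ Finset.Ioc a b, y ∈ e (r', c)) → ¬ r < r' := by
        rintro r c r' ⟨y, hy, hyc⟩ ⟨z, hz, hzc⟩ hr
        rw [Finset.mem_Ioc] at hy hz
        obtain ⟨y, rfl⟩ := Nat.exists_eq_add_of_le' (show 1 ≤ y by omega)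
        obtain ⟨z, rfl⟩ := Nat.exists_eq_add_of_le' (show 1 ≤ z by omega)
        have hmem : (r + 1, c) ∈ δ (z + 1) :=
          (δ (z + 1)).up_left_mem hr le_rfl (h.mem_of_mem hzc).2.2.1.1
        rcases lt_or_ge y z with hyz | hyz
        · exact habove (by omega) hyz (by omega) hyc hmem
        · exact (h.mem_of_mem hyc).2.2.1.2.1 (h.mono (by omega) (by omega) hmem)
      rintro ⟨r, c⟩ ⟨r', c'⟩ h1 h2 (rfl : c = c')
      have := key r c r' h1 h2
      have := key r' c r h2 h1
      exact Prod.ext (by simp only; omega) rfl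

end Growth

end Growth

section Bijection

variable {k : ℕ}

theorem sum_take_le_sum (α : List ℕ) (x : ℕ) : (α.take x).sum ≤ α.sum :=
  (List.take_sublist x α).sum_le_sum fun _ _ => Nat.zero_le _

theorem getD_eq_sum_take_sub {α : List ℕ} {x : ℕ} (hx : x < α.length) :
    α.getD x 0 = (α.take (x + 1)).sum - (α.take x).sum := by
  rw [List.sum_take_succ α x hx, Nat.add_sub_cancel_left, List.getD_eq_getElem _ _ hx]

variable [Nontrivial (ZMod (k + 1))]

theorem Growth.run_eq {n : ℕ} {δ : ℕ → YoungDiagram} {s : ℕ → Tops k} {i : ℕ → ZMod (k + 1)}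
    {e : ℕ × ℕ → Finset ℕ} (h : Growth n δ s i e) {y : ℕ} (hy : y ≤ n) :
    run (s 0) ((List.range y).map i) = some (s y) := by
  induction y with
  | zero => rfl
  | succ y ih =>
    rw [List.range_succ, List.map_append, run_append, ih (by omega)]
    simpa [run_singleton] using
      step_of_coreStep (h.rep y (by omega)) (h.rep (y + 1) hy) (h.coreStep y hy)

theorem Growth.compat_iff {n : ℕ} {δ : ℕ → YoungDiagram} {s : ℕ → Tops k} {i : ℕ → ZMod (k + 1)}
    {e : ℕ × ℕ → Finset ℕ} (h : Growth n δ s i e) {y z : ℕ} (hy : y < n) (hz : z < n) :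
    Compat (s 0) ((List.range n).map i) y z ↔
      i z ≠ i y ∧ i z + 1 ≠ i y ∧ s (y + 1) (i y) < s (z + 1) (i z) := by
  have htake : ∀ x < n, ((List.range n).map i).take (x + 1) = (List.range (x + 1)).map i := by
    intro x hx
    rw [← List.map_take, List.take_range, min_eq_left hx]
  have hget : ∀ x < n, ((List.range n).map i)[x]? = some (i x) := by
    intro x hx
    rw [List.getElem?_map, List.getElem?_range hx, Option.map_some]
  simp only [Compat, htake y hy, htake z hz, hget y hy, hget z hz, h.run_eq (Nat.succ_le_of_lt hy),
    h.run_eq (Nat.succ_le_of_lt hz), Option.some.injEq]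
  constructor
  · intro H
    exact H _ _ _ _ rfl rfl rfl rfl
  · rintro H _ _ _ _ rfl rfl rfl rfl
    exact H

theorem Growth.isASVT_iff {α : List ℕ} {δ : ℕ → YoungDiagram} {s : ℕ → Tops k}
    {i : ℕ → ZMod (k + 1)} {e : ℕ × ℕ → Finset ℕ} (h : Growth α.sum δ s i e) :
    IsASVT k α (δ α.sum) e ↔
      ValidWord α (s 0) ((List.range α.sum).map i) (s α.sum) := by
  unfold IsASVT ValidWord
  rw [and_iff_right h.isStdASVT, and_iff_right (h.run_eq le_rfl),
    and_iff_right (by simp)]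
  have hblock : ∀ x < α.length, _ := fun x (hx : x < α.length) =>
    h.block_iff (a := (α.take x).sum) (b := (α.take (x + 1)).sum) (sum_take_le_sum α _)
  constructor
  · intro H x hx y z hy hyz hz
    have hn := sum_take_le_sum α (x + 1)
    have h1 := H (x + 1) (by omega) hx
    simp only [alphaBlock, Nat.add_sub_cancel, getD_eq_sum_take_sub hx] at h1
    exact (h.compat_iff (by omega) (by omega)).2 ((hblock x hx).1 h1 y z hy hyz hz)
  · intro H x hx1 hx
    obtain ⟨x, rfl⟩ := Nat.exists_eq_add_of_le' hx1
    have hn := sum_take_le_sum α (x + 1)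
    simp only [alphaBlock, Nat.add_sub_cancel, getD_eq_sum_take_sub hx]
    exact (hblock x hx).2 fun y z hy hyz hz =>
      (h.compat_iff (by omega) (by omega)).1 (H x hx y z hy hyz hz)

theorem exists_growth {p q : Tops k} {w : List (ZMod (k + 1))} (hp : Rep ⊥ p)
    (hw : run p w = some q) : ∃ δ s, ∃ i : ℕ → ZMod (k + 1), ∃ e,
      Growth w.length δ s i e ∧ s 0 = p ∧ s w.length = q ∧ (List.range w.length).map i = w := by
  have hex : ∀ y, ∃ (δ : YoungDiagram) (s : Tops k), run p (w.take y) = some s ∧ Rep δ s := by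
    intro y
    induction y with
    | zero => exact ⟨⊥, p, rfl, hp⟩
    | succ y ih =>
      obtain ⟨δ, s, hs, hδ⟩ := ih
      rcases lt_or_ge y w.length with hy | hy
      · have h1 : run p (w.take (y + 1) ++ w.drop (y + 1)) = some q := by
          rwa [List.take_append_drop]
        rw [run_append, Option.bind_eq_some_iff] at h1
        obtain ⟨t, ht, -⟩ := h1
        have h2 := ht
        rw [List.take_succ_eq_append_getElem hy, run_append, hs, Option.bind_some,
          run_singleton] at h2
        obtain ⟨δ', hδ', -⟩ := exists_coreStep hδ h2
        exact ⟨δ', t, ht, hδ'⟩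
      · refine ⟨δ, s, ?_, hδ⟩
        rw [List.take_of_length_le (by omega)] at hs ⊢
        exact hs
  choose δ s hs hδ using hex
  have hs0 : s 0 = p := Option.some_injective _ ((hs 0).symm.trans rfl)
  have hsn : s w.length = q := by
    have := hs w.length
    rw [List.take_length, hw] at this
    exact (Option.some_injective _ this).symm
  let i : ℕ → ZMod (k + 1) := fun y => w.getD y 0
  refine ⟨δ, s, i, fun c => ((Finset.range w.length).filter fun y =>
    Removable (δ (y + 1)) c ∧ residue k c = i y).image (· + 1),
    ⟨?_, fun y _ => hδ y, fun y hy => ?_, fun c => by simp, fun c y => by simp⟩, hs0, hsn, ?_⟩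
  · have := hδ 0
    rw [hs0] at this
    exact this.unique_left hp
  · have h2 := hs (y + 1)
    rw [List.take_succ_eq_append_getElem hy, run_append, hs, Option.bind_some,
      run_singleton] at h2
    obtain ⟨δ', hδ', hc⟩ := exists_coreStep (hδ y) h2
    rw [(hδ (y + 1)).unique_left hδ']
    simpa only [i, List.getD_eq_getElem _ _ hy] using hc
  · refine List.ext_getElem (by simp) fun y h1 h2 => ?_
    simp [i, h2]

/-- Affine set-valued tableaux are in bijection with valid words. -/
theorem card_isASVT {α : List ℕ} {γ : YoungDiagram} {p q : Tops k} (hp : Rep ⊥ p)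
    (hq : Rep γ q) : Nat.card {e // IsASVT k α γ e} = Nat.card {w // ValidWord α p w q} := by
  have hex : ∀ e : {e // IsASVT k α γ e}, ∃ w : {w // ValidWord α p w q}, ∃ δ s i,
      Growth α.sum δ s i e.1 ∧ (List.range α.sum).map i = w.1 := by
    rintro ⟨e, he⟩
    obtain ⟨δ, s, i, h, rfl⟩ := Growth.exists_of_isStdASVT he.1
    have h0 := h.rep 0 (Nat.zero_le _)
    rw [h.zero] at h0
    have hv := h.isASVT_iff.1 he
    rw [h0.unique hp, (h.rep _ le_rfl).unique hq] at hv
    exact ⟨⟨_, hv⟩, δ, s, i, h, rfl⟩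
  choose f hf using hex
  refine Nat.card_congr (Equiv.ofBijective f ⟨?_, ?_⟩)
  · intro e e' hee
    obtain ⟨δ, s, i, h, hi⟩ := hf e
    obtain ⟨δ', s', i', h', hi'⟩ := hf e'
    rw [← hee, ← hi] at hi'
    have hii : ∀ y < α.sum, i' y = i y := fun y hy => by
      have := congrArg (fun l : List (ZMod (k + 1)) => l[y]?) hi'
      simpa [List.getElem?_range hy] using this
    have h'' := h'.congr_residue hii
    have h0 := h.rep 0 (Nat.zero_le _)
    rw [h.zero] at h0
    have h0' := h'.rep 0 (Nat.zero_le _)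
    rw [h'.zero] at h0'
    refine Subtype.ext (h.filling_eq h'' fun y hy => ?_)
    have h1 := h.run_eq hy
    have h2 := h''.run_eq hy
    rw [h0'.unique h0, h1, Option.some.injEq] at h2
    have h3 := h'.rep y hy
    rw [← h2] at h3
    exact (h.rep y hy).unique_left h3
  · rintro ⟨w, hw⟩
    obtain ⟨δ, s, i, e, h, rfl, rfl, hi⟩ := exists_growth hp hw.1
    rw [hw.2.1] at h hi hq
    have hγ := hq.unique_left (h.rep _ le_rfl)
    have hw' := hw
    rw [hw.2.1, ← hi] at hw'
    have he := h.isASVT_iff.2 hw'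
    rw [← hγ] at he
    refine ⟨⟨e, he⟩, Subtype.ext ?_⟩
    obtain ⟨δ', s', i', h', hi'⟩ := hf ⟨e, he⟩
    refine hi'.symm.trans (Eq.trans ?_ hi)
    exact List.map_congr_left fun y hy => (h.residue_eq h' (List.mem_range.1 hy)).symm

end Bijection

section Basis

theorem prod_map_hSym {l : List ℕ} (hl : ∀ r ∈ l, 0 < r) : (l.map hSym).prod =
    MvPolynomial.monomial (Multiset.toFinsupp ((l : Multiset ℕ).map fun r => r - 1)) (1 : ℤ) := by
  induction l with
  | nil => simp
  | cons r l ih =>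
    obtain ⟨n, rfl⟩ := Nat.exists_eq_add_of_le' (show 1 ≤ r from hl r (by simp))
    rw [List.map_cons, List.prod_cons, ih fun x hx => hl x (by simp [hx]), ← Multiset.cons_coe,
      Multiset.map_cons, ← Multiset.singleton_add, Multiset.toFinsupp_add,
      Multiset.toFinsupp_singleton, Nat.add_sub_cancel]
    simp [hSym, MvPolynomial.X, MvPolynomial.monomial_mul]

theorem hProd_eq_monomial (lam : YoungDiagram) :
    hProd lam = MvPolynomial.monomial (hExp lam) (1 : ℤ) :=
  prod_map_hSym lam.pos_of_mem_rowLens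

theorem hExp_injective : Function.Injective hExp := by
  intro lam mu h
  have h1 := Multiset.toFinsupp.injective h
  have h2 := congrArg (Multiset.map (· + 1)) h1
  have h3 : ∀ ν : YoungDiagram, Multiset.map (· + 1)
      ((ν.rowLens : Multiset ℕ).map fun r => r - 1) = ν.rowLens := by
    intro ν
    rw [Multiset.map_map]
    refine (Multiset.map_congr rfl fun r hr => ?_).trans (Multiset.map_id _)
    exact Nat.sub_add_cancel (ν.pos_of_mem_rowLens r hr)
  rw [h3, h3, Multiset.coe_eq_coe] at h2
  have h4 : lam.rowLens = mu.rowLens :=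
    h2.eq_of_pairwise (fun _ _ _ _ h1 h2 => le_antisymm h2 h1)
      lam.rowLens_sorted.pairwise mu.rowLens_sorted.pairwise
  exact YoungDiagram.equivListRowLens.injective (Subtype.ext h4)

theorem linearIndependent_hProd : LinearIndependent ℤ hProd := by
  have h := (MvPolynomial.basisMonomials ℕ ℤ).linearIndependent.comp hExp hExp_injective
  rw [MvPolynomial.coe_basisMonomials] at h
  rw [show hProd = (fun s => MvPolynomial.monomial s (1 : ℤ)) ∘ hExp from
    funext hProd_eq_monomial]
  exact h

variable {k : ℕ}

theorem hProd_mem_LambdaK {lam : YoungDiagram} (h : IsKBounded k lam) : hProd lam ∈ LambdaK k := by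
  refine Subalgebra.list_prod_mem _ fun x hx => ?_
  obtain ⟨r, hr, rfl⟩ := List.mem_map.1 hx
  have hrk : r ≤ k := by
    obtain ⟨i, hi, rfl⟩ := List.mem_iff_getElem.1 hr
    simpa [YoungDiagram.rowLens] using h i
  cases r with
  | zero => exact Subalgebra.one_mem _
  | succ n => exact MvPolynomial.X_mem_supported.2 (show n < k by omega)

theorem exists_hProd_eq_monomial {m : ℕ →₀ ℕ} (hm : ∀ n ∈ m.support, n < k) :
    ∃ lam, IsKBounded k lam ∧ hProd lam = MvPolynomial.monomial m (1 : ℤ) := by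
  set l := ((Finsupp.toMultiset m).map (· + 1)).sort (· ≥ ·) with hl
  have hmem : ∀ r ∈ l, 0 < r ∧ r ≤ k := by
    intro r hr
    rw [hl, Multiset.mem_sort, Multiset.mem_map] at hr
    obtain ⟨n, hn, rfl⟩ := hr
    have := hm n (by rwa [Finsupp.mem_toMultiset] at hn)
    omega
  have hsort : l.SortedGE := (Multiset.pairwise_sort _ _).sortedGE
  refine ⟨YoungDiagram.ofRowLens l hsort, fun i => ?_, ?_⟩
  · rcases lt_or_ge i l.length with hi | hi
    · rw [YoungDiagram.rowLen_ofRowLens (hw := hsort) ⟨i, hi⟩]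
      exact (hmem _ (List.getElem_mem _)).2
    · by_contra! hcon
      have h0 : (i, 0) ∈ YoungDiagram.ofRowLens l hsort :=
        YoungDiagram.mem_iff_lt_rowLen.2 (by omega)
      obtain ⟨h1, -⟩ := YoungDiagram.mem_ofRowLens.1 h0
      exact absurd h1 (by simpa using hi)
  · rw [hProd, YoungDiagram.rowLens_ofRowLens_eq_self fun r hr => (hmem r hr).1,
      prod_map_hSym fun r hr => (hmem r hr).1, hl, Multiset.sort_eq, Multiset.map_map]
    congr 2
    simp

theorem mem_span_hProd {f : SymFunc} (hf : f ∈ LambdaK k) :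
    f ∈ Submodule.span ℤ (hProd '' {lam | IsKBounded k lam}) := by
  rw [f.as_sum]
  refine Submodule.sum_mem _ fun m hm => ?_
  obtain ⟨lam, hlam, h⟩ := exists_hProd_eq_monomial (k := k) (m := m) fun n hn =>
    MvPolynomial.mem_supported.1 hf ((MvPolynomial.mem_vars_iff_mem_support _).2 ⟨m, hm, hn⟩)
  rw [show MvPolynomial.monomial m (MvPolynomial.coeff m f) =
    MvPolynomial.coeff m f • MvPolynomial.monomial m (1 : ℤ) by simp [MvPolynomial.smul_monomial],
    ← h]
  exact Submodule.smul_mem _ _ (Submodule.subset_span ⟨lam, hlam, rfl⟩)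

theorem finite_card_le (d : ℕ) : {μ : YoungDiagram | μ.card ≤ d}.Finite := by
  have hinj : Function.Injective YoungDiagram.cells := fun _ _ h => YoungDiagram.ext h
  refine Set.Finite.of_finite_image (f := YoungDiagram.cells) ?_ hinj.injOn
  refine ((Finset.range d ×ˢ Finset.range d).powerset.finite_toSet).subset ?_
  rintro _ ⟨μ, hμ, rfl⟩
  simp only [Finset.coe_powerset, Set.mem_preimage, Set.mem_powerset_iff, Finset.coe_subset]
  rintro ⟨r, c⟩ hrc
  rw [YoungDiagram.mem_cells] at hrc
  have hμ : μ.cells.card ≤ d := hμ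
  have h1 := YoungDiagram.mem_iff_lt_rowLen.1 hrc
  have h2 := YoungDiagram.mem_iff_lt_colLen.1 hrc
  rw [μ.rowLen_eq_card] at h1
  rw [μ.colLen_eq_card] at h2
  have h3 : (μ.row r).card ≤ μ.cells.card := Finset.card_le_card (Finset.filter_subset _ _)
  have h4 : (μ.col c).card ≤ μ.cells.card := Finset.card_le_card (Finset.filter_subset _ _)
  simp only [Finset.mem_product, Finset.mem_range]
  omega

end Basis

section Conclusion

variable {k : ℕ}

theorem phi_prod_map_hSym (l : List ℕ) :
    phi k (l.map hSym).prod = (-1 : ℤ) ^ l.sum • (l.map (hOp k)).prod := by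
  induction l with
  | nil => simp
  | cons r l ih =>
    rw [List.map_cons, List.prod_cons, map_mul, ih, phi_hSym, List.sum_cons, List.map_cons,
      List.prod_cons, pow_add, smul_mul_smul_comm]

theorem sum_rowLens (lam : YoungDiagram) : lam.rowLens.sum = lam.card := by
  rw [card_eq_sum_rowLen le_rfl, YoungDiagram.rowLens, Finset.sum_range, ← List.sum_ofFn]
  congr 1
  exact List.ext_getElem (by simp) (by simp)

theorem prod_reverse_map_hOp (l : List ℕ) :
    (l.reverse.map (hOp k)).prod = (l.map (hOp k)).prod := by
  refine ((List.reverse_perm l).map (hOp k)).prod_eq' ?_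
  exact List.pairwise_map.2 (List.pairwise_of_forall fun r s => hOp_commute r s)

/-- The image of the vacuum vector under the operator attached to a symmetric function. -/
noncomputable def evalAt (p : Tops k) : SymFunc →ₗ[ℤ] Tops k →₀ ℤ :=
  LinearMap.applyₗ (Finsupp.single p 1) ∘ₗ (phi k).toLinearMap

theorem evalAt_apply (p : Tops k) (f : SymFunc) :
    evalAt p f = phi k f (Finsupp.single p 1) := rfl

/-- The `k`-bounded partitions of size at most `d`. -/
noncomputable def boundedFinset (k d : ℕ) : Finset YoungDiagram :=
  (finite_card_le d).toFinset.filter (IsKBounded k)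

theorem mem_boundedFinset {d : ℕ} {μ : YoungDiagram} :
    μ ∈ boundedFinset k d ↔ IsKBounded k μ ∧ μ.card ≤ d := by
  simp [boundedFinset, and_comm]

/-- The signed affine set-valued Kostka numbers. -/
noncomputable def signedKcal (k : ℕ) (lam μ : YoungDiagram) : ℤ :=
  (-1) ^ (lam.card + μ.card) * (Kcal k μ lam.rowLens : ℤ)

theorem KKSchurSystem.hProd_eq {g : YoungDiagram → SymFunc} (hg : KKSchurSystem k g)
    {lam : YoungDiagram} (hlam : IsKBounded k lam) :
    hProd lam = ∑ μ ∈ boundedFinset k lam.card, signedKcal k lam μ • g μ := by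
  rw [hg.2 lam hlam, finsum_eq_sum_of_support_subset (s := boundedFinset k lam.card)]
  · exact Finset.sum_congr rfl fun μ hμ => if_pos (mem_boundedFinset.1 hμ)
  · intro μ hμ
    by_contra hcon
    exact hμ (if_neg fun h => hcon (Finset.mem_coe.2 (mem_boundedFinset.2 h)))

/-- The signed value of a family indexed by partitions at a state encoding a core. -/
noncomputable def stateValue (G : YoungDiagram → SymFunc) (q : Tops k) : SymFunc :=
  if h : ∃ γ, Rep γ q then
    (-1 : ℤ) ^ (pPart k h.choose).card • G (pPart k h.choose)
  else 0

theorem stateValue_of_rep (G : YoungDiagram → SymFunc) {γ : YoungDiagram} {q : Tops k}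
    (h : Rep γ q) :
    stateValue G q = (-1 : ℤ) ^ (pPart k γ).card • G (pPart k γ) := by
  have hex : ∃ γ, Rep γ q := ⟨γ, h⟩
  rw [stateValue, dif_pos hex, hex.choose_spec.unique_left h]

/-- The state encoding the core of a bounded partition. -/
noncomputable def stateOf (k : ℕ) (μ : YoungDiagram) : Tops k :=
  if h : ∃ q, Rep (coreOf k μ) q then h.choose else fun _ => 0

theorem rep_stateOf {μ : YoungDiagram} (h : IsKBounded k μ) : Rep (coreOf k μ) (stateOf k μ) := by
  have hex : ∃ q : Tops k, Rep (coreOf k μ) q := (coreOf_spec h).1.exists_rep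
  rw [stateOf, dif_pos hex]
  exact hex.choose_spec

theorem stateOf_injOn : Set.InjOn (stateOf k) {μ | IsKBounded k μ} := by
  intro μ hμ ν hν h
  have h1 := rep_stateOf hμ
  rw [h] at h1
  rw [← pPart_coreOf hμ, h1.unique_left (rep_stateOf hν), pPart_coreOf hν]

theorem pSize_bot : pSize k ⊥ = 0 := by simp [pSize]

theorem isCore_bot : IsCore (k + 1) ⊥ := fun _ hc => absurd hc (YoungDiagram.notMem_bot _)

theorem stateValue_tau (G : YoungDiagram → SymFunc) (q : Tops k) :
    stateValue G (tau q) = stateValue (G ∘ kConj k) q := by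
  by_cases h : ∃ γ, Rep γ q
  · obtain ⟨γ, hγ⟩ := h
    have hc := hγ.isCore
    rw [stateValue_of_rep _ hγ.transpose, stateValue_of_rep _ hγ, card_pPart hc.transpose,
      card_pPart hc, pSize_transpose, Function.comp_apply, kConj, coreOf_pPart hc]
  · rw [stateValue, stateValue, dif_neg h, dif_neg]
    rintro ⟨γ, hγ⟩
    have := hγ.transpose
    rw [tau_tau] at this
    exact h ⟨_, this⟩

theorem linearCombination_tauOp (G : YoungDiagram → SymFunc) (v : Tops k →₀ ℤ) :
    Finsupp.linearCombination ℤ (stateValue G) (tauOp k ℤ v) =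
      Finsupp.linearCombination ℤ (stateValue (G ∘ kConj k)) v := by
  have : Finsupp.linearCombination ℤ (stateValue G) ∘ₗ tauOp k ℤ =
      Finsupp.linearCombination ℤ (stateValue (k := k) (G ∘ kConj k)) := by
    ext q : 2
    simp [tauOp, lin_single, stateValue_tau]
  exact LinearMap.congr_fun this v

theorem sum_boundedFinset_eq {d : ℕ} {lam : YoungDiagram} (hd : lam.card ≤ d)
    (G : YoungDiagram → SymFunc) :
    ∑ μ ∈ boundedFinset k lam.card, signedKcal k lam μ • G μ =
      ∑ μ : boundedFinset k d,
        (if μ.1.card ≤ lam.card then signedKcal k lam μ else 0) • G μ := by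
  rw [Finset.sum_coe_sort (boundedFinset k d)
    fun μ => (if μ.card ≤ lam.card then signedKcal k lam μ else 0) • G μ]
  simp only [ite_smul, zero_smul]
  rw [← Finset.sum_filter]
  congr 1
  ext μ
  simp only [Finset.mem_filter, mem_boundedFinset]
  exact ⟨fun h => ⟨⟨h.1, h.2.trans hd⟩, h.2⟩, fun h => ⟨h.1.1, h.2⟩⟩

variable [Nontrivial (ZMod (k + 1))]

theorem evalAt_hProd {p : Tops k} (hp : ∀ j, (p j : ZMod (k + 1)) = j) (lam : YoungDiagram)
    (q : Tops k) : evalAt p (hProd lam) q =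
      (-1) ^ lam.card * (Nat.card {w // ValidWord lam.rowLens p w q} : ℤ) := by
  rw [card_validWord _ hp, prod_reverse_map_hOp, evalAt_apply, hProd, phi_prod_map_hSym,
    sum_rowLens, LinearMap.smul_apply, Finsupp.smul_apply, smul_eq_mul]

theorem exists_rep_of_run {p q : Tops k} {γ : YoungDiagram} (hp : Rep γ p)
    {w : List (ZMod (k + 1))} (h : run p w = some q) :
    ∃ δ, Rep δ q ∧ pSize k δ ≤ pSize k γ + w.length := by
  induction w using List.reverseRecOn generalizing q with
  | nil =>
    obtain rfl : p = q := by simpa [run] using h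
    exact ⟨γ, hp, le_rfl⟩
  | append_singleton w i ih =>
    rw [run_append, Option.bind_eq_some_iff] at h
    obtain ⟨r, h1, h2⟩ := h
    rw [run_singleton] at h2
    obtain ⟨δ, hδ, hle⟩ := ih h1
    obtain ⟨ε, hε, -⟩ := exists_coreStep hδ h2
    have := pSize_le_of_step hδ hε h2
    exact ⟨ε, hε, by simp; omega⟩

theorem linearCombination_stateValue {p : Tops k} (hp : Rep ⊥ p) (G : YoungDiagram → SymFunc)
    (lam : YoungDiagram) :
    Finsupp.linearCombination ℤ (stateValue G) (evalAt p (hProd lam)) =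
      ∑ μ ∈ boundedFinset k lam.card, signedKcal k lam μ • G μ := by
  have hcoe := evalAt_hProd hp.1 lam
  have hterm : ∀ μ ∈ boundedFinset k lam.card, signedKcal k lam μ • G μ =
      evalAt p (hProd lam) (stateOf k μ) • stateValue G (stateOf k μ) := by
    intro μ hμ
    have hb := (mem_boundedFinset.1 hμ).1
    rw [stateValue_of_rep G (rep_stateOf hb), pPart_coreOf hb, hcoe,
      ← card_isASVT hp (rep_stateOf hb), smul_smul, signedKcal, Kcal]
    congr 1
    ring
  rw [Finset.sum_congr rfl hterm,
    ← Finset.sum_image (g := stateOf k) (f := fun q => evalAt p (hProd lam) q • stateValue G q)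
      fun μ hμ ν hν => stateOf_injOn (mem_boundedFinset.1 hμ).1 (mem_boundedFinset.1 hν).1,
    Finsupp.linearCombination_apply, Finsupp.sum]
  refine Finset.sum_subset (fun q hq => ?_) fun q _ hq => ?_
  · rw [Finsupp.mem_support_iff, hcoe] at hq
    have hne : Nat.card {w // ValidWord lam.rowLens p w q} ≠ 0 := fun h => hq (by simp [h])
    obtain ⟨⟨w, hw⟩⟩ := (Nat.card_ne_zero.1 hne).1
    obtain ⟨δ, hδ, hle⟩ := exists_rep_of_run hp hw.1
    rw [hw.2.1, sum_rowLens, pSize_bot, zero_add] at hle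
    have hb := isKBounded_pPart hδ.isCore
    refine Finset.mem_image.2 ⟨pPart k δ, mem_boundedFinset.2 ⟨hb, ?_⟩, ?_⟩
    · rwa [card_pPart hδ.isCore]
    · have := rep_stateOf hb
      rw [coreOf_pPart hδ.isCore] at this
      exact this.unique hδ
  · rw [Finsupp.notMem_support_iff.1 hq, zero_smul]

theorem evalAt_OmegaMap {p : Tops k} (hp : Rep ⊥ p) {f : SymFunc} (hf : f ∈ LambdaK k) :
    evalAt p (OmegaMap f) = tauOp k ℤ (evalAt p f) := by
  have h : tau p = p := by
    have h1 := hp.transpose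
    rw [show (⊥ : YoungDiagram).transpose = ⊥ by ext; simp] at h1
    exact h1.unique hp
  rw [evalAt_apply, phi_OmegaMap hf, evalAt_apply, Module.End.mul_apply, Module.End.mul_apply,
    show tauOp k ℤ (Finsupp.single p 1) = Finsupp.single p 1 by
      rw [tauOp, lin_single, Option.elim_some, h]]

theorem KKSchurSystem.linearCombination_evalAt {g : YoungDiagram → SymFunc}
    (hg : KKSchurSystem k g) {p : Tops k} (hp : Rep ⊥ p) {f : SymFunc} (hf : f ∈ LambdaK k) :
    Finsupp.linearCombination ℤ (stateValue g) (evalAt p f) = f := by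
  have h := mem_span_hProd hf
  clear hf
  induction h using Submodule.span_induction with
  | mem x hx =>
    obtain ⟨lam, hlam, rfl⟩ := hx
    rw [linearCombination_stateValue hp, ← hg.hProd_eq hlam]
  | zero => simp
  | add x y _ _ hx hy => rw [map_add, map_add, hx, hy]
  | smul c x _ hx => rw [map_smul, map_smul, hx]

theorem KKSchurSystem.sum_smul_sub_eq_zero {g : YoungDiagram → SymFunc} (hg : KKSchurSystem k g)
    {lam : YoungDiagram} (hlam : IsKBounded k lam) :
    ∑ μ ∈ boundedFinset k lam.card,
      signedKcal k lam μ • (OmegaMap (g μ) - g (kConj k μ)) = 0 := by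
  obtain ⟨p, hp⟩ := (isCore_bot (k := k)).exists_rep
  have hmem := hProd_mem_LambdaK hlam
  have h1 := hg.linearCombination_evalAt hp (OmegaMap_mem_LambdaK hmem)
  rw [evalAt_OmegaMap hp hmem, linearCombination_tauOp, linearCombination_stateValue hp] at h1
  have h2 := congrArg OmegaMap (hg.hProd_eq hlam)
  rw [← h1, map_sum] at h2
  simp only [smul_sub, Finset.sum_sub_distrib, sub_eq_zero]
  simpa using h2.symm

section Inversion

variable {ι M : Type*} [Fintype ι] [DecidableEq ι] [AddCommGroup M]

theorem det_ne_zero_of_linearIndependent {a : Matrix ι ι ℤ} {u v : ι → M}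
    (hu : LinearIndependent ℤ u) (h : ∀ i, u i = ∑ j, a i j • v j) : a.det ≠ 0 := by
  intro h0
  obtain ⟨c, hc, hca⟩ := Matrix.exists_vecMul_eq_zero_iff.2 h0
  refine hc (funext (Fintype.linearIndependent_iff.1 hu c ?_))
  simp only [h, Finset.smul_sum, smul_smul]
  rw [Finset.sum_comm]
  refine Finset.sum_eq_zero fun j _ => ?_
  rw [← Finset.sum_smul, show ∑ i, c i * a i j = 0 from congrFun hca j, zero_smul]

theorem det_smul_eq_zero {a : Matrix ι ι ℤ} {v : ι → M} (h : ∀ i, ∑ j, a i j • v j = 0) (j : ι) :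
    a.det • v j = 0 := by
  have h1 : ∑ l, (a.adjugate * a) j l • v l = 0 := by
    simp only [Matrix.mul_apply, Finset.sum_smul, mul_smul]
    rw [Finset.sum_comm]
    simp only [← Finset.smul_sum, h, smul_zero, Finset.sum_const_zero]
  simpa [Matrix.adjugate_mul, Matrix.one_apply, Finset.sum_ite_eq] using h1

end Inversion

end Conclusion

/-- For any `k`-bounded partition `λ`, `Ω(g^{(k)}_λ) = g^{(k)}_{λ^{ω_k}}`,
where `Ω` is the algebra endomorphism of `Λ` determined by
`Ω(h_ℓ) = Σ_{j=1}^ℓ binom(ℓ-1, j-1) e_j` and `λ^{ω_k} = 𝔭(𝔠(λ)')` is the `k`-conjugate. -/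
theorem Omega_kKSchur
    (k : ℕ) (hk : 1 ≤ k) (g : YoungDiagram → SymFunc) (hg : KKSchurSystem k g)
    (lam : YoungDiagram) (hlam : IsKBounded k lam) :
    OmegaMap (g lam) = g (kConj k lam) := by
  have : Fact (1 < k + 1) := ⟨by omega⟩
  let a : Matrix (boundedFinset k lam.card) (boundedFinset k lam.card) ℤ := fun κ μ =>
    if μ.1.card ≤ κ.1.card then signedKcal k κ μ else 0
  have hmem (κ : boundedFinset k lam.card) := mem_boundedFinset.1 κ.2
  have hdet : a.det ≠ 0 := det_ne_zero_of_linearIndependent (v := fun μ => g μ.1)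
    (linearIndependent_hProd.comp _ Subtype.val_injective) fun κ => by
      rw [Function.comp_apply, hg.hProd_eq (hmem κ).1, sum_boundedFinset_eq (hmem κ).2]
  have hzero := det_smul_eq_zero (a := a) (v := fun μ => OmegaMap (g μ.1) - g (kConj k μ.1))
    (fun κ => (sum_boundedFinset_eq (hmem κ).2 fun μ => OmegaMap (g μ) - g (kConj k μ)).symm.trans
      (hg.sum_smul_sub_eq_zero (hmem κ).1)) ⟨lam, mem_boundedFinset.2 ⟨hlam, le_rfl⟩⟩
  exact sub_eq_zero.1 ((smul_eq_zero.1 hzero).resolve_left hdet)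

end AffineKTheory
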